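/- Let φ be a nontrivial classical solution of the linear parabolic equation φₜ = a(t,x) φₓₓ + b(t,x) φₓ + c(t,x) φ on (0,∞) × ℝ, 2π-periodic in x. Then there exist T > 0 and a natural number N such that for every t ≥ T all zeros of φ(t,·) are simple (φ(t,x) = 0 implies ∂ₓφ(t,x) ≠ 0) and z(φ(t,·)) = N; in particular the zero number drops only finitely many times. -/

import Mathlib

open Real Set Filter

noncomputable def zeroNum (u : ℝ → ℝ) : ℕ∞ :=
  {x ∈ Set.Ico (0 : ℝ) (2 * Real.pi) | u x = 0}.encard

namespace ZN

open Topology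

def Pat (u : ℝ → ℝ) (k : ℕ) : Prop :=
  ∃ x : ℕ → ℝ, (∀ i j, i < j → j < k → x i < x j) ∧ (∀ j < k, x j < x 0 + 2 * π) ∧
    (∀ j < k, 0 < (-1 : ℝ) ^ j * u (x j))

lemma second_deriv_nonpos {f f' : ℝ → ℝ} {f'' x : ℝ}
    (hf : ∀ y, HasDerivAt f (f' y) y) (hf' : HasDerivAt f' f'' x)
    (hm : IsLocalMax f x) : f'' ≤ 0 := by
  by_contra h
  push Not at h
  have hd : deriv f = f' := funext fun y => (hf y).deriv
  have h0 : deriv f x = 0 := hm.deriv_eq_zero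
  have hmin : IsLocalMin f x := by
    apply isLocalMin_of_deriv_deriv_pos
    · rw [hd, hf'.deriv]; exact h
    · exact h0
    · exact (hf x).continuousAt
  have hc : f =ᶠ[𝓝 x] fun _ => f x := by
    filter_upwards [hm, hmin] with y h1 h2
    exact le_antisymm h1 h2
  have h1 : deriv f =ᶠ[𝓝 x] deriv (fun _ => f x) := hc.deriv
  have h2 : deriv (deriv f) x = 0 := by
    rw [h1.deriv_eq]; simp
  rw [hd, hf'.deriv] at h2
  linarith

lemma deriv_nonneg_of_left_max {h : ℝ → ℝ} {h' x : ℝ} (hd : HasDerivAt h h' x)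
    (hm : ∀ᶠ t in 𝓝[<] x, h t ≤ h x) : 0 ≤ h' := by
  have h1 := (hasDerivWithinAt_iff_tendsto_slope' (s := Iio x) (by simp)).1
    (hd.hasDerivWithinAt (s := Iio x))
  apply ge_of_tendsto h1
  filter_upwards [hm, self_mem_nhdsWithin] with t h2 h3
  rw [slope_def_field]
  exact div_nonneg_of_nonpos (by linarith) (by have : t < x := h3; linarith)

theorem pat_mono (M : ℝ)
    (a b c φ φ_t φ_x φ_xx : ℝ → ℝ → ℝ)
    (hc : ∀ t > (0:ℝ), ∀ x : ℝ, |c t x| ≤ M)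
    (ha_pos : ∀ t > (0:ℝ), ∀ x : ℝ, 0 < a t x)
    (hφ_per : ∀ t > (0:ℝ), ∀ x : ℝ, φ t (x + 2 * Real.pi) = φ t x)
    (hφ_cont : ContinuousOn (fun p : ℝ × ℝ => φ p.1 p.2) (Set.Ioi 0 ×ˢ Set.univ))
    (hφ_t : ∀ t > (0:ℝ), ∀ x : ℝ, HasDerivAt (fun s => φ s x) (φ_t t x) t)
    (hφ_x : ∀ t > (0:ℝ), ∀ x : ℝ, HasDerivAt (fun y => φ t y) (φ_x t x) x)
    (hφ_xx : ∀ t > (0:ℝ), ∀ x : ℝ, HasDerivAt (fun y => φ_x t y) (φ_xx t x) x)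
    (heq : ∀ t > (0:ℝ), ∀ x : ℝ,
      φ_t t x = a t x * φ_xx t x + b t x * φ_x t x + c t x * φ t x)
    (k : ℕ) (hk : Even k) (s T : ℝ) (hs : 0 < s) (hsT : s ≤ T) (hP : Pat (φ T) k) :
    Pat (φ s) k := by
  rcases Nat.eq_zero_or_pos k with rfl | hk0
  · exact ⟨fun _ => 0, by simp, by simp, by simp⟩
  haveI : NeZero k := ⟨hk0.ne'⟩
  set ψ : ℝ → ℝ → ℝ := fun t x => φ (max t s) x with hψ
  have hψc : Continuous (fun p : ℝ × ℝ => ψ p.1 p.2) := by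
    have : Continuous (fun p : ℝ × ℝ => ((max p.1 s, p.2) : ℝ × ℝ)) := by fun_prop
    exact hφ_cont.comp_continuous this (fun p => by
      simp only [mem_prod, mem_Ioi, mem_univ, and_true]; exact lt_of_lt_of_le hs (le_max_right _ _))
  have hψe : ∀ t, s ≤ t → ∀ x, ψ t x = φ t x := fun t ht x => by simp [hψ, max_eq_left ht]
  have hψper : ∀ t x, ψ t (x + 2 * π) = ψ t x := fun t x =>
    hφ_per _ (lt_of_lt_of_le hs (le_max_right _ _)) x
  have hψperz : ∀ t x (n : ℤ), ψ t (x + n * (2 * π)) = ψ t x := fun t x n =>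
    (show Function.Periodic (ψ t) (2 * π) from hψper t).int_mul n x
  set lam : ℝ := k * M + 1
  let K' : Set (ℝ × (Fin k → ℝ)) := {p | p.1 ∈ Icc s T ∧ (∀ i j, i ≤ j → p.2 i ≤ p.2 j) ∧
    (∀ j, p.2 j ≤ p.2 0 + 2 * π) ∧ ∀ j : Fin k, 0 ≤ (-1 : ℝ) ^ (j : ℕ) * ψ p.1 (p.2 j)}
  let K : Set (ℝ × (Fin k → ℝ)) := (Icc s T ×ˢ Icc (fun _ => 0) (fun _ => 4 * π)) ∩ K'
  let g : ℝ × (Fin k → ℝ) → ℝ := fun p =>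
    Real.exp (-lam * p.1) * ∏ j : Fin k, ((-1 : ℝ) ^ (j : ℕ) * ψ p.1 (p.2 j))
  have hψj : ∀ j : Fin k, Continuous fun p : ℝ × (Fin k → ℝ) => ψ p.1 (p.2 j) := fun j =>
    hψc.comp (by fun_prop : Continuous fun p : ℝ × (Fin k → ℝ) => (p.1, p.2 j))
  have hgc : Continuous g := by
    refine Continuous.mul (by fun_prop) ?_
    exact continuous_finsetProd _ fun j _ => continuous_const.mul (hψj j)
  have hK'c : IsClosed K' := by
    have h1 : IsClosed {p : ℝ × (Fin k → ℝ) | p.1 ∈ Icc s T} :=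
      isClosed_Icc.preimage continuous_fst
    have h2 : IsClosed {p : ℝ × (Fin k → ℝ) | ∀ i j, i ≤ j → p.2 i ≤ p.2 j} := by
      simp only [ofPred_forall]
      refine isClosed_iInter fun i => isClosed_iInter fun j => isClosed_iInter fun _ =>
        isClosed_le (by fun_prop) (by fun_prop)
    have h3 : IsClosed {p : ℝ × (Fin k → ℝ) | ∀ j, p.2 j ≤ p.2 0 + 2 * π} := by
      simp only [ofPred_forall]
      exact isClosed_iInter fun j => isClosed_le (by fun_prop) (by fun_prop)
    have h4 : IsClosed {p : ℝ × (Fin k → ℝ) | ∀ j : Fin k, 0 ≤ (-1 : ℝ) ^ (j : ℕ) * ψ p.1 (p.2 j)} := by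
      simp only [ofPred_forall]
      exact isClosed_iInter fun j => isClosed_le continuous_const (continuous_const.mul (hψj j))
    exact h1.inter (h2.inter (h3.inter h4))
  have hKc : IsCompact K := ((isCompact_Icc.prod isCompact_Icc).inter_right hK'c)
  have hpi := Real.pi_pos
  have hshift : ∀ p ∈ K', ∃ p' ∈ K, g p' = g p ∧ p'.1 = p.1 := by
    rintro ⟨t, x⟩ ⟨h1, h2, h3, h4⟩
    obtain ⟨n, hn⟩ : ∃ n : ℤ, x 0 + n * (2 * π) ∈ Ico 0 (2 * π) := by
      obtain ⟨n, hn, -⟩ := existsUnique_add_zsmul_mem_Ico (by positivity : 0 < 2 * π) (x 0) 0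
      exact ⟨n, by simpa using hn⟩
    refine ⟨(t, fun j => x j + n * (2 * π)), ⟨⟨h1, ?_, ?_⟩, h1, ?_, ?_, ?_⟩, ?_, rfl⟩
    · intro j
      have := h2 0 j (Fin.zero_le _)
      simp only at this ⊢
      linarith [hn.1]
    · intro j
      have := h3 j
      simp only at this ⊢
      linarith [hn.2]
    · intro i j hij
      have := h2 i j hij
      simp only at this ⊢
      linarith
    · intro j
      have := h3 j
      simp only at this ⊢
      linarith
    · intro j
      have := h4 j
      simp only [hψperz] at this ⊢
      exact this
    · simp only [g, hψperz]
  obtain ⟨x, hx1, hx2, hx3⟩ := hP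
  have hTK : (T, fun j : Fin k => x j) ∈ K' := by
    refine ⟨⟨hsT, le_rfl⟩, ?_, ?_, ?_⟩
    · intro i j hij
      rcases hij.eq_or_lt with rfl | h
      · exact le_rfl
      · exact (hx1 _ _ h j.2).le
    · intro j
      simpa using (hx2 j j.2).le
    · intro j
      simp only [hψe T hsT]
      exact (hx3 j j.2).le
  have hTg : 0 < g (T, fun j : Fin k => x j) := by
    refine mul_pos (Real.exp_pos _) (Finset.prod_pos fun j _ => ?_)
    simp only [hψe T hsT]
    exact hx3 j j.2
  obtain ⟨pT, hpT, hpTg, -⟩ := hshift _ hTK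
  obtain ⟨⟨ts, xs⟩, hpK, hmax⟩ := hKc.exists_isMaxOn ⟨pT, hpT⟩ hgc.continuousOn
  have hmax' : ∀ p ∈ K', g p ≤ g (ts, xs) := by
    intro p hp
    obtain ⟨p', hp', h1, -⟩ := hshift p hp
    rw [← h1]; exact hmax hp'
  have hgpos : 0 < g (ts, xs) := lt_of_lt_of_le hTg (hmax' _ hTK)
  obtain ⟨hts, hord, hwin, hsgn⟩ := hpK.2
  simp only at hts hord hwin hsgn
  have hts0 : 0 < ts := lt_of_lt_of_le hs hts.1
  have hprod : 0 < ∏ j : Fin k, ((-1 : ℝ) ^ (j : ℕ) * ψ ts (xs j)) :=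
    (mul_pos_iff_of_pos_left (Real.exp_pos _)).1 hgpos
  have hsgn' : ∀ j : Fin k, 0 < (-1 : ℝ) ^ (j : ℕ) * ψ ts (xs j) := by
    intro j
    refine lt_of_le_of_ne (hsgn j) fun h => ?_
    rw [Finset.prod_eq_zero (Finset.mem_univ j) h.symm] at hprod
    exact lt_irrefl _ hprod
  have hsucc : ∀ i : ℕ, (hi : i + 1 < k) → xs ⟨i, by omega⟩ < xs ⟨i + 1, hi⟩ := by
    intro i hi
    refine lt_of_le_of_ne (hord _ _ (by simp)) fun h => ?_
    have h1 := hsgn' ⟨i, by omega⟩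
    have h2 := hsgn' ⟨i + 1, hi⟩
    rw [← h] at h2
    simp only [pow_succ] at h1 h2
    linarith
  have hstrict : StrictMono xs := by
    have : ∀ (n i : ℕ) (h : i + n + 1 < k), xs ⟨i, by omega⟩ < xs ⟨i + n + 1, h⟩ := by
      intro n
      induction n with
      | zero => intro i h; exact hsucc i h
      | succ n ih => intro i h; exact (ih i (by omega)).trans (hsucc (i + n + 1) h)
    intro i j hij
    have h1 : (i : ℕ) < j := hij
    have := this (j - i - 1) i (by omega)
    have e : (⟨(i:ℕ) + ((j:ℕ) - i - 1) + 1, by omega⟩ : Fin k) = j := by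
      ext; simp only []; omega
    rw [e] at this
    exact this
  have hlast : ∀ j : Fin k, xs j < xs 0 + 2 * π := by
    have hl : xs ⟨k - 1, by omega⟩ < xs 0 + 2 * π := by
      refine lt_of_le_of_ne (hwin _) fun h => ?_
      have h1 := hsgn' ⟨k - 1, by omega⟩
      have h2 := hsgn' 0
      rw [h, hψper] at h1
      have hodd : Odd (k - 1) := by
        obtain ⟨m, rfl⟩ := hk
        exact ⟨m - 1, by omega⟩
      simp only [hodd.neg_one_pow, Fin.val_zero, pow_zero] at h1 h2
      linarith
    intro j
    exact lt_of_le_of_lt (hord _ _ (by rw [Fin.le_def]; simp; omega)) hl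
  rcases hts.1.eq_or_lt with h | hlt
  · subst h
    refine ⟨fun i => if h : i < k then xs ⟨i, h⟩ else 0, ?_, ?_, ?_⟩
    · intro i j hij hj
      simp only [hj, hij.trans hj, dite_true]
      exact hstrict (by simpa using hij)
    · intro j hj
      simp only [hj, hk0, dite_true]
      exact hlast _
    · intro j hj
      simp only [hj, dite_true]
      have := hsgn' ⟨j, hj⟩
      rwa [hψe s le_rfl] at this
  exfalso
  have hupd : ∀ j : Fin k, ∀ᶠ y in 𝓝 (xs j), (ts, Function.update xs j y) ∈ K' := by
    intro j
    have hcu : ∀ i : Fin k, ContinuousAt (fun y => Function.update xs j y i) (xs j) := by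
      intro i
      have : Continuous (fun y => Function.update xs j y i) := by fun_prop
      exact this.continuousAt
    have e1 : ∀ᶠ y in 𝓝 (xs j), ∀ i i' : Fin k, i < i' →
        Function.update xs j y i < Function.update xs j y i' := by
      rw [eventually_all]; intro i
      rw [eventually_all]; intro i'
      by_cases hi : i < i'
      · have : ∀ᶠ y in 𝓝 (xs j), Function.update xs j y i < Function.update xs j y i' :=
          (hcu i).eventually_lt (hcu i') (by simpa using hstrict hi)
        filter_upwards [this] with y hy _ using hy
      · exact Eventually.of_forall fun y h => absurd h hi
    have e2 : ∀ᶠ y in 𝓝 (xs j), ∀ i : Fin k,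
        Function.update xs j y i < Function.update xs j y 0 + 2 * π := by
      rw [eventually_all]; intro i
      exact (hcu i).eventually_lt ((hcu 0).add continuousAt_const) (by simpa using hlast i)
    have e3 : ∀ᶠ y in 𝓝 (xs j), ∀ i : Fin k,
        0 < (-1 : ℝ) ^ (i : ℕ) * ψ ts (Function.update xs j y i) := by
      rw [eventually_all]; intro i
      have hcc : ContinuousAt (fun y => (-1 : ℝ) ^ (i : ℕ) * ψ ts (Function.update xs j y i)) (xs j) := by
        have : Continuous (fun y => ψ ts (Function.update xs j y i)) :=
          hψc.comp (by fun_prop : Continuous fun y => (ts, Function.update xs j y i))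
        exact (continuous_const.mul this).continuousAt
      exact continuousAt_const.eventually_lt hcc (by simpa using hsgn' i)
    filter_upwards [e1, e2, e3] with y h1 h2 h3
    refine ⟨hts, ?_, fun i => (h2 i).le, fun i => (h3 i).le⟩
    intro i i' hii
    rcases hii.eq_or_lt with rfl | h
    · exact le_rfl
    · exact (h1 _ _ h).le
  have hloc : ∀ j : Fin k, IsLocalMax (fun y => (-1 : ℝ) ^ (j : ℕ) * φ ts y) (xs j) := by
    intro j
    filter_upwards [hupd j] with y hy
    have h1 := hmax' _ hy
    simp only [g] at h1
    have h2 := le_of_mul_le_mul_left h1 (Real.exp_pos _)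
    rw [← Finset.mul_prod_erase _ _ (Finset.mem_univ j),
      ← Finset.mul_prod_erase Finset.univ (fun j : Fin k => (-1 : ℝ) ^ (j : ℕ) * ψ ts (xs j)) (Finset.mem_univ j)] at h2
    have h3 : ∏ x ∈ Finset.univ.erase j, ((-1 : ℝ) ^ (x : ℕ) * ψ ts (Function.update xs j y x))
        = ∏ x ∈ Finset.univ.erase j, ((-1 : ℝ) ^ (x : ℕ) * ψ ts (xs x)) := by
      refine Finset.prod_congr rfl fun i hi => ?_
      rw [Function.update_of_ne (Finset.ne_of_mem_erase hi)]
    rw [h3] at h2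
    have h4 := le_of_mul_le_mul_right h2 (Finset.prod_pos fun i _ => hsgn' i)
    simpa [hψe ts hts.1] using h4
  have hxz : ∀ j : Fin k, φ_x ts (xs j) = 0 := by
    intro j
    have := (hloc j).hasDerivAt_eq_zero ((hφ_x ts hts0 (xs j)).const_mul ((-1 : ℝ) ^ (j : ℕ)))
    rcases mul_eq_zero.1 this with h | h
    · exact absurd h (by positivity)
    · exact h
  have hxxz : ∀ j : Fin k, (-1 : ℝ) ^ (j : ℕ) * φ_xx ts (xs j) ≤ 0 := by
    intro j
    exact second_deriv_nonpos (fun y => (hφ_x ts hts0 y).const_mul ((-1 : ℝ) ^ (j : ℕ)))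
      ((hφ_xx ts hts0 (xs j)).const_mul ((-1 : ℝ) ^ (j : ℕ))) (hloc j)
  have hsφ : ∀ j : Fin k, 0 < (-1 : ℝ) ^ (j : ℕ) * φ ts (xs j) := by
    intro j; have := hsgn' j; rwa [hψe ts hts.1] at this
  have hder : HasDerivAt (fun t => (∑ j : Fin k, Real.log ((-1 : ℝ) ^ (j : ℕ) * φ t (xs j))) - lam * t)
      ((∑ j : Fin k, ((-1 : ℝ) ^ (j : ℕ) * φ_t ts (xs j)) / ((-1 : ℝ) ^ (j : ℕ) * φ ts (xs j))) - lam * 1) ts := by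
    refine HasDerivAt.sub (HasDerivAt.fun_sum fun j _ => ?_) ((hasDerivAt_id ts).const_mul lam)
    exact ((hφ_t ts hts0 (xs j)).const_mul _).log (hsφ j).ne'
  have hleft := deriv_nonneg_of_left_max hder (by
    have e3 : ∀ᶠ t in 𝓝 ts, ∀ i : Fin k, 0 < (-1 : ℝ) ^ (i : ℕ) * φ t (xs i) := by
      rw [eventually_all]; intro i
      have hcc : ContinuousAt (fun t => (-1 : ℝ) ^ (i : ℕ) * φ t (xs i)) ts :=
        ((hφ_t ts hts0 (xs i)).const_mul _).continuousAt
      exact continuousAt_const.eventually_lt hcc (hsφ i)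
    filter_upwards [self_mem_nhdsWithin, nhdsWithin_le_nhds e3,
      nhdsWithin_le_nhds (Ioi_mem_nhds hlt)] with t ht1 ht2 ht3
    have htK : (t, xs) ∈ K' := by
      refine ⟨⟨le_of_lt ht3, (le_of_lt ht1).trans hts.2⟩, hord, hwin, fun j => ?_⟩
      simp only [hψe t (le_of_lt ht3)]
      exact (ht2 j).le
    have h1 := hmax' _ htK
    have hg : ∀ t, s ≤ t → (∀ i : Fin k, 0 < (-1 : ℝ) ^ (i : ℕ) * φ t (xs i)) →
        (∑ j : Fin k, Real.log ((-1 : ℝ) ^ (j : ℕ) * φ t (xs j))) - lam * t = Real.log (g (t, xs)) := by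
      intro t hst hpos
      simp only [g, hψe t hst]
      rw [Real.log_mul (Real.exp_pos _).ne' (Finset.prod_pos fun j _ => hpos j).ne',
        Real.log_exp, Real.log_prod (fun j _ => (hpos j).ne')]
      ring
    rw [hg t (le_of_lt ht3) ht2, hg ts hts.1 hsφ]
    refine Real.log_le_log ?_ h1
    refine mul_pos (Real.exp_pos _) (Finset.prod_pos fun j _ => ?_)
    simp only [hψe t (le_of_lt ht3)]
    exact ht2 j)
  have hterm : ∀ j : Fin k,
      ((-1 : ℝ) ^ (j : ℕ) * φ_t ts (xs j)) / ((-1 : ℝ) ^ (j : ℕ) * φ ts (xs j)) ≤ M := by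
    intro j
    rw [div_le_iff₀ (hsφ j), heq ts hts0, hxz j]
    have h1 := mul_nonpos_of_nonneg_of_nonpos (ha_pos ts hts0 (xs j)).le (hxxz j)
    have h2 := (abs_le.1 (hc ts hts0 (xs j))).2
    have h3 := mul_le_mul_of_nonneg_right h2 (hsφ j).le
    nlinarith
  have hsum := Finset.sum_le_sum (s := Finset.univ) fun j (_ : j ∈ Finset.univ) => hterm j
  simp only [Finset.sum_const, Finset.card_univ, Fintype.card_fin, nsmul_eq_mul] at hsum
  simp only [lam] at hleft
  linarith

end ZN

open Real Set Filter
namespace ZN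
open Topology

lemma Pat.prefix {u : ℝ → ℝ} {k l : ℕ} (h : Pat u k) (hl : l ≤ k) : Pat u l := by
  obtain ⟨x, h1, h2, h3⟩ := h
  exact ⟨x, fun i j hij hj => h1 i j hij (hj.trans_le hl), fun j hj => h2 j (hj.trans_le hl),
    fun j hj => h3 j (hj.trans_le hl)⟩

noncomputable def nxt (x : ℕ → ℝ) (k j : ℕ) : ℝ := if j + 1 < k then x (j + 1) else x 0 + 2 * π

structure PD (u : ℝ → ℝ) (k : ℕ) (x : ℕ → ℝ) : Prop where
  mono : ∀ i j, i < j → j < k → x i < x j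
  win : ∀ j < k, x j < x 0 + 2 * π
  sgn : ∀ j < k, 0 < (-1 : ℝ) ^ j * u (x j)

lemma PD.lt_nxt {u : ℝ → ℝ} {k : ℕ} {x : ℕ → ℝ} (h : PD u k x) {j : ℕ} (hj : j < k) :
    x j < nxt x k j := by
  unfold nxt
  split_ifs with hh
  · exact h.mono _ _ (by omega) hh
  · exact h.win j hj

lemma PD.nxt_le {u : ℝ → ℝ} {k : ℕ} {x : ℕ → ℝ} (h : PD u k x) {j : ℕ} :
    nxt x k j ≤ x 0 + 2 * π := by
  unfold nxt
  split_ifs with hh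
  · exact (h.win _ hh).le
  · exact le_rfl

lemma PD.nxt_le' {u : ℝ → ℝ} {k : ℕ} {x : ℕ → ℝ} (h : PD u k x) {i j : ℕ} (hij : i < j)
    (hj : j < k) : nxt x k i ≤ x j := by
  unfold nxt
  rw [if_pos (by omega)]
  rcases Nat.lt_or_ge (i + 1) j with h1 | h1
  · exact (h.mono _ _ h1 hj).le
  · have : i + 1 = j := by omega
    rw [this]

lemma PD.sgn_nxt {u : ℝ → ℝ} {k : ℕ} {x : ℕ → ℝ} (h : PD u k x) (hk : Even k)
    (hper : ∀ y, u (y + 2 * π) = u y) {j : ℕ} (hj : j < k) :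
    (-1 : ℝ) ^ j * u (nxt x k j) < 0 := by
  unfold nxt
  split_ifs with hh
  · have := h.sgn _ hh
    rw [pow_succ] at this
    linarith
  · have := h.sgn 0 (by omega)
    rw [hper]
    have hodd : Odd j := by
      obtain ⟨m, rfl⟩ := hk
      exact ⟨m - 1, by omega⟩
    rw [hodd.neg_one_pow]
    simp at this
    linarith

lemma PD.insert {u : ℝ → ℝ} {k : ℕ} {x : ℕ → ℝ} (h : PD u k x) {j : ℕ} (hj : j < k)
    {p q : ℝ} (hp : x j < p) (hpq : p < q) (hq : q < nxt x k j)
    (hsp : (-1 : ℝ) ^ j * u p < 0) (hsq : 0 < (-1 : ℝ) ^ j * u q) : Pat u (k + 2) := by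
  set z : ℕ → ℝ := fun i => if i ≤ j then x i else if i = j + 1 then p else
    if i = j + 2 then q else x (i - 2) with hz
  have hsucc : ∀ i, i + 1 < k + 2 → z i < z (i + 1) := by
    intro i hi
    simp only [hz]
    rcases lt_trichotomy i j with h1 | h1 | h1
    · rw [if_pos h1.le, if_pos (by omega)]
      exact h.mono _ _ (by omega) (by omega)
    · subst h1
      rw [if_pos le_rfl, if_neg (by omega), if_pos rfl]
      exact hp
    · rw [if_neg (show ¬ i ≤ j by omega), if_neg (show ¬ i + 1 ≤ j by omega),
        if_neg (show ¬ i + 1 = j + 1 by omega)]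
      by_cases h2 : i = j + 1
      · rw [if_pos h2, if_pos (by omega)]
        exact hpq
      · rw [if_neg h2, if_neg (show ¬ i + 1 = j + 2 by omega)]
        by_cases h3 : i = j + 2
        · rw [if_pos h3]
          have e : i + 1 - 2 = j + 1 := by omega
          rw [e]
          unfold nxt at hq
          rwa [if_pos (by omega)] at hq
        · rw [if_neg h3]
          exact h.mono _ _ (by omega) (by omega)
  have hmono : ∀ i i', i < i' → i' < k + 2 → z i < z i' := by
    intro i i' hii hi'
    induction i', hii using Nat.le_induction with
    | base => exact hsucc i hi'
    | succ m hm ih => exact (ih (by omega)).trans (hsucc m hi')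
  have hz0 : z 0 = x 0 := by simp [hz]
  refine ⟨z, hmono, ?_, ?_⟩
  · intro i hi
    rw [hz0]
    simp only [hz]
    have hnl : nxt x k j ≤ x 0 + 2 * π := h.nxt_le
    split_ifs with h1 h2 h3
    · exact h.win _ (by omega)
    · linarith
    · linarith
    · exact h.win _ (by omega)
  · intro i hi
    simp only [hz]
    split_ifs with h1 h2 h3
    · exact h.sgn _ (by omega)
    · rw [h2, pow_succ]; linarith
    · rw [h3, pow_add]; simpa using hsq
    · have := h.sgn (i - 2) (by omega)
      have e : i = (i - 2) + 2 := by omega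
      rw [show (-1 : ℝ) ^ i = (-1 : ℝ) ^ (i - 2) by
        conv_lhs => rw [e, pow_add]
        simp]
      exact this

lemma PD.gap {u : ℝ → ℝ} {k : ℕ} {x : ℕ → ℝ} (_h : PD u k x) (hk : 0 < k) {y : ℝ}
    (h0 : x 0 < y) (h1 : y < x 0 + 2 * π) (hne : ∀ j < k, x j ≠ y) :
    ∃ j < k, x j < y ∧ y < nxt x k j := by
  by_contra hcon
  push Not at hcon
  have : ∀ j < k, x j < y := by
    intro j
    induction j with
    | zero => intro _; exact h0
    | succ j ih =>
      intro hj
      have h2 := hcon j (by omega) (ih (by omega))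
      unfold nxt at h2
      rw [if_pos hj] at h2
      exact lt_of_le_of_ne h2 (hne _ hj)
  have h3 := hcon (k - 1) (by omega) (this _ (by omega))
  unfold nxt at h3
  rw [if_neg (by omega)] at h3
  linarith

lemma PD.insert_triple {u : ℝ → ℝ} {k : ℕ} {x : ℕ → ℝ} (h : PD u k x) {j : ℕ} (hj : j < k)
    {p q r s : ℝ} (hp : x j < p) (hpq : p < q) (hqr : q < r) (hq : r < nxt x k j)
    (h1 : 0 < s * u p) (h2 : s * u q < 0) (h3 : 0 < s * u r) : Pat u (k + 2) := by
  rcases neg_one_pow_eq_or ℝ j with e | e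
  · rcases lt_trichotomy s 0 with hs | hs | hs
    · refine h.insert hj hp hpq (hqr.trans hq) ?_ ?_ <;> rw [e]
      · nlinarith
      · nlinarith
    · simp [hs] at h1
    · refine h.insert hj (hp.trans hpq) hqr hq ?_ ?_ <;> rw [e]
      · nlinarith
      · nlinarith
  · rcases lt_trichotomy s 0 with hs | hs | hs
    · refine h.insert hj (hp.trans hpq) hqr hq ?_ ?_ <;> rw [e]
      · nlinarith
      · nlinarith
    · simp [hs] at h1
    · refine h.insert hj hp hpq (hqr.trans hq) ?_ ?_ <;> rw [e]
      · nlinarith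
      · nlinarith

lemma pos_right {f : ℝ → ℝ} {f' z b : ℝ} (hf : HasDerivAt f f' z) (h0 : f z = 0) (hp : 0 < f')
    (hb : z < b) : ∃ y, z < y ∧ y < b ∧ 0 < f y := by
  have h1 : ∀ᶠ y in 𝓝[>] z, 0 < slope f z y :=
    (hasDerivWithinAt_iff_tendsto_slope' (by simp)).1 (hf.hasDerivWithinAt (s := Ioi z))
      |>.eventually (lt_mem_nhds hp)
  obtain ⟨y, hy1, hy2⟩ := (h1.and (Ioo_mem_nhdsGT hb)).exists
  refine ⟨y, hy2.1, hy2.2, ?_⟩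
  rw [slope_def_field, h0, sub_zero] at hy1
  have := mul_pos hy1 (sub_pos.2 hy2.1)
  rwa [div_mul_cancel₀ _ (sub_pos.2 hy2.1).ne'] at this

lemma neg_left {f : ℝ → ℝ} {f' z b : ℝ} (hf : HasDerivAt f f' z) (h0 : f z = 0) (hp : 0 < f')
    (hb : b < z) : ∃ y, b < y ∧ y < z ∧ f y < 0 := by
  have h : HasDerivAt (fun y => - f (- y)) f' (-z) := by
    have h1 : HasDerivAt f f' (-(-z)) := by simpa using hf
    have := (h1.comp (-z) (hasDerivAt_neg (-z))).neg
    exact this.congr_deriv (by ring)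
  obtain ⟨y, h1, h2, h3⟩ := pos_right h (by simp [h0]) hp (neg_lt_neg hb)
  exact ⟨-y, by linarith, by linarith, by linarith⟩

lemma encard_le_shift {u : ℝ → ℝ} (hper : ∀ y, u (y + 2 * π) = u y) (A B : ℝ) :
    {x ∈ Ico A (A + 2 * π) | u x = 0}.encard ≤ {x ∈ Ico B (B + 2 * π) | u x = 0}.encard := by
  have hp : Function.Periodic u (2 * π) := hper
  refine Set.encard_le_encard_of_injOn (f := toIcoMod two_pi_pos B) ?_ ?_
  · rintro x ⟨hx, h0⟩
    refine ⟨toIcoMod_mem_Ico _ _ _, ?_⟩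
    rw [toIcoMod, hp.sub_zsmul_eq, h0]
  · rintro x ⟨hx, -⟩ y ⟨hy, -⟩ hxy
    have h1 := congrArg (toIcoMod two_pi_pos A) hxy
    simp only [toIcoMod_toIcoMod] at h1
    rwa [(toIcoMod_eq_self two_pi_pos).2 hx, (toIcoMod_eq_self two_pi_pos).2 hy] at h1

lemma PD.uniq {u u' : ℝ → ℝ} {k : ℕ} {x : ℕ → ℝ} (h : PD u k x) 
    (hu : ∀ y, HasDerivAt u (u' y) y) (hs : ∀ y, u y = 0 → u' y ≠ 0)
    (hno : ¬ Pat u (k + 2)) {j : ℕ} (hj : j < k) {z z' : ℝ} (h1 : x j < z) (h2 : z < z')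
    (h3 : z' < nxt x k j) (hz : u z = 0) (hz' : u z' = 0) : False := by
  have hdf : ∀ y, HasDerivAt (fun y => (-1 : ℝ) ^ j * u y) ((-1 : ℝ) ^ j * u' y) y :=
    fun y => (hu y).const_mul _
  have key : ∀ y, x j < y → y < nxt x k j → u y = 0 → (-1 : ℝ) ^ j * u' y < 0 := by
    intro y hy1 hy2 hy3
    by_contra hcon
    push Not at hcon
    have hpos : 0 < (-1 : ℝ) ^ j * u' y := lt_of_le_of_ne hcon (Ne.symm (by
      have := hs y hy3
      simp [this]))
    obtain ⟨q, hq1, hq2, hq3⟩ := pos_right (hdf y) (by simp [hy3]) hpos hy2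
    obtain ⟨p, hp1, hp2, hp3⟩ := neg_left (hdf y) (by simp [hy3]) hpos hy1
    exact hno (h.insert hj hp1 (hp2.trans hq1) hq2 hp3 hq3)
  have k1 := key z h1 (h2.trans h3) hz
  have k2 := key z' (h1.trans h2) h3 hz'
  obtain ⟨p, hp1, hp2, hp3⟩ := pos_right (f := fun y => -((-1 : ℝ) ^ j * u y)) (hdf z).neg
    (by simp [hz]) (by linarith) (show z < (z + z') / 2 by linarith)
  obtain ⟨q, hq1, hq2, hq3⟩ := neg_left (f := fun y => -((-1 : ℝ) ^ j * u y)) (hdf z').neg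
    (by simp [hz']) (by linarith) (show (z + z') / 2 < z' by linarith)
  exact hno (h.insert hj (h1.trans hp1) (hp2.trans hq1) (hq2.trans h3) (by linarith)
    (by linarith))

theorem count_zeros {u u' : ℝ → ℝ} (hper : ∀ y, u (y + 2 * π) = u y)
    (hu : ∀ y, HasDerivAt u (u' y) y) (hs : ∀ y, u y = 0 → u' y ≠ 0) (k : ℕ) (hk : Even k)
    (hP : Pat u k) (hno : ¬ Pat u (k + 2)) : zeroNum u = (k : ℕ∞) := by
  have hcont : Continuous u := continuous_iff_continuousAt.2 fun y => (hu y).continuousAt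
  rcases Nat.eq_zero_or_pos k with rfl | hk0
  · unfold zeroNum
    have : {x ∈ Ico (0 : ℝ) (2 * π) | u x = 0} = ∅ := by
      rw [Set.eq_empty_iff_forall_notMem]
      rintro z ⟨-, hz⟩
      apply hno
      have hpi := pi_pos
      rcases lt_or_gt_of_ne (hs z hz) with hd | hd
      · obtain ⟨q, hq1, hq2, hq3⟩ := pos_right (f := fun y => - u y) (hu z).neg (by simp [hz])
          (by linarith) (show z < z + π by linarith)
        obtain ⟨p, hp1, hp2, hp3⟩ := neg_left (f := fun y => - u y) (hu z).neg (by simp [hz])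
          (by linarith) (show z - π < z by linarith)
        refine ⟨fun i => if i = 0 then p else q, ?_, ?_, ?_⟩
        · intro i j hij hj
          have e1 : i = 0 := by omega
          have e2 : j = 1 := by omega
          subst e1; subst e2
          simp only [if_true, one_ne_zero, if_false]
          linarith
        · intro j hj
          interval_cases j
          · simp only [if_true]; linarith
          · simp only [if_true, one_ne_zero, if_false]; linarith
        · intro j hj
          interval_cases j
          · simp only [if_true, pow_zero]; linarith
          · simp only [one_ne_zero, if_false, pow_one]; linarith
      · obtain ⟨q, hq1, hq2, hq3⟩ := pos_right (f := fun y => u y) (hu z) hz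
          (by linarith) (show z < z + π / 2 by linarith)
        obtain ⟨p, hp1, hp2, hp3⟩ := neg_left (f := fun y => u y) (hu z) hz
          (by linarith) (show z - π / 2 < z by linarith)
        refine ⟨fun i => if i = 0 then q else p + 2 * π, ?_, ?_, ?_⟩
        · intro i j hij hj
          have e1 : i = 0 := by omega
          have e2 : j = 1 := by omega
          subst e1; subst e2
          simp only [if_true, one_ne_zero, if_false]
          linarith
        · intro j hj
          interval_cases j
          · simp only [if_true]; linarith
          · simp only [if_true, one_ne_zero, if_false]; linarith
        · intro j hj
          interval_cases j
          · simp only [if_true, pow_zero]; linarith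
          · simp only [one_ne_zero, if_false, pow_one]; rw [hper]; linarith
    rw [this]; simp
  · obtain ⟨x, d1, d2, d3⟩ := hP
    have h : PD u k x := ⟨d1, d2, d3⟩
    have hex : ∀ j, ∃ c, j < k → (x j < c ∧ c < nxt x k j ∧ u c = 0) := by
      intro j
      by_cases hj : j < k
      · have a1 := h.sgn j hj
        have a2 := h.sgn_nxt hk hper hj
        have a3 := h.lt_nxt hj
        have hc : ContinuousOn (fun y => (-1 : ℝ) ^ j * u y) (Icc (x j) (nxt x k j)) :=
          (continuous_const.mul hcont).continuousOn
        obtain ⟨c, hc1, hc2⟩ := intermediate_value_Ioo' a3.le hc ⟨a2, a1⟩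
        refine ⟨c, fun _ => ⟨hc1.1, hc1.2, ?_⟩⟩
        simpa using hc2
      · exact ⟨0, fun hh => absurd hh hj⟩
    choose c hc using hex
    have hS : {y ∈ Ico (x 0) (x 0 + 2 * π) | u y = 0} = c '' (Finset.range k : Set ℕ) := by
      ext y
      constructor
      · rintro ⟨hy, h0⟩
        have hne : ∀ j < k, x j ≠ y := by
          intro j hj e
          have := h.sgn j hj
          rw [e, h0] at this
          simp at this
        obtain ⟨j, hj, b1, b2⟩ := h.gap hk0 (lt_of_le_of_ne hy.1 (hne 0 hk0)) hy.2 hne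
        refine ⟨j, by simpa using hj, ?_⟩
        obtain ⟨c1, c2, c3⟩ := hc j hj
        rcases lt_trichotomy (c j) y with hl | hl | hl
        · exact (h.uniq hu hs hno hj c1 hl b2 c3 h0).elim
        · exact hl
        · exact (h.uniq hu hs hno hj b1 hl c2 h0 c3).elim
      · rintro ⟨j, hj, rfl⟩
        have hj' : j < k := by simpa using hj
        obtain ⟨c1, c2, c3⟩ := hc j hj'
        refine ⟨⟨?_, c2.trans_le h.nxt_le⟩, c3⟩
        rcases Nat.eq_zero_or_pos j with rfl | hj0
        · exact c1.le
        · exact ((h.mono 0 j hj0 hj').trans c1).le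
    have hinj : InjOn c (Finset.range k : Set ℕ) := by
      have : ∀ i j, i < j → j < k → c i < c j := fun i j hij hj =>
        ((hc i (by omega)).2.1.trans_le (h.nxt_le' hij hj)).trans (hc j hj).1
      intro i hi j hj hij
      have hi' : i < k := by simpa using hi
      have hj' : j < k := by simpa using hj
      rcases lt_trichotomy i j with hl | hl | hl
      · exact absurd hij (this i j hl hj').ne
      · exact hl
      · exact absurd hij (this j i hl hi').ne'
    have e1 : zeroNum u = {y ∈ Ico (x 0) (x 0 + 2 * π) | u y = 0}.encard := by
      have a1 := encard_le_shift hper 0 (x 0)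
      have a2 := encard_le_shift hper (x 0) 0
      rw [zero_add] at a1 a2
      exact le_antisymm a1 a2
    rw [e1, hS, hinj.encard_image, Set.encard_coe_eq_coe_finsetCard, Finset.card_range]

end ZN

open Real Set Filter
namespace ZN
open Topology MeasureTheory

noncomputable def rho (y : ℝ) : ℝ := exp (-(y ^ 2 / 4))

lemma rho_pos (y : ℝ) : 0 < rho y := exp_pos _

lemma rho_cont : Continuous rho := by unfold rho; fun_prop

lemma rho_deriv (y : ℝ) : HasDerivAt rho (-(y / 2) * rho y) y := by
  unfold rho
  have : HasDerivAt (fun y : ℝ => -(y ^ 2 / 4)) (-(y / 2)) y := by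
    have := ((hasDerivAt_pow 2 y).div_const 4).neg
    exact this.congr_deriv (by simp; ring)
  exact this.exp.congr_deriv (by ring)

def PG (f : ℝ → ℝ) : Prop := Continuous f ∧ ∃ (C : ℝ) (n : ℕ), ∀ y, |f y| ≤ C * (1 + y ^ 2) ^ n

lemma PG.cont {f : ℝ → ℝ} (h : PG f) : Continuous f := h.1

lemma PG.bd {f : ℝ → ℝ} (hc : Continuous f) (C : ℝ) (h : ∀ y, |f y| ≤ C) : PG f :=
  ⟨hc, C, 0, fun y => by simpa using h y⟩

lemma PG.bd1 {f : ℝ → ℝ} (hc : Continuous f) (C : ℝ) (h : ∀ y, |f y| ≤ C * (1 + |y|)) : PG f := by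
  refine ⟨hc, 2 * |C|, 1, fun y => (h y).trans ?_⟩
  have h1 : |y| ≤ 1 + y ^ 2 := by nlinarith [sq_abs y, abs_nonneg y, sq_nonneg (|y| - 1)]
  have h2 : C ≤ |C| := le_abs_self C
  have h3 := abs_nonneg y
  have h4 : C * (1 + |y|) ≤ |C| * (1 + |y|) := by gcongr
  have h5 : |C| * (1 + |y|) ≤ |C| * (2 * (1 + y ^ 2)) := by
    gcongr; nlinarith [sq_nonneg y]
  linarith [show |C| * (2 * (1 + y ^ 2)) = 2 * |C| * (1 + y ^ 2) ^ 1 by ring]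

lemma PG.const (c : ℝ) : PG (fun _ => c) := PG.bd continuous_const |c| fun _ => le_rfl

lemma PG.id : PG (fun y => y) := PG.bd1 continuous_id 1 fun y => by linarith

lemma PG.mul {f g : ℝ → ℝ} (hf : PG f) (hg : PG g) : PG (fun y => f y * g y) := by
  obtain ⟨cf, C, n, h1⟩ := hf
  obtain ⟨cg, D, m, h2⟩ := hg
  refine ⟨cf.mul cg, C * D, n + m, fun y => ?_⟩
  rw [abs_mul, pow_add]
  calc |f y| * |g y| ≤ (C * (1 + y ^ 2) ^ n) * (D * (1 + y ^ 2) ^ m) :=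
        mul_le_mul (h1 y) (h2 y) (abs_nonneg _) ((abs_nonneg _).trans (h1 y))
    _ = _ := by ring

lemma PG.add {f g : ℝ → ℝ} (hf : PG f) (hg : PG g) : PG (fun y => f y + g y) := by
  obtain ⟨cf, C, n, h1⟩ := hf
  obtain ⟨cg, D, m, h2⟩ := hg
  refine ⟨cf.add cg, |C| + |D|, n + m, fun y => (abs_add_le _ _).trans ?_⟩
  have hb : 1 ≤ 1 + y ^ 2 := by nlinarith [sq_nonneg y]
  have e1 : C * (1 + y ^ 2) ^ n ≤ |C| * (1 + y ^ 2) ^ (n + m) :=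
    mul_le_mul (le_abs_self C) (pow_le_pow_right₀ hb (by omega)) (by positivity) (abs_nonneg _)
  have e2 : D * (1 + y ^ 2) ^ m ≤ |D| * (1 + y ^ 2) ^ (n + m) :=
    mul_le_mul (le_abs_self D) (pow_le_pow_right₀ hb (by omega)) (by positivity) (abs_nonneg _)
  rw [add_mul]
  linarith [h1 y, h2 y]

lemma PG.neg {f : ℝ → ℝ} (hf : PG f) : PG (fun y => - f y) := by
  obtain ⟨cf, C, n, h1⟩ := hf
  exact ⟨cf.neg, C, n, fun y => by rw [abs_neg]; exact h1 y⟩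

lemma PG.sub {f g : ℝ → ℝ} (hf : PG f) (hg : PG g) : PG (fun y => f y - g y) := by
  simpa [sub_eq_add_neg] using hf.add hg.neg

lemma PG.sq {f : ℝ → ℝ} (hf : PG f) : PG (fun y => f y ^ 2) := by
  simpa [pow_two] using hf.mul hf

lemma PG.abs {f : ℝ → ℝ} (hf : PG f) : PG (fun y => |f y|) := by
  obtain ⟨cf, C, n, h1⟩ := hf
  exact ⟨cf.abs, C, n, fun y => by rw [abs_abs]; exact h1 y⟩

lemma rho_bd (n : ℕ) (y : ℝ) :
    (1 + y ^ 2) ^ n * rho y ≤ (8 ^ n * n.factorial * exp (1 / 8)) * exp (-(1 / 8) * y ^ 2) := by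
  have h := Real.pow_div_factorial_le_exp ((1 + y ^ 2) / 8) (by positivity) n
  rw [div_le_iff₀ (by positivity)] at h
  have e : (1 + y ^ 2) ^ n = 8 ^ n * ((1 + y ^ 2) / 8) ^ n := by
    rw [← mul_pow]; congr 1; ring
  rw [e]
  calc 8 ^ n * ((1 + y ^ 2) / 8) ^ n * rho y
      ≤ 8 ^ n * (exp ((1 + y ^ 2) / 8) * n.factorial) * rho y := by
        gcongr; exact (rho_pos y).le
    _ = (8 ^ n * n.factorial) * (exp ((1 + y ^ 2) / 8) * rho y) := by ring
    _ = _ := by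
        unfold rho
        rw [← exp_add, mul_assoc _ (exp (1/8)), ← exp_add]
        congr 2; ring

lemma PG.integrable {f : ℝ → ℝ} (hf : PG f) : Integrable (fun y => f y * rho y) := by
  obtain ⟨cf, C, n, h1⟩ := hf
  refine Integrable.mono' (g := fun y => |C| * ((8 ^ n * n.factorial * exp (1 / 8)) *
    exp (-(1 / 8) * y ^ 2))) ?_ (cf.mul rho_cont).aestronglyMeasurable ?_
  · exact ((integrable_exp_neg_mul_sq (by norm_num)).const_mul _).const_mul _
  · refine Eventually.of_forall fun y => ?_
    rw [norm_eq_abs, abs_mul, abs_of_pos (rho_pos y)]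
    calc |f y| * rho y ≤ |C| * (1 + y ^ 2) ^ n * rho y := by
          gcongr
          · exact (rho_pos y).le
          · exact (h1 y).trans (by gcongr; exact le_abs_self C)
      _ = |C| * ((1 + y ^ 2) ^ n * rho y) := by ring
      _ ≤ _ := mul_le_mul_of_nonneg_left (rho_bd n y) (abs_nonneg C)

lemma ibp {f f' : ℝ → ℝ} (hf : PG f) (hf' : PG f') (h : ∀ y, HasDerivAt f (f' y) y) :
    ∫ y, (f' y - y / 2 * f y) * rho y = 0 := by
  have hd : ∀ y, HasDerivAt (fun y => f y * rho y) ((f' y - y / 2 * f y) * rho y) y := fun y =>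
    ((h y).mul (rho_deriv y)).congr_deriv (by ring)
  refine integral_eq_zero_of_hasDerivAt_of_integrable hd ?_ hf.integrable
  exact (hf'.sub ((PG.id.mul (PG.const (1/2))).mul hf)).integrable.congr
    (Eventually.of_forall fun y => by simp only []; ring)

lemma symm_L {u' u'' v v' : ℝ → ℝ} (h0 : PG u') (h1 : PG u'') (h2 : PG v) (h3 : PG v')
    (hu : ∀ y, HasDerivAt u' (u'' y) y) (hv : ∀ y, HasDerivAt v (v' y) y) :
    ∫ y, (u'' y - y / 2 * u' y) * v y * rho y = - ∫ y, u' y * v' y * rho y := by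
  have h := ibp (h0.mul h2) ((h1.mul h2).add (h0.mul h3)) (fun y => (hu y).mul (hv y))
  have e : (fun y => (u'' y * v y + u' y * v' y - y / 2 * (u' y * v y)) * rho y)
      = fun y => (u'' y - y / 2 * u' y) * v y * rho y + u' y * v' y * rho y := by
    funext y; ring
  rw [e, integral_add] at h
  · linarith
  · exact ((h1.sub ((PG.id.mul (PG.const (1/2))).mul h0)).mul h2).integrable.congr
      (Eventually.of_forall fun y => by simp only []; ring)
  · exact (h0.mul h3).integrable

lemma int_mono {f g : ℝ → ℝ} (hf : PG f) (hg : PG g) (h : ∀ y, f y ≤ g y) :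
    ∫ y, f y * rho y ≤ ∫ y, g y * rho y :=
  integral_mono hf.integrable hg.integrable fun y =>
    mul_le_mul_of_nonneg_right (h y) (rho_pos y).le

lemma int_add {f g : ℝ → ℝ} (hf : PG f) (hg : PG g) :
    ∫ y, (f y + g y) * rho y = (∫ y, f y * rho y) + ∫ y, g y * rho y := by
  rw [← integral_add hf.integrable hg.integrable]
  congr 1; funext y; ring

lemma int_cmul (c : ℝ) (f : ℝ → ℝ) :
    ∫ y, (c * f y) * rho y = c * ∫ y, f y * rho y := by
  rw [← integral_const_mul]
  congr 1; funext y; ring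

lemma int_nonneg {f : ℝ → ℝ} (h : ∀ y, 0 ≤ f y) : 0 ≤ ∫ y, f y * rho y :=
  integral_nonneg fun y => mul_nonneg (h y) (rho_pos y).le

lemma int_sq_pos {f : ℝ → ℝ} (hf : PG f) (h : ∃ y, f y ≠ 0) : 0 < ∫ y, f y ^ 2 * rho y := by
  obtain ⟨y0, hy0⟩ := h
  refine integral_pos_of_integrable_nonneg_nonzero (x := y0) ((hf.cont.pow 2).mul rho_cont)
    hf.sq.integrable (fun y => mul_nonneg (sq_nonneg _) (rho_pos y).le) ?_
  exact mul_ne_zero (pow_ne_zero _ hy0) (rho_pos y0).ne'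

end ZN

open Real Set Filter
namespace ZN
open Topology MeasureTheory

structure SS (σ0 M C : ℝ) (w ws wy wyy : ℝ → ℝ → ℝ) : Prop where
  hσ0 : 0 ≤ σ0
  hM : 0 ≤ M
  ds : ∀ σ > σ0, ∀ y, HasDerivAt (fun s => w s y) (ws σ y) σ
  dy : ∀ σ > σ0, ∀ y, HasDerivAt (w σ) (wy σ y) y
  dyy : ∀ σ > σ0, ∀ y, HasDerivAt (wy σ) (wyy σ y) y
  cs : ∀ σ > σ0, Continuous (ws σ)
  cyy : ∀ σ > σ0, Continuous (wyy σ)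
  tcy : ∀ σ > σ0, ∀ y, ContinuousAt (fun s => wy s y) σ
  tcyy : ∀ σ > σ0, ∀ y, ContinuousAt (fun s => wyy s y) σ
  b0 : ∀ σ > σ0, ∀ y, |w σ y| ≤ C
  b1 : ∀ σ > σ0, ∀ y, |wy σ y| ≤ C
  b2 : ∀ σ > σ0, ∀ y, |wyy σ y| ≤ C
  bs : ∀ σ > σ0, ∀ y, |ws σ y| ≤ C * (1 + |y|)
  eq : ∀ σ > σ0, ∀ y, |ws σ y - (wyy σ y - y / 2 * wy σ y)| ≤
    M * exp (-σ / 2) * (|w σ y| + |wy σ y|)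
  nt : ∀ σ > σ0, ∃ y, w σ y ≠ 0

noncomputable def HH (w : ℝ → ℝ) : ℝ := ∫ y, w y ^ 2 * rho y

noncomputable def NN (w wy : ℝ → ℝ) : ℝ := HH wy / HH w

noncomputable def EE (w wy wyy : ℝ → ℝ) : ℝ :=
  (∫ y, (wyy y - y / 2 * wy y + NN w wy * w y) ^ 2 * rho y) / HH w

section
variable {σ0 M C : ℝ} {w ws wy wyy : ℝ → ℝ → ℝ}

lemma SS.pw (h : SS σ0 M C w ws wy wyy) {σ : ℝ} (hσ : σ0 < σ) : PG (w σ) :=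
  PG.bd (continuous_iff_continuousAt.2 fun y => (h.dy σ hσ y).continuousAt) C (h.b0 σ hσ)

lemma SS.pwy (h : SS σ0 M C w ws wy wyy) {σ : ℝ} (hσ : σ0 < σ) : PG (wy σ) :=
  PG.bd (continuous_iff_continuousAt.2 fun y => (h.dyy σ hσ y).continuousAt) C (h.b1 σ hσ)

lemma SS.pwyy (h : SS σ0 M C w ws wy wyy) {σ : ℝ} (hσ : σ0 < σ) : PG (wyy σ) :=
  PG.bd (h.cyy σ hσ) C (h.b2 σ hσ)

lemma SS.pws (h : SS σ0 M C w ws wy wyy) {σ : ℝ} (hσ : σ0 < σ) : PG (ws σ) :=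
  PG.bd1 (h.cs σ hσ) C (h.bs σ hσ)

lemma PG.half : PG (fun y => y / 2) := by
  have := PG.id.mul (PG.const (1/2))
  simpa [div_eq_mul_inv] using this

lemma SS.pL (h : SS σ0 M C w ws wy wyy) {σ : ℝ} (hσ : σ0 < σ) :
    PG (fun y => wyy σ y - y / 2 * wy σ y) := (h.pwyy hσ).sub (PG.half.mul (h.pwy hσ))

lemma SS.Hpos (h : SS σ0 M C w ws wy wyy) {σ : ℝ} (hσ : σ0 < σ) : 0 < HH (w σ) :=
  int_sq_pos (h.pw hσ) (h.nt σ hσ)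

lemma HH_nonneg (w : ℝ → ℝ) : 0 ≤ HH w := int_nonneg fun _ => sq_nonneg _

lemma NN_nonneg (w wy : ℝ → ℝ) : 0 ≤ NN w wy := div_nonneg (HH_nonneg _) (HH_nonneg _)

lemma SS.Cnn (h : SS σ0 M C w ws wy wyy) : 0 ≤ C :=
  (abs_nonneg _).trans (h.b0 (σ0 + 1) (by linarith) 0)

lemma SS.hasDerivAt_H (h : SS σ0 M C w ws wy wyy) {σ : ℝ} (hσ : σ0 < σ) :
    HasDerivAt (fun s => HH (w s)) (2 * ∫ y, w σ y * ws σ y * rho y) σ := by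
  have key := hasDerivAt_integral_of_dominated_loc_of_deriv_le (μ := volume)
    (F := fun s y => w s y ^ 2 * rho y) (F' := fun s y => 2 * (w s y * ws s y) * rho y)
    (x₀ := σ) (s := Ioi σ0) (bound := fun y => 2 * (C * (C * (1 + |y|))) * rho y)
    (Ioi_mem_nhds hσ)
    (by
      filter_upwards [Ioi_mem_nhds hσ] with s hs
      exact (h.pw hs).sq.integrable.aestronglyMeasurable)
    ((h.pw hσ).sq.integrable)
    (((PG.const 2).mul ((h.pw hσ).mul (h.pws hσ))).integrable.aestronglyMeasurable)
    (by
      refine Eventually.of_forall fun y s hs => ?_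
      rw [norm_eq_abs, abs_mul, abs_of_pos (rho_pos y), abs_mul, abs_mul, abs_two]
      have := h.b0 s hs y
      have := h.bs s hs y
      have := h.Cnn
      gcongr
      exact (rho_pos y).le)
    (((PG.const 2).mul ((PG.const C).mul ((PG.const C).mul
      ((PG.const 1).add PG.id.abs)))).integrable)
    (by
      refine Eventually.of_forall fun y s hs => ?_
      exact (((h.ds s hs y).pow 2).mul_const (rho y)).congr_deriv (by rw [show 2 - 1 = 1 from rfl]; push_cast; ring))
  refine key.2.congr_deriv ?_
  rw [int_cmul 2]

lemma SS.lip (h : SS σ0 M C w ws wy wyy) {s σ : ℝ} (hs : σ0 < s) (hσ : σ0 < σ) (y : ℝ) :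
    |w s y - w σ y| ≤ C * (1 + |y|) * |s - σ| := by
  have := (convex_Ioi σ0).norm_image_sub_le_of_norm_hasDerivWithin_le
    (f := fun s => w s y) (f' := fun s => ws s y) (C := C * (1 + |y|))
    (fun x hx => (h.ds x hx y).hasDerivWithinAt) (fun x hx => h.bs x hx y) hσ hs
  simpa using this

lemma SS.hasDerivAt_D (h : SS σ0 M C w ws wy wyy) {σ : ℝ} (hσ : σ0 < σ) :
    HasDerivAt (fun s => HH (wy s))
      (-2 * ∫ y, ws σ y * (wyy σ y - y / 2 * wy σ y) * rho y) σ := by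
  rw [hasDerivAt_iff_tendsto_slope]
  have hev : ∀ᶠ s in 𝓝[≠] σ, σ0 < s := nhdsWithin_le_nhds (Ioi_mem_nhds hσ)
  have hev2 : ∀ᶠ s in 𝓝[≠] σ, s ≠ σ := eventually_mem_nhdsWithin
  have e1 : ∀ s, σ0 < s → HH (wy s) - HH (wy σ) =
      - ∫ y, ((wyy s y + wyy σ y) - y / 2 * (wy s y + wy σ y)) * (w s y - w σ y) * rho y := by
    intro s hs
    rw [symm_L (u' := fun y => wy s y + wy σ y) (u'' := fun y => wyy s y + wyy σ y)
      (v := fun y => w s y - w σ y) (v' := fun y => wy s y - wy σ y)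
      ((h.pwy hs).add (h.pwy hσ)) ((h.pwyy hs).add (h.pwyy hσ)) ((h.pw hs).sub (h.pw hσ))
      ((h.pwy hs).sub (h.pwy hσ)) (fun y => (h.dyy s hs y).add (h.dyy σ hσ y))
      (fun y => (h.dy s hs y).sub (h.dy σ hσ y)), neg_neg]
    unfold HH
    rw [← integral_sub (h.pwy hs).sq.integrable (h.pwy hσ).sq.integrable]
    congr 1; funext y; ring
  have e2 : (fun s => slope (fun s => HH (wy s)) σ s) =ᶠ[𝓝[≠] σ] fun s =>
      - ∫ y, ((wyy s y + wyy σ y) - y / 2 * (wy s y + wy σ y)) *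
        ((w s y - w σ y) / (s - σ)) * rho y := by
    filter_upwards [hev] with s hs
    rw [slope_def_field, e1 s hs, neg_div, ← integral_div]
    congr 2; funext y; ring
  refine Tendsto.congr' e2.symm ?_
  have e3 : (-2 * ∫ y, ws σ y * (wyy σ y - y / 2 * wy σ y) * rho y) =
      - ∫ y, ((wyy σ y + wyy σ y) - y / 2 * (wy σ y + wy σ y)) * ws σ y * rho y := by
    rw [neg_mul, ← integral_const_mul]
    congr 2; funext y; ring
  rw [e3]
  refine Tendsto.neg ?_
  refine tendsto_integral_filter_of_dominated_convergence
    (fun y => ((C + C) + |y| / 2 * (C + C)) * (C * (1 + |y|)) * rho y) ?_ ?_ ?_ ?_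
  · filter_upwards [hev] with s hs
    exact (((((h.pwyy hs).add (h.pwyy hσ)).sub (PG.half.mul ((h.pwy hs).add (h.pwy hσ)))).mul
      (((h.pw hs).sub (h.pw hσ)).mul (PG.const (s - σ)⁻¹))).integrable).aestronglyMeasurable
  · filter_upwards [hev, hev2] with s hs hne
    refine Eventually.of_forall fun y => ?_
    rw [norm_eq_abs, abs_mul, abs_of_pos (rho_pos y), abs_mul]
    have hC := h.Cnn
    refine mul_le_mul_of_nonneg_right (mul_le_mul ?_ ?_ (abs_nonneg _) (by positivity))
      (rho_pos y).le
    · refine (abs_sub _ _).trans (add_le_add ((abs_add_le _ _).trans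
        (add_le_add (h.b2 s hs y) (h.b2 σ hσ y))) ?_)
      rw [abs_mul, abs_div, abs_two]
      refine mul_le_mul_of_nonneg_left ((abs_add_le _ _).trans
        (add_le_add (h.b1 s hs y) (h.b1 σ hσ y))) (by positivity)
    · rw [abs_div, div_le_iff₀ (abs_pos.2 (sub_ne_zero.2 hne))]
      exact h.lip hs hσ y
  · exact ((((PG.const C).add (PG.const C)).add
      ((PG.id.abs.mul (PG.const (1/2))).mul ((PG.const C).add (PG.const C)))).mul
      ((PG.const C).mul ((PG.const 1).add PG.id.abs))).integrable.congr
      (Eventually.of_forall fun y => by simp only []; ring)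
  · refine Eventually.of_forall fun y => ?_
    refine Tendsto.mul_const _ (Tendsto.mul ?_ ?_)
    · refine Tendsto.sub (Tendsto.add_const _ ?_) (Tendsto.const_mul _ (Tendsto.add_const _ ?_))
      · exact (h.tcyy σ hσ y).tendsto.mono_left nhdsWithin_le_nhds
      · exact (h.tcy σ hσ y).tendsto.mono_left nhdsWithin_le_nhds
    · have := hasDerivAt_iff_tendsto_slope.1 (h.ds σ hσ y)
      refine this.congr fun s => ?_
      rw [slope_def_field]

end
end ZN

open Real Set Filter
namespace ZN
open Topology MeasureTheory
section
variable {σ0 M C : ℝ} {w ws wy wyy : ℝ → ℝ → ℝ}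

lemma SS.wL (h : SS σ0 M C w ws wy wyy) {σ : ℝ} (hσ : σ0 < σ) :
    ∫ y, (wyy σ y - y / 2 * wy σ y) * w σ y * rho y = - HH (wy σ) := by
  rw [symm_L (h.pwy hσ) (h.pwyy hσ) (h.pw hσ) (h.pwy hσ) (h.dyy σ hσ) (h.dy σ hσ)]
  unfold HH
  congr 2; funext y; ring

lemma SS.gbd (h : SS σ0 M C w ws wy wyy) {σ : ℝ} (hσ : σ0 < σ) :
    ∫ y, (ws σ y - (wyy σ y - y / 2 * wy σ y)) ^ 2 * rho y ≤
      2 * M ^ 2 * exp (-σ) * (HH (w σ) + HH (wy σ)) := by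
  have e : HH (w σ) + HH (wy σ) = ∫ y, (w σ y ^ 2 + wy σ y ^ 2) * rho y :=
    (int_add (h.pw hσ).sq (h.pwy hσ).sq).symm
  rw [e, ← int_cmul]
  refine int_mono ((h.pws hσ).sub (h.pL hσ)).sq
    ((PG.const _).mul ((h.pw hσ).sq.add (h.pwy hσ).sq)) fun y => ?_
  have h1 := h.eq σ hσ y
  have h2 := pow_le_pow_left₀ (abs_nonneg _) h1 2
  rw [sq_abs] at h2
  have h3 : exp (-σ / 2) ^ 2 = exp (-σ) := by
    rw [← exp_nat_mul]; congr 1; push_cast; ring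
  have h4 : (|w σ y| + |wy σ y|) ^ 2 ≤ 2 * (w σ y ^ 2 + wy σ y ^ 2) := by
    nlinarith [sq_abs (w σ y), sq_abs (wy σ y), sq_nonneg (|w σ y| - |wy σ y|)]
  calc _ ≤ _ := h2
    _ = M ^ 2 * exp (-σ) * (|w σ y| + |wy σ y|) ^ 2 := by rw [mul_pow, mul_pow, h3]
    _ ≤ M ^ 2 * exp (-σ) * (2 * (w σ y ^ 2 + wy σ y ^ 2)) := by gcongr
    _ = _ := by ring

lemma SS.N_deriv (h : SS σ0 M C w ws wy wyy) {σ : ℝ} (hσ : σ0 < σ) :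
    ∃ N', HasDerivAt (fun s => NN (w s) (wy s)) N' σ ∧
      N' ≤ - EE (w σ) (wy σ) (wyy σ) + 2 * M ^ 2 * exp (-σ) * (1 + NN (w σ) (wy σ)) := by
  have hH := h.Hpos hσ
  have hd := (h.hasDerivAt_D hσ).div (h.hasDerivAt_H hσ) hH.ne'
  refine ⟨_, hd, ?_⟩
  set N := NN (w σ) (wy σ) with hN
  have hND : HH (wy σ) = N * HH (w σ) := by
    rw [hN, NN, div_mul_cancel₀ _ hH.ne']
  have pF : PG (fun y => wyy σ y - y / 2 * wy σ y + N * w σ y) :=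
    (h.pL hσ).add ((PG.const N).mul (h.pw hσ))
  have pg : PG (fun y => ws σ y - (wyy σ y - y / 2 * wy σ y)) := (h.pws hσ).sub (h.pL hσ)
  have a1 : ∫ y, (-2 * (ws σ y * (wyy σ y - y / 2 * wy σ y)) + (-2 * N) * (w σ y * ws σ y)
      + (-2 * N) * ((N * w σ y ^ 2 + (wyy σ y - y / 2 * wy σ y) * w σ y))) * rho y =
      -2 * (∫ y, ws σ y * (wyy σ y - y / 2 * wy σ y) * rho y) +
      (-2 * N) * (∫ y, w σ y * ws σ y * rho y) := by
    have p1 := (PG.const (-2)).mul ((h.pws hσ).mul (h.pL hσ))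
    have p2 := (PG.const (-2 * N)).mul ((h.pw hσ).mul (h.pws hσ))
    have p3a := (PG.const N).mul (h.pw hσ).sq
    have p3b := (h.pL hσ).mul (h.pw hσ)
    have p3 := (PG.const (-2 * N)).mul (p3a.add p3b)
    rw [int_add (p1.add p2) p3, int_add p1 p2, int_cmul, int_cmul, int_cmul, int_add p3a p3b,
      int_cmul, h.wL hσ]
    change _ + -2 * N * (N * HH (w σ) + - HH (wy σ)) = _
    rw [hND]; ring
  have a2 : ∫ y, (-2 * (ws σ y * (wyy σ y - y / 2 * wy σ y)) + (-2 * N) * (w σ y * ws σ y)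
      + (-2 * N) * ((N * w σ y ^ 2 + (wyy σ y - y / 2 * wy σ y) * w σ y))) * rho y ≤
      ∫ y, ((-1) * (wyy σ y - y / 2 * wy σ y + N * w σ y) ^ 2 +
        (ws σ y - (wyy σ y - y / 2 * wy σ y)) ^ 2) * rho y := by
    refine int_mono ?_ (((PG.const (-1)).mul pF.sq).add pg.sq) fun y => ?_
    · exact (((PG.const (-2)).mul ((h.pws hσ).mul (h.pL hσ))).add
        ((PG.const (-2 * N)).mul ((h.pw hσ).mul (h.pws hσ)))).add
        ((PG.const (-2 * N)).mul (((PG.const N).mul (h.pw hσ).sq).add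
          ((h.pL hσ).mul (h.pw hσ))))
    · set g := ws σ y
      set l := wyy σ y - y / 2 * wy σ y
      set u := w σ y
      nlinarith [sq_nonneg ((g - l) + (l + N * u))]
  rw [int_add ((PG.const (-1)).mul pF.sq) pg.sq, int_cmul] at a2
  have a3 := h.gbd hσ
  rw [hND] at a3
  have hE : EE (w σ) (wy σ) (wyy σ) * HH (w σ) =
      ∫ y, (wyy σ y - y / 2 * wy σ y + N * w σ y) ^ 2 * rho y := by
    rw [EE, div_mul_cancel₀ _ hH.ne']
  rw [div_le_iff₀ (by positivity), hND]
  rw [a1] at a2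
  have a4 : (-2 * (∫ y, ws σ y * (wyy σ y - y / 2 * wy σ y) * rho y) +
      (-2 * N) * (∫ y, w σ y * ws σ y * rho y)) ≤
      (- EE (w σ) (wy σ) (wyy σ) + 2 * M ^ 2 * exp (-σ) * (1 + N)) * HH (w σ) := by
    linarith
  have := mul_le_mul_of_nonneg_right a4 hH.le
  linarith

lemma SS.H_deriv (h : SS σ0 M C w ws wy wyy) {σ : ℝ} (hσ : σ0 < σ) :
    ∃ H', HasDerivAt (fun s => HH (w s)) H' σ ∧
      -(2 * NN (w σ) (wy σ) + M * exp (-σ / 2) * (3 + NN (w σ) (wy σ))) * HH (w σ) ≤ H' := by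
  refine ⟨_, h.hasDerivAt_H hσ, ?_⟩
  have hH := h.Hpos hσ
  set N := NN (w σ) (wy σ) with hN
  have hND : HH (wy σ) = N * HH (w σ) := by
    rw [hN, NN, div_mul_cancel₀ _ hH.ne']
  set m := M * exp (-σ / 2) with hm
  have hmn : 0 ≤ m := mul_nonneg h.hM (exp_pos _).le
  have pw := h.pw hσ
  have pwy := h.pwy hσ
  have pL := h.pL hσ
  have key : ∫ y, (2 * ((wyy σ y - y / 2 * wy σ y) * w σ y) +
      (-m) * (3 * w σ y ^ 2 + wy σ y ^ 2)) * rho y ≤ ∫ y, (2 * (w σ y * ws σ y)) * rho y := by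
    refine int_mono (((PG.const 2).mul (pL.mul pw)).add ((PG.const (-m)).mul
      (((PG.const 3).mul pw.sq).add pwy.sq))) ((PG.const 2).mul (pw.mul (h.pws hσ))) fun y => ?_
    have h1 := h.eq σ hσ y
    set g := ws σ y
    set l := wyy σ y - y / 2 * wy σ y
    set u := w σ y
    set v := wy σ y
    have h2 : |u * (g - l)| ≤ |u| * (m * (|u| + |v|)) := by
      rw [abs_mul]; gcongr
    have h3 := (abs_le.1 h2).1
    have h4 : |u| * (|u| + |v|) ≤ (3 * u ^ 2 + v ^ 2) / 2 := by
      nlinarith [sq_abs u, sq_abs v, sq_nonneg (|u| - |v|)]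
    have h5 := mul_le_mul_of_nonneg_left h4 hmn
    nlinarith
  have p1 := (PG.const 2).mul (pL.mul pw)
  have p2 := (PG.const 3).mul pw.sq
  rw [int_add p1 ((PG.const (-m)).mul (p2.add pwy.sq)), int_cmul, int_cmul, int_add p2 pwy.sq,
    int_cmul, int_cmul, h.wL hσ] at key
  change 2 * - HH (wy σ) + -m * (3 * HH (w σ) + HH (wy σ)) ≤ _ at key
  rw [hND] at key
  linarith

lemma antitone_of_deriv {f : ℝ → ℝ} {a : ℝ}
    (hd : ∀ x > a, ∃ f', HasDerivAt f f' x ∧ f' ≤ 0) : AntitoneOn f (Ioi a) := by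
  refine antitoneOn_of_deriv_nonpos (convex_Ioi a) ?_ ?_ ?_
  · intro x hx
    obtain ⟨f', h1, _⟩ := hd x hx
    exact h1.continuousAt.continuousWithinAt
  · intro x hx
    rw [interior_Ioi] at hx
    obtain ⟨f', h1, _⟩ := hd x hx
    exact h1.differentiableAt.differentiableWithinAt
  · intro x hx
    rw [interior_Ioi] at hx
    obtain ⟨f', h1, h2⟩ := hd x hx
    rw [h1.deriv]; exact h2

lemma hasDerivAt_exp_neg (x : ℝ) : HasDerivAt (fun s => exp (-s)) (-exp (-x)) x := by
  exact (hasDerivAt_neg x).exp.congr_deriv (by ring)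

lemma EE_nonneg (w wy wyy : ℝ → ℝ) : 0 ≤ EE w wy wyy :=
  div_nonneg (int_nonneg fun _ => sq_nonneg _) (HH_nonneg _)

lemma SS.F1 (h : SS σ0 M C w ws wy wyy) {σ1 σ : ℝ} (h1 : σ0 < σ1) (h2 : σ1 ≤ σ) :
    1 + NN (w σ) (wy σ) ≤ exp (2 * M ^ 2 * exp (-σ1)) * (1 + NN (w σ1) (wy σ1)) := by
  have ha : AntitoneOn (fun s => (1 + NN (w s) (wy s)) * exp (2 * M ^ 2 * exp (-s)))
      (Ioi σ0) := by
    refine antitone_of_deriv fun s hs => ?_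
    obtain ⟨N', hN1, hN2⟩ := h.N_deriv hs
    refine ⟨_, (hN1.const_add 1).mul (((hasDerivAt_exp_neg s).const_mul (2 * M ^ 2)).exp), ?_⟩
    have hE := EE_nonneg (w s) (wy s) (wyy s)
    have e : N' * exp (2 * M ^ 2 * exp (-s)) + (1 + NN (w s) (wy s)) *
        (exp (2 * M ^ 2 * exp (-s)) * (2 * M ^ 2 * -exp (-s))) =
        (N' - 2 * M ^ 2 * exp (-s) * (1 + NN (w s) (wy s))) * exp (2 * M ^ 2 * exp (-s)) := by
      ring
    rw [e]
    exact mul_nonpos_of_nonpos_of_nonneg (by linarith) (exp_pos _).le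
  have := ha h1 (h1.trans_le h2) h2
  simp only [] at this
  have hN := NN_nonneg (w σ) (wy σ)
  have h3 : 1 ≤ exp (2 * M ^ 2 * exp (-σ)) := one_le_exp (by positivity)
  nlinarith

lemma SS.F2 (h : SS σ0 M C w ws wy wyy) {ε l : ℝ} (hε : 0 < ε) (hl : 0 < l) :
    ∃ σ2 > σ0, ∀ σ ≥ σ2, ∃ σ' ∈ Ioo σ (σ + l), EE (w σ') (wy σ') (wyy σ') ≤ ε := by
  set σ1 := σ0 + 1 with hσ1
  have h01 : σ0 < σ1 := by linarith
  set K := 2 * M ^ 2 * (exp (2 * M ^ 2 * exp (-σ1)) * (1 + NN (w σ1) (wy σ1))) with hK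
  have hKn : 0 ≤ K := by
    have := NN_nonneg (w σ1) (wy σ1)
    positivity
  set G := fun s => NN (w s) (wy s) + K * exp (-s) with hG
  have hGd : ∀ s > σ1, ∃ G', HasDerivAt G G' s ∧ G' ≤ - EE (w s) (wy s) (wyy s) := by
    intro s hs
    obtain ⟨N', hN1, hN2⟩ := h.N_deriv (h01.trans hs)
    refine ⟨_, hN1.add ((hasDerivAt_exp_neg s).const_mul K), ?_⟩
    have := h.F1 h01 hs.le
    have h3 : 2 * M ^ 2 * exp (-s) * (1 + NN (w s) (wy s)) ≤ K * exp (-s) := by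
      rw [hK]
      have : 2 * M ^ 2 * exp (-s) * (1 + NN (w s) (wy s)) ≤ 2 * M ^ 2 * exp (-s) *
        (exp (2 * M ^ 2 * exp (-σ1)) * (1 + NN (w σ1) (wy σ1))) := by gcongr
      linarith
    linarith
  have hGa : AntitoneOn G (Ioi σ1) := antitone_of_deriv fun s hs => by
    obtain ⟨G', a1, a2⟩ := hGd s hs
    exact ⟨G', a1, by linarith [EE_nonneg (w s) (wy s) (wyy s)]⟩
  have hGn : ∀ s, 0 ≤ G s := fun s => add_nonneg (NN_nonneg _ _) (by positivity)
  have hbd : BddBelow (G '' Ioi σ1) := ⟨0, by rintro _ ⟨s, -, rfl⟩; exact hGn s⟩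
  have hne : (G '' Ioi σ1).Nonempty := ⟨_, σ1 + 1, by simp, rfl⟩
  obtain ⟨_, ⟨s0, hs0, rfl⟩, hlt⟩ := exists_lt_of_csInf_lt hne
    (show sInf (G '' Ioi σ1) < sInf (G '' Ioi σ1) + ε * l by
      have := mul_pos hε hl
      linarith)
  refine ⟨s0, h01.trans hs0, fun σ hσ => ?_⟩
  have hσ' : σ1 < σ := lt_of_lt_of_le hs0 hσ
  choose! G' hG1 hG2 using hGd
  obtain ⟨c, hc, hc2⟩ := exists_hasDerivAt_eq_slope G G' (show σ < σ + l by linarith)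
    (fun x hx => (hG1 x (hσ'.trans_le hx.1)).continuousAt.continuousWithinAt)
    (fun x hx => hG1 x (hσ'.trans hx.1))
  refine ⟨c, hc, ?_⟩
  have h4 := hG2 c (hσ'.trans hc.1)
  have h5 : G σ ≤ G s0 := hGa hs0 hσ' hσ
  have h6 : sInf (G '' Ioi σ1) ≤ G (σ + l) := csInf_le hbd ⟨_, by
    rw [mem_Ioi]; linarith, rfl⟩
  rw [hc2, add_sub_cancel_left, div_le_iff₀ hl] at h4
  have h7 : EE (w c) (wy c) (wyy c) * l ≤ ε * l := by linarith
  exact le_of_mul_le_mul_right h7 hl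

lemma SS.F4 (h : SS σ0 M C w ws wy wyy) {K : ℝ}
    (hz : ∀ σ > σ0, ∀ y, |w σ y| ≤ K * exp (-σ) * (1 + y ^ 2)) {σ1 : ℝ} (h1 : σ0 < σ1)
    (hM : 80 * M ^ 2 * exp (-σ1) ≤ 1) :
    9 / 10 < NN (w σ1) (wy σ1) := by
  by_contra hcon
  push Not at hcon
  have hexp : exp (2 * M ^ 2 * exp (-σ1)) ≤ 1.95 / 1.9 := by
    have e0 : 2 * M ^ 2 * exp (-σ1) ≤ 1 / 40 := by
      linarith
    calc exp (2 * M ^ 2 * exp (-σ1)) ≤ exp (1/40) := exp_le_exp.2 e0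
      _ ≤ 1.95 / 1.9 := by
        have := Real.exp_bound' (x := 1/40) (by norm_num) (by norm_num) (n := 2) (by norm_num)
        norm_num [Finset.sum_range_succ] at this ⊢
        linarith
  have hN : ∀ σ ≥ σ1, NN (w σ) (wy σ) ≤ 19 / 20 := by
    intro σ hσ
    have := h.F1 h1 hσ
    have h2 : exp (2 * M ^ 2 * exp (-σ1)) * (1 + NN (w σ1) (wy σ1)) ≤ 1.95 / 1.9 * (1 + 9 / 10) := by
      have := NN_nonneg (w σ1) (wy σ1)
      gcongr
    norm_num at h2
    linarith
  have hmono : AntitoneOn (fun s => - (HH (w s) * exp (19 / 10 * s + -8 * M * exp (-s / 2))))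
      (Ioi σ1) := by
    refine antitone_of_deriv fun s hs => ?_
    obtain ⟨H', b1, b2⟩ := h.H_deriv (h1.trans hs)
    have d1 : HasDerivAt (fun s : ℝ => exp (-s / 2)) (-(1/2) * exp (-s / 2)) s := by
      exact ((hasDerivAt_neg s).div_const 2).exp.congr_deriv (by ring)
    have d2 : HasDerivAt (fun s : ℝ => 19 / 10 * s + -8 * M * exp (-s / 2))
      (19 / 10 + 4 * M * exp (-s / 2)) s :=
      (((hasDerivAt_id s).const_mul (19 / 10)).add (d1.const_mul (-8 * M))).congr_deriv (by ring)
    refine ⟨_, (b1.mul d2.exp).neg, ?_⟩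
    have hH := h.Hpos (h1.trans hs)
    have hNs := hN s (le_of_lt hs)
    have hm : 0 ≤ M * exp (-s / 2) := mul_nonneg h.hM (exp_pos _).le
    have h3 : -(19 / 10 + 4 * M * exp (-s / 2)) * HH (w s) ≤ H' := by
      refine le_trans ?_ b2
      refine mul_le_mul_of_nonneg_right ?_ hH.le
      nlinarith
    have h4 := exp_pos (19 / 10 * s + -8 * M * exp (-s / 2))
    nlinarith
  set s1 := σ1 + 1
  set c0 := HH (w s1) * exp (19 / 10 * s1 + -8 * M * exp (-s1 / 2)) with hc0
  have hc0p : 0 < c0 := mul_pos (h.Hpos (by simp only [s1]; linarith)) (exp_pos _)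
  set K2 := K ^ 2 * ∫ y, (1 + y ^ 2) ^ 2 * rho y with hK2
  have hup : ∀ s ≥ s1, c0 ≤ K2 * exp (-(s / 10)) := by
    intro s hs
    have hs1 : σ1 < s1 := by simp only [s1]; linarith
    have hss : σ1 < s := lt_of_lt_of_le hs1 hs
    have e1 := hmono (show s1 ∈ Ioi σ1 from hs1) (show s ∈ Ioi σ1 from hss) hs
    simp only [] at e1
    have e2 : HH (w s) ≤ K2 * exp (-(2 * s)) := by
      have : HH (w s) ≤ ∫ y, ((K ^ 2 * exp (-(2 * s))) * (1 + y ^ 2) ^ 2) * rho y := by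
        refine int_mono (h.pw (h1.trans hss)).sq ((PG.const _).mul
          (((PG.const 1).add PG.id.sq).sq)) fun y => ?_
        have q := pow_le_pow_left₀ (abs_nonneg _) (hz s (h1.trans hss) y) 2
        rw [sq_abs, mul_pow, mul_pow, ← exp_nat_mul] at q
        rw [show -(2 * s) = ((2 : ℕ) : ℝ) * -s by push_cast; ring]
        exact q
      rw [int_cmul] at this
      rw [hK2]; linarith
    have e3 : exp (19 / 10 * s + -8 * M * exp (-s / 2)) ≤ exp (19 / 10 * s) := by
      apply exp_le_exp.2
      have : 0 ≤ M * exp (-s / 2) := mul_nonneg h.hM (exp_pos _).le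
      linarith
    calc c0 ≤ HH (w s) * exp (19 / 10 * s + -8 * M * exp (-s / 2)) := by linarith
      _ ≤ (K2 * exp (-(2 * s))) * exp (19 / 10 * s) :=
        mul_le_mul e2 e3 (exp_pos _).le ((HH_nonneg _).trans e2)
      _ = K2 * exp (-(s / 10)) := by
        rw [mul_assoc, ← exp_add]; congr 2; ring
  have ht : Tendsto (fun s : ℝ => K2 * exp (-(s / 10))) atTop (𝓝 (K2 * 0)) := by
    refine Tendsto.const_mul _ (tendsto_exp_neg_atTop_nhds_zero.comp ?_)
    exact tendsto_id.atTop_div_const (by norm_num)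
  rw [mul_zero] at ht
  have := ge_of_tendsto ht ((eventually_ge_atTop s1).mono hup)
  linarith

end
end ZN

open Real Set Filter
namespace ZN
open Topology MeasureTheory

structure ST (Nm ε : ℝ) (w wy wyy : ℝ → ℝ) : Prop where
  dy : ∀ y, HasDerivAt w (wy y) y
  dyy : ∀ y, HasDerivAt wy (wyy y) y
  cyy : Continuous wyy
  bd : ∃ B, ∀ y, |w y| ≤ B ∧ |wy y| ≤ B ∧ |wyy y| ≤ B
  H1 : HH w = 1
  Nle : HH wy ≤ Nm
  Fle : ∫ y, (wyy y - y / 2 * wy y + HH wy * w y) ^ 2 * rho y ≤ ε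

section
variable {Nm ε : ℝ} {w wy wyy : ℝ → ℝ}

lemma ST.cw (h : ST Nm ε w wy wyy) : Continuous w :=
  continuous_iff_continuousAt.2 fun y => (h.dy y).continuousAt
lemma ST.cwy (h : ST Nm ε w wy wyy) : Continuous wy :=
  continuous_iff_continuousAt.2 fun y => (h.dyy y).continuousAt
lemma ST.pw (h : ST Nm ε w wy wyy) : PG w := by
  obtain ⟨B, hB⟩ := h.bd
  exact PG.bd h.cw B fun y => (hB y).1
lemma ST.pwy (h : ST Nm ε w wy wyy) : PG wy := by
  obtain ⟨B, hB⟩ := h.bd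
  exact PG.bd h.cwy B fun y => (hB y).2.1
lemma ST.pwyy (h : ST Nm ε w wy wyy) : PG wyy := by
  obtain ⟨B, hB⟩ := h.bd
  exact PG.bd h.cyy B fun y => (hB y).2.2

noncomputable def FF (w wy wyy : ℝ → ℝ) (y : ℝ) : ℝ := wyy y - y / 2 * wy y + HH wy * w y

lemma ST.pF (h : ST Nm ε w wy wyy) : PG (FF w wy wyy) :=
  (h.pwyy.sub (PG.half.mul h.pwy)).add ((PG.const _).mul h.pw)

lemma ST.Fle' (h : ST Nm ε w wy wyy) : ∫ y, FF w wy wyy y ^ 2 * rho y ≤ ε := h.Fle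

lemma ST.Nmn (h : ST Nm ε w wy wyy) : 0 ≤ Nm := (HH_nonneg wy).trans h.Nle

lemma gron_aux {q q' f : ℝ → ℝ} {K y0 y : ℝ} (hy : y0 ≤ y) (hK : 0 ≤ K)
    (hq : ∀ s, HasDerivAt q (q' s) s) (hf : Continuous f) (hf0 : ∀ s, 0 ≤ f s)
    (h : ∀ s ∈ Icc y0 y, q' s ≤ K * q s + f s) :
    q y ≤ exp (K * (y - y0)) * (q y0 + ∫ s in y0..y, f s) := by
  have hanti : AntitoneOn (fun s => q s * exp (-(K * (s - y0))) - ∫ r in y0..s, f r)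
      (Icc y0 y) := by
    have hd : ∀ s, HasDerivAt (fun s => q s * exp (-(K * (s - y0))) - ∫ r in y0..s, f r)
        (q' s * exp (-(K * (s - y0))) + q s * (exp (-(K * (s - y0))) * (-K)) - f s) s := by
      intro s
      refine HasDerivAt.sub ((hq s).mul ?_) (hf.integral_hasStrictDerivAt y0 s).hasDerivAt
      have : HasDerivAt (fun s => -(K * (s - y0))) (-K) s :=
        (((hasDerivAt_id s).sub_const y0).const_mul K).neg.congr_deriv (by ring)
      exact this.exp
    refine antitoneOn_of_deriv_nonpos (convex_Icc _ _)
      (fun s _ => (hd s).continuousAt.continuousWithinAt)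
      (fun s _ => (hd s).differentiableAt.differentiableWithinAt) fun s hs => ?_
    rw [interior_Icc] at hs
    rw [(hd s).deriv]
    have h1 := h s ⟨hs.1.le, hs.2.le⟩
    have h2 : exp (-(K * (s - y0))) ≤ 1 := exp_le_one_iff.2 (by
      have := mul_nonneg hK (sub_nonneg.2 hs.1.le); linarith)
    have h3 := exp_pos (-(K * (s - y0)))
    have h4 := hf0 s
    nlinarith [mul_le_mul_of_nonneg_right h1 h3.le, mul_le_mul_of_nonneg_left h2 h4]
  have := hanti (left_mem_Icc.2 hy) (right_mem_Icc.2 hy) hy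
  simp only [sub_self, mul_zero, neg_zero, exp_zero, mul_one, intervalIntegral.integral_same,
    sub_zero] at this
  have h5 : q y * exp (-(K * (y - y0))) ≤ q y0 + ∫ s in y0..y, f s := by linarith
  have h6 := mul_le_mul_of_nonneg_left h5 (exp_pos (K * (y - y0))).le
  have h7 : exp (K * (y - y0)) * (q y * exp (-(K * (y - y0)))) = q y := by
    rw [mul_comm, mul_assoc, ← exp_add]; simp
  linarith

lemma sub_int {f : ℝ → ℝ} {R a b : ℝ} (ha : -R ≤ a) (hab : a ≤ b) (hb : b ≤ R)
    (hf : Continuous f) (hf0 : ∀ s, 0 ≤ f s) : ∫ s in a..b, f s ≤ ∫ s in -R..R, f s :=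
  intervalIntegral.integral_mono_interval ha hab hb (Eventually.of_forall hf0)
    (hf.intervalIntegrable _ _)

lemma gron {q q' f : ℝ → ℝ} {K R y0 y : ℝ} (hy0 : y0 ∈ Icc (-R) R) (hy : y ∈ Icc (-R) R)
    (hK : 0 ≤ K) (hq0 : ∀ s, 0 ≤ q s)
    (hq : ∀ s, HasDerivAt q (q' s) s) (hf : Continuous f) (hf0 : ∀ s, 0 ≤ f s)
    (h : ∀ s ∈ Icc (-R) R, |q' s| ≤ K * q s + f s) :
    q y ≤ exp (2 * R * K) * (q y0 + ∫ s in -R..R, f s) := by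
  have hJ : ∀ a b, -R ≤ a → a ≤ b → b ≤ R → 0 ≤ ∫ s in a..b, f s := fun a b _ hab _ =>
    intervalIntegral.integral_nonneg hab fun s _ => hf0 s
  have hfin : ∀ d, 0 ≤ d → d ≤ 2 * R → ∀ J, 0 ≤ J → J ≤ ∫ s in -R..R, f s →
      exp (K * d) * (q y0 + J) ≤ exp (2 * R * K) * (q y0 + ∫ s in -R..R, f s) := by
    intro d _ hd2 J hJ0 hJ1
    have := hq0 y0
    have e : exp (K * d) ≤ exp (2 * R * K) := exp_le_exp.2 (by nlinarith)
    gcongr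
  rcases le_total y0 y with hle | hle
  · refine (gron_aux hle hK hq hf hf0 fun s hs => (le_abs_self _).trans
      (h s ⟨hy0.1.trans hs.1, hs.2.trans hy.2⟩)).trans ?_
    exact hfin _ (by linarith) (by linarith [hy.2, hy0.1]) _ (hJ _ _ hy0.1 hle hy.2)
      (sub_int hy0.1 hle hy.2 hf hf0)
  · have h1 := gron_aux (q := fun s => q (-s)) (q' := fun s => - q' (-s)) (f := fun s => f (-s))
      (K := K) (neg_le_neg hle) hK
      (fun s => by
        have := (hq (-s)).comp s (hasDerivAt_neg s)
        exact this.congr_deriv (by ring))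
      (hf.comp continuous_neg) (fun s => hf0 _) (fun s hs => by
        have := h (-s) ⟨by linarith [hs.2, hy.1], by linarith [hs.1, hy0.2]⟩
        exact (neg_le_abs _).trans this)
    simp only [neg_neg] at h1
    refine h1.trans ?_
    rw [intervalIntegral.integral_comp_neg, neg_neg, neg_neg]
    exact hfin _ (by linarith) (by linarith [hy.1, hy0.2]) _ (hJ _ _ hy.1 hle hy0.2)
      (sub_int hy.1 hle hy0.2 hf hf0)

lemma rho_lower {R y : ℝ} (h : y ∈ Icc (-R) R) : exp (-(R ^ 2 / 4)) ≤ rho y := by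
  unfold rho
  apply exp_le_exp.2
  have : y ^ 2 ≤ R ^ 2 := sq_le_sq' h.1 h.2
  linarith

lemma int_local {f : ℝ → ℝ} {R : ℝ} (hR : 0 ≤ R) (hf : PG f) (hf0 : ∀ y, 0 ≤ f y) :
    ∫ s in -R..R, f s ≤ exp (R ^ 2 / 4) * ∫ y, f y * rho y := by
  rw [intervalIntegral.integral_of_le (by linarith)]
  have h1 : ∫ s in Ioc (-R) R, f s ≤ ∫ s in Ioc (-R) R, exp (R ^ 2 / 4) * (f s * rho s) := by
    refine setIntegral_mono_on ?_ ?_ measurableSet_Ioc fun s hs => ?_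
    · exact hf.cont.integrableOn_Ioc
    · exact (hf.integrable.const_mul _).integrableOn
    · have h2 := rho_lower (Ioc_subset_Icc_self hs)
      have h3 : exp (R ^ 2 / 4) * exp (-(R ^ 2 / 4)) = 1 := by rw [← exp_add]; simp
      have h4 : 1 ≤ exp (R ^ 2 / 4) * rho s := by
        rw [← h3]; gcongr
      nlinarith [mul_le_mul_of_nonneg_left h4 (hf0 s)]
  refine h1.trans ?_
  rw [← integral_const_mul]
  refine setIntegral_le_integral (hf.integrable.const_mul _) (Eventually.of_forall fun y => ?_)
  have := hf0 y
  have := rho_pos y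
  simp only [Pi.zero_apply]
  positivity

lemma ST.tail (h : ST Nm ε w wy wyy) : ∫ y, (y ^ 2 * w y ^ 2) * rho y ≤ 4 + 16 * Nm := by
  have pw := h.pw
  have pwy := h.pwy
  have i1 := ibp (f := fun y => y * w y ^ 2) (f' := fun y => w y ^ 2 + 2 * (y * w y * wy y))
    (PG.id.mul pw.sq) (pw.sq.add ((PG.const 2).mul ((PG.id.mul pw).mul pwy)))
    (fun y => ((hasDerivAt_id y).mul ((h.dy y).pow 2)).congr_deriv (by simp; ring))
  have i2 : ∫ y, ((1/4) * (y ^ 2 * w y ^ 2) + (-1) * (w y ^ 2 + 4 * wy y ^ 2)) * rho y ≤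
      ∫ y, (-1 * (w y ^ 2 + 2 * (y * w y * wy y) - y / 2 * (y * w y ^ 2))) * rho y := by
    refine int_mono (((PG.const _).mul (PG.id.sq.mul pw.sq)).add
      ((PG.const _).mul (pw.sq.add ((PG.const _).mul pwy.sq))))
      ((PG.const _).mul ((pw.sq.add ((PG.const 2).mul ((PG.id.mul pw).mul pwy))).sub
        (PG.half.mul (PG.id.mul pw.sq)))) fun y => ?_
    nlinarith [sq_nonneg (y * w y / 2 - 2 * wy y)]
  rw [int_cmul, i1, int_add ((PG.const _).mul (PG.id.sq.mul pw.sq))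
    ((PG.const _).mul (pw.sq.add ((PG.const _).mul pwy.sq))), int_cmul, int_cmul,
    int_add pw.sq ((PG.const _).mul pwy.sq), int_cmul] at i2
  have e1 : ∫ y, w y ^ 2 * rho y = 1 := h.H1
  have e2 : ∫ y, wy y ^ 2 * rho y ≤ Nm := h.Nle
  rw [e1] at i2
  linarith

lemma ST.qd (h : ST Nm ε w wy wyy) (R : ℝ) (y : ℝ) (hy : y ∈ Icc (-R) R) :
    |2 * w y * wy y + 2 * wy y * wyy y| ≤ (2 + Nm + R) * (w y ^ 2 + wy y ^ 2)
      + FF w wy wyy y ^ 2 := by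
  have hN := h.Nle
  have hN0 := HH_nonneg wy
  have e : wyy y = FF w wy wyy y + y / 2 * wy y - HH wy * w y := by unfold FF; ring
  set F := FF w wy wyy y
  set N := HH wy
  set a := w y
  set b := wy y
  rw [e]
  have e2 : 2 * a * b + 2 * b * (F + y / 2 * b - N * a) =
    2 * (a * b) * (1 - N) + 2 * (b * F) + y * b ^ 2 := by ring
  rw [e2]
  have a1 : |2 * (a * b) * (1 - N)| ≤ (1 + Nm) * (a ^ 2 + b ^ 2) := by
    rw [abs_mul, mul_comm]
    refine mul_le_mul ?_ ?_ (abs_nonneg _) (by linarith)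
    · rw [abs_le]; constructor <;> linarith
    · rw [abs_le]; constructor <;> nlinarith [sq_nonneg (a + b), sq_nonneg (a - b)]
  have a2 : |2 * (b * F)| ≤ (a ^ 2 + b ^ 2) + F ^ 2 := by
    rw [abs_le]; constructor <;> nlinarith [sq_nonneg (b + F), sq_nonneg (b - F), sq_nonneg a]
  have a3 : |y * b ^ 2| ≤ R * (a ^ 2 + b ^ 2) := by
    rw [abs_mul, abs_of_nonneg (sq_nonneg b)]
    have : |y| ≤ R := abs_le.2 hy
    have hR : 0 ≤ R := (abs_nonneg y).trans this
    nlinarith [sq_nonneg a, sq_nonneg b, mul_nonneg hR (sq_nonneg a)]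
  calc _ ≤ |2 * (a * b) * (1 - N)| + |2 * (b * F)| + |y * b ^ 2| :=
        (abs_add_le _ _).trans (by gcongr; exact abs_add_le _ _)
    _ ≤ _ := by linarith

lemma ST.gron (h : ST Nm ε w wy wyy) {R y0 y : ℝ} (hR : 0 ≤ R) (hy0 : y0 ∈ Icc (-R) R)
    (hy : y ∈ Icc (-R) R) :
    w y ^ 2 + wy y ^ 2 ≤ exp (2 * R * (2 + Nm + R)) *
      (w y0 ^ 2 + wy y0 ^ 2 + exp (R ^ 2 / 4) * ε) := by
  have hN := h.Nmn
  have := ZN.gron (q := fun y => w y ^ 2 + wy y ^ 2)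
    (q' := fun y => 2 * w y * wy y + 2 * wy y * wyy y) (f := fun y => FF w wy wyy y ^ 2)
    (K := 2 + Nm + R) hy0 hy (by linarith) (fun s => by positivity)
    (fun s => (((h.dy s).pow 2).add ((h.dyy s).pow 2)).congr_deriv (by simp))
    (h.pF.cont.pow 2) (fun s => sq_nonneg _) (fun s hs => h.qd R s hs)
  refine this.trans ?_
  have h2 := int_local hR h.pF.sq (fun s => sq_nonneg _)
  have h3 := h.Fle'
  gcongr
  exact h2.trans (by gcongr)

lemma exists_le_of_int {f : ℝ → ℝ} (hf : Continuous f) {R A : ℝ} (hR : 0 < R)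
    (h : ∫ s in -R..R, f s ≤ A) : ∃ y ∈ Icc (-R) R, f y * (2 * R) ≤ A := by
  by_contra hcon
  push Not at hcon
  have h1 : ∫ s in -R..R, (A / (2 * R)) < ∫ s in -R..R, f s := by
    refine intervalIntegral.integral_lt_integral_of_continuousOn_of_le_of_exists_lt (by linarith)
      continuousOn_const hf.continuousOn (fun x hx => ?_) ⟨R, by simp; linarith, ?_⟩
    · rw [div_le_iff₀ (by linarith)]
      exact (hcon x (Ioc_subset_Icc_self hx)).le
    · rw [div_lt_iff₀ (by linarith)]
      exact hcon R (by simp; linarith)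
  rw [intervalIntegral.integral_const, smul_eq_mul] at h1
  have : (R - -R) * (A / (2 * R)) = A := by field_simp; ring
  linarith

lemma S0 (Nm R : ℝ) (hN : 0 ≤ Nm) : ∃ c > 0, ∃ K > 0, ∃ ε0 > 0, ∀ ε ≤ ε0,
    ∀ w wy wyy, ST Nm ε w wy wyy → ∀ y ∈ Icc (-R) R,
      c ≤ w y ^ 2 + wy y ^ 2 ∧ w y ^ 2 + wy y ^ 2 ≤ K := by
  obtain ⟨R0, hR0, hR1, hRR⟩ : ∃ R0 : ℝ, 1 ≤ R0 ∧ 2 * (4 + 16 * Nm) ≤ R0 ∧ R ≤ R0 :=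
    ⟨max 1 (max (2 * (4 + 16 * Nm)) R), le_max_left _ _, (le_max_left _ _).trans (le_max_right _ _),
      (le_max_right _ _).trans (le_max_right _ _)⟩
  have hR0p : 0 < R0 := by linarith
  set A := exp (2 * R0 * (2 + Nm + R0)) with hA
  set e := exp (R0 ^ 2 / 4) with he
  have hAp : 0 < A := exp_pos _
  have hep : 0 < e := exp_pos _
  refine ⟨1 / (8 * R0 * A), by positivity, A * (exp (R0 ^ 2 / 4) * (1 + Nm) + e), by positivity,
    min 1 (1 / (8 * R0 * A * e)), by positivity, ?_⟩
  intro ε hε w wy wyy h y hy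
  have hy' : y ∈ Icc (-R0) R0 := ⟨by linarith [hy.1], by linarith [hy.2]⟩
  have hε1 : ε ≤ 1 := hε.trans (min_le_left _ _)
  have hε2 : e * ε ≤ 1 / (8 * R0 * A) := by
    have : e * ε ≤ e * (1 / (8 * R0 * A * e)) := by gcongr; exact hε.trans (min_le_right _ _)
    refine this.trans (le_of_eq ?_)
    field_simp
  constructor
  · have h1 : 1 / 2 ≤ ∫ s in -R0..R0, w s ^ 2 * rho s := by
      have t1 : ∫ s, (1 / R0 * (s ^ 2 * w s ^ 2)) * rho s ≤ 1 / 2 := by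
        rw [int_cmul]
        have := h.tail
        calc 1 / R0 * ∫ y, y ^ 2 * w y ^ 2 * rho y ≤ 1 / R0 * (4 + 16 * Nm) := by gcongr
          _ ≤ 1 / 2 := by rw [one_div_mul_eq_div, div_le_iff₀ hR0p]; linarith
      have t2 : ∫ s, w s ^ 2 * rho s = 1 := h.H1
      have hI := h.pw.sq.integrable
      rw [intervalIntegral.integral_of_le (by linarith)]
      rw [← integral_add_compl (measurableSet_Ioc (a := -R0) (b := R0)) hI] at t2
      have t3 : ∫ s in (Ioc (-R0) R0)ᶜ, w s ^ 2 * rho s ≤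
          ∫ s, (1 / R0 * (s ^ 2 * w s ^ 2)) * rho s := by
        have hI2 := ((PG.const (1 / R0)).mul (PG.id.sq.mul h.pw.sq)).integrable
        refine (setIntegral_mono_on hI.integrableOn hI2.integrableOn
          measurableSet_Ioc.compl fun s hs => ?_).trans
          (setIntegral_le_integral hI2 (Eventually.of_forall fun s => ?_))
        · have hs2 : R0 ≤ s ^ 2 := by
            rw [mem_compl_iff, mem_Ioc, not_and_or, not_lt, not_le] at hs
            rcases hs with hs | hs <;> nlinarith
          have : 1 ≤ 1 / R0 * s ^ 2 := by rw [one_div_mul_eq_div, le_div_iff₀ hR0p]; linarith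
          have h3 := mul_nonneg (sq_nonneg (w s)) (rho_pos s).le
          nlinarith
        · have := rho_pos s
          simp only [Pi.zero_apply]
          positivity
      linarith
    obtain ⟨y1, hy1, h2⟩ := exists_le_of_int (f := fun s => -(w s ^ 2 * rho s))
      (A := -(1/2)) ((h.cw.pow 2).mul rho_cont).neg hR0p (by
        rw [intervalIntegral.integral_neg]; linarith)
    have hr1 : rho y1 ≤ 1 := by
      unfold rho; exact exp_le_one_iff.2 (by nlinarith [sq_nonneg y1])
    have h3 : 1 / (4 * R0) ≤ w y1 ^ 2 + wy y1 ^ 2 := by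
      have a1 : 1 / 2 ≤ w y1 ^ 2 * (2 * R0) := by
        have : w y1 ^ 2 * rho y1 ≤ w y1 ^ 2 * 1 := by gcongr
        nlinarith
      rw [div_le_iff₀ (by positivity)]
      nlinarith [sq_nonneg (wy y1)]
    have h4 := h.gron hR0p.le hy' hy1
    rw [← hA, ← he] at h4
    have h5 : 1 / (4 * R0) ≤ A * (w y ^ 2 + wy y ^ 2 + 1 / (8 * R0 * A)) :=
      (h3.trans h4).trans (by gcongr)
    have h6 : 1 / (4 * R0) = A * (1 / (8 * R0 * A) + 1 / (8 * R0 * A)) := by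
      field_simp; norm_num
    rw [h6] at h5
    have := le_of_mul_le_mul_left h5 hAp
    linarith
  · have hq : PG (fun y => w y ^ 2 + wy y ^ 2) := h.pw.sq.add h.pwy.sq
    have h1 := int_local hR0p.le hq (fun y => by positivity)
    rw [int_add h.pw.sq h.pwy.sq] at h1
    have e1 : ∫ y, w y ^ 2 * rho y = 1 := h.H1
    have e2 : ∫ y, wy y ^ 2 * rho y ≤ Nm := h.Nle
    have h2 : ∫ s in -R0..R0, (w s ^ 2 + wy s ^ 2) ≤ exp (R0 ^ 2 / 4) * (1 + Nm) :=
      h1.trans (by rw [e1]; gcongr)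
    obtain ⟨y1, hy1, h3⟩ := exists_le_of_int hq.cont hR0p h2
    have h4 := h.gron hR0p.le hy1 hy'
    refine h4.trans ?_
    rw [← hA, ← he]
    have h5 : 0 ≤ w y1 ^ 2 + wy y1 ^ 2 := by positivity
    have h6 : w y1 ^ 2 + wy y1 ^ 2 ≤ e * (1 + Nm) := by nlinarith
    have h7 : e * ε ≤ e := by nlinarith
    gcongr

end
end ZN

open Real Set Filter
namespace ZN
open Topology MeasureTheory
section
variable {Nm ε : ℝ} {w wy wyy : ℝ → ℝ}

noncomputable def mm : ℝ := ∫ y, rho y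

lemma mm_eq : ∫ y, (1 : ℝ) * rho y = mm := by simp [mm]

lemma mm_pos : 0 < mm := by
  have := int_sq_pos (PG.const 1) ⟨0, one_ne_zero⟩
  simpa [mm] using this

lemma mom1 : ∫ y, y * rho y = 0 := by
  have h := ibp (f := fun _ => 1) (f' := fun _ => 0) (PG.const 1) (PG.const 0)
    (fun y => hasDerivAt_const y 1)
  have e : (fun y : ℝ => (0 - y / 2 * 1) * rho y) = fun y => (-(1/2) * y) * rho y := by
    funext y; ring
  rw [e, int_cmul] at h
  linarith

lemma mom2 : ∫ y, y ^ 2 * rho y = 2 * mm := by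
  have h := ibp (f := fun y => y) (f' := fun _ => 1) PG.id (PG.const 1)
    (fun y => hasDerivAt_id y)
  have e : (fun y : ℝ => (1 - y / 2 * y) * rho y) = fun y => (1 + -(1/2) * y ^ 2) * rho y := by
    funext y; ring
  rw [e, int_add (PG.const 1) ((PG.const _).mul PG.id.sq), int_cmul, mm_eq] at h
  linarith

lemma sq_le_abs {x K : ℝ} (hK : 0 ≤ K) (h : x ^ 2 ≤ K) : |x| ≤ K + 1 := by
  refine abs_le_of_sq_le_sq ?_ (by linarith)
  nlinarith

lemma ST.wy_lip (h : ST Nm ε w wy wyy) {K : ℝ} (hK : 0 ≤ K)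
    (hq : ∀ y ∈ Icc (-2 : ℝ) 2, w y ^ 2 + wy y ^ 2 ≤ K) {x y : ℝ}
    (hx : x ∈ Icc (-2 : ℝ) 2) (hy : y ∈ Icc (-2 : ℝ) 2) :
    |wy y - wy x| ≤ (1 + (1 + Nm) * (K + 1)) * |y - x| + 3 * ε := by
  have hN := h.Nmn
  have key : ∀ a b, a ∈ Icc (-2 : ℝ) 2 → b ∈ Icc (-2 : ℝ) 2 → a ≤ b →
      |wy b - wy a| ≤ (1 + (1 + Nm) * (K + 1)) * (b - a) + 3 * ε := by
    intro a b ha hb hab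
    have e : ∫ s in a..b, wyy s = wy b - wy a :=
      intervalIntegral.integral_eq_sub_of_hasDerivAt (fun s _ => h.dyy s)
        (h.cyy.intervalIntegrable _ _)
    have hFc := h.pF.cont
    have h1 : |∫ s in a..b, wyy s| ≤ ∫ s in a..b, ((1 + (1 + Nm) * (K + 1)) +
        FF w wy wyy s ^ 2) := by
      refine (intervalIntegral.abs_integral_le_integral_abs hab).trans ?_
      refine intervalIntegral.integral_mono_on hab (h.cyy.abs.intervalIntegrable _ _)
        ((continuous_const.add (hFc.pow 2)).intervalIntegrable _ _) fun s hs => ?_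
      have hs2 : s ∈ Icc (-2 : ℝ) 2 := ⟨ha.1.trans hs.1, hs.2.trans hb.2⟩
      have hq' := hq s hs2
      have b1 : |w s| ≤ K + 1 := sq_le_abs hK (by nlinarith [sq_nonneg (wy s)])
      have b2 : |wy s| ≤ K + 1 := sq_le_abs hK (by nlinarith [sq_nonneg (w s)])
      have e1 : wyy s = FF w wy wyy s + s / 2 * wy s - HH wy * w s := by unfold FF; ring
      have e2 : |FF w wy wyy s| ≤ 1 + FF w wy wyy s ^ 2 := by
        rw [abs_le]; constructor <;> nlinarith [sq_nonneg (FF w wy wyy s + 1),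
          sq_nonneg (FF w wy wyy s - 1), sq_nonneg (FF w wy wyy s)]
      have e3 : |s / 2 * wy s| ≤ 1 * (K + 1) := by
        rw [abs_mul]
        refine mul_le_mul ?_ b2 (abs_nonneg _) zero_le_one
        rw [abs_le]; constructor <;> linarith [hs2.1, hs2.2]
      have e4 : |HH wy * w s| ≤ Nm * (K + 1) := by
        rw [abs_mul, abs_of_nonneg (HH_nonneg wy)]
        exact mul_le_mul h.Nle b1 (abs_nonneg _) hN
      rw [e1]
      have e5 := abs_sub (FF w wy wyy s + s / 2 * wy s) (HH wy * w s)
      have e6 := abs_add_le (FF w wy wyy s) (s / 2 * wy s)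
      linarith
    have hF2 : Continuous (fun s => FF w wy wyy s ^ 2) := hFc.pow 2
    rw [intervalIntegral.integral_add (continuous_const.intervalIntegrable _ _)
      (hF2.intervalIntegrable _ _), intervalIntegral.integral_const, smul_eq_mul, e] at h1
    have h2 : ∫ s in a..b, FF w wy wyy s ^ 2 ≤ 3 * ε := by
      refine (sub_int ha.1 hab hb.2 (hFc.pow 2) (fun s => sq_nonneg _)).trans ?_
      refine (int_local (by norm_num) h.pF.sq (fun s => sq_nonneg _)).trans ?_
      have h3 := h.Fle'
      have h4 : 0 ≤ ∫ y, FF w wy wyy y ^ 2 * rho y := int_nonneg fun _ => sq_nonneg _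
      have h5 : exp ((2 : ℝ) ^ 2 / 4) ≤ 3 := by
        rw [show (2 : ℝ) ^ 2 / 4 = 1 by norm_num]
        exact (exp_one_lt_d9.trans (by norm_num)).le
      exact mul_le_mul h5 h3 h4 (by norm_num)
    linarith
  rcases le_total x y with hxy | hxy
  · rw [abs_of_nonneg (sub_nonneg.2 hxy)]
    exact key x y hx hy hxy
  · rw [abs_sub_comm, abs_sub_comm y x, abs_of_nonneg (sub_nonneg.2 hxy)]
    exact key y x hy hx hxy

lemma ST.w_taylor (h : ST Nm ε w wy wyy) {K : ℝ} (hK : 0 ≤ K)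
    (hq : ∀ y ∈ Icc (-2 : ℝ) 2, w y ^ 2 + wy y ^ 2 ≤ K) {x y : ℝ}
    (hx : x ∈ Icc (-2 : ℝ) 2) (hy : y ∈ Icc (-2 : ℝ) 2) :
    |w y - w x - (y - x) * wy x| ≤ ((1 + (1 + Nm) * (K + 1)) * |y - x| + 3 * ε) * |y - x| := by
  have hN := h.Nmn
  have hsub : uIcc x y ⊆ Icc (-2 : ℝ) 2 := by
    rw [← uIcc_of_le (by norm_num : (-2 : ℝ) ≤ 2)]
    exact uIcc_subset_uIcc (by rwa [uIcc_of_le (by norm_num)]) (by rwa [uIcc_of_le (by norm_num)])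
  have := (convex_uIcc x y).norm_image_sub_le_of_norm_hasDerivWithin_le
    (f := fun y => w y - (y - x) * wy x) (f' := fun y => wy y - wy x)
    (C := (1 + (1 + Nm) * (K + 1)) * |y - x| + 3 * ε)
    (fun s _ => (((h.dy s).sub (((hasDerivAt_id s).sub_const x).mul_const (wy x))).congr_deriv
      (by ring)).hasDerivWithinAt)
    (fun s hs => by
      rw [norm_eq_abs]
      refine (h.wy_lip hK hq hx (hsub hs)).trans ?_
      have : |s - x| ≤ |y - x| := by
        have := abs_sub_left_of_mem_uIcc hs
        exact this
      gcongr) left_mem_uIcc right_mem_uIcc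
  simp only [norm_eq_abs] at this
  convert this using 2
  ring

lemma rho_compare {s z x : ℝ} (hs : 0 < s) (hs2 : s ≤ 1 / 2) (hx : |x| ≤ 1) (hz : 1 < s ^ 2 * z ^ 2) :
    rho z ≤ 256 * s ^ 4 * rho (x + s * z) := by
  have h1 : rho z ≤ exp (1 / 2) * exp (-(z ^ 2 / 8)) * rho (x + s * z) := by
    unfold rho
    rw [← exp_add, ← exp_add]
    apply exp_le_exp.2
    have hx2 : x ^ 2 ≤ 1 := by rw [← sq_abs]; nlinarith [abs_nonneg x]
    have a1 : s ^ 2 ≤ 1 / 4 := by nlinarith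
    have a2 : (s * z) ^ 2 ≤ 1 / 4 * z ^ 2 := by rw [mul_pow]; gcongr
    nlinarith [sq_nonneg (x - s * z)]
  have h2 : exp (1 / 2 : ℝ) ≤ 2 := by
    have h3 : exp (1 / 2 : ℝ) ^ 2 = exp 1 := by rw [← exp_nat_mul]; norm_num
    have h4 := exp_one_lt_d9
    nlinarith [exp_pos (1 / 2 : ℝ)]
  have h3 : exp (-(z ^ 2 / 8)) ≤ 128 * s ^ 4 := by
    rw [exp_neg, inv_le_comm₀ (exp_pos _) (by positivity)]
    have h4 := quadratic_le_exp_of_nonneg (show 0 ≤ z ^ 2 / 8 by positivity)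
    have h5 : (128 * s ^ 4)⁻¹ ≤ (z ^ 2 / 8) ^ 2 / 2 := by
      rw [inv_le_iff_one_le_mul₀ (by positivity)]
      nlinarith
    have : 0 ≤ z ^ 2 / 8 := by positivity
    linarith
  refine h1.trans (mul_le_mul_of_nonneg_right ?_ (rho_pos _).le)
  calc exp (1 / 2) * exp (-(z ^ 2 / 8)) ≤ 2 * (128 * s ^ 4) := by gcongr
    _ = _ := by ring

lemma pt_inner {s z K2 K3 l r b v : ℝ} (hK : 40 * K2 ^ 2 ≤ K3)
    (r1' : v ^ 2 ≤ K2 ^ 2 * s ^ 2 * (2 * (1 + z ^ 2)))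
    (r2' : r ^ 2 ≤ K2 ^ 2 * s ^ 4 * (2 * (1 + z ^ 2) * z ^ 2)) :
    8 / 10 * l ^ 2 - 11 / 10 * (s * b) ^ 2 ≤ 9 / 10 * (l + r) ^ 2 + (-1) * (s * (b + v)) ^ 2 +
      K3 * s ^ 4 * (1 + z ^ 2) ^ 3 := by
  have t1 : 8 / 10 * l ^ 2 - 7.2 * r ^ 2 ≤ 9 / 10 * (l + r) ^ 2 := by
    nlinarith [sq_nonneg (l + 9 * r)]
  have t2 : (s * (b + v)) ^ 2 ≤ 11 / 10 * (s * b) ^ 2 + 11 * (s ^ 2 * v ^ 2) := by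
    nlinarith [sq_nonneg (s * b - 10 * (s * v))]
  have t3 : s ^ 2 * v ^ 2 ≤ s ^ 2 * (K2 ^ 2 * s ^ 2 * (2 * (1 + z ^ 2))) := by gcongr
  have t4 : 7.2 * (K2 ^ 2 * s ^ 4 * (2 * (1 + z ^ 2) * z ^ 2)) +
      11 * (s ^ 2 * (K2 ^ 2 * s ^ 2 * (2 * (1 + z ^ 2)))) ≤ K3 * s ^ 4 * (1 + z ^ 2) ^ 3 := by
    have u1 : 1 ≤ 1 + z ^ 2 := by nlinarith [sq_nonneg z]
    have u2 : (1 + z ^ 2) * z ^ 2 ≤ (1 + z ^ 2) ^ 3 := by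
      calc (1 + z ^ 2) * z ^ 2 ≤ (1 + z ^ 2) * (1 + z ^ 2) := by gcongr; linarith
        _ = (1 + z ^ 2) ^ 2 := by ring
        _ ≤ _ := pow_le_pow_right₀ u1 (by norm_num)
    have u3 : (1 + z ^ 2) ≤ (1 + z ^ 2) ^ 3 := by
      calc 1 + z ^ 2 = (1 + z ^ 2) ^ 1 := by ring
        _ ≤ _ := pow_le_pow_right₀ u1 (by norm_num)
    have u4 : 0 ≤ K2 ^ 2 * s ^ 4 := by positivity
    have u5 : 40 * K2 ^ 2 * (s ^ 4 * (1 + z ^ 2) ^ 3) ≤ K3 * (s ^ 4 * (1 + z ^ 2) ^ 3) := by gcongr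
    have u6 := mul_le_mul_of_nonneg_left u2 u4
    have u7 := mul_le_mul_of_nonneg_left u3 u4
    have u8 : 0 ≤ K2 ^ 2 * s ^ 4 * (1 + z ^ 2) ^ 3 := by positivity
    linarith
  linarith

lemma pt_outer {s z K a b : ℝ} (bα : a ^ 2 ≤ (K + 1) ^ 2) (bβ : b ^ 2 ≤ (K + 1) ^ 2)
    (hz : 1 < s ^ 2 * z ^ 2) : (a + s * b * z) ^ 2 ≤ 4 * (K + 1) ^ 2 * s ^ 4 * (1 + z ^ 2) ^ 3 := by
  have : (a + s * b * z) ^ 2 ≤ 2 * (K + 1) ^ 2 * (1 + s ^ 2 * z ^ 2) := by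
    have q1 : (s * b * z) ^ 2 ≤ (K + 1) ^ 2 * (s ^ 2 * z ^ 2) := by
      calc (s * b * z) ^ 2 = b ^ 2 * (s ^ 2 * z ^ 2) := by ring
        _ ≤ _ := by gcongr
    nlinarith [sq_nonneg (a - s * b * z)]
  have q2 : 1 + s ^ 2 * z ^ 2 ≤ 2 * (s ^ 2 * z ^ 2) ^ 2 := by nlinarith
  have q3 : (z ^ 2) ^ 2 ≤ (1 + z ^ 2) ^ 3 := by
    have u1 : 1 ≤ 1 + z ^ 2 := by nlinarith [sq_nonneg z]
    calc (z ^ 2) ^ 2 ≤ (1 + z ^ 2) ^ 2 := by gcongr; linarith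
      _ ≤ _ := pow_le_pow_right₀ u1 (by norm_num)
  calc _ ≤ _ := this
    _ ≤ 2 * (K + 1) ^ 2 * (2 * (s ^ 2 * z ^ 2) ^ 2) := by gcongr
    _ = 4 * (K + 1) ^ 2 * s ^ 4 * (z ^ 2) ^ 2 := by ring
    _ ≤ _ := by gcongr

set_option maxHeartbeats 1000000 in
lemma S1 (Nm : ℝ) (hN : 0 ≤ Nm) : ∃ s0 > 0, ∃ ε0 > 0, ∀ ε ≤ ε0,
    ∀ w wy wyy, ST Nm ε w wy wyy → ∀ s > 0, s ≤ s0 → 3 * ε ≤ s → ∀ x, |x| ≤ 1 →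
      HH (fun z => s * wy (x + s * z)) ≤ 9 / 10 * HH (fun z => w (x + s * z)) := by
  obtain ⟨c, hc, K, hK, ε0, hε0, hS0⟩ := S0 Nm 2 hN
  obtain ⟨K2, hK2, hK2p⟩ : ∃ K2, K2 = 2 + (1 + Nm) * (K + 1) ∧ 0 ≤ K2 := ⟨_, rfl, by positivity⟩
  obtain ⟨K3, hK3a, hK3b, hK3c, hK3p⟩ : ∃ K3, 40 * K2 ^ 2 ≤ K3 ∧ 4 * (K + 1) ^ 2 ≤ K3 ∧
      256 ≤ K3 ∧ 0 < K3 := by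
    have := sq_nonneg K2
    have := sq_nonneg (K + 1)
    exact ⟨40 * K2 ^ 2 + 4 * (K + 1) ^ 2 + 256, by linarith, by linarith, by linarith,
      by positivity⟩
  obtain ⟨M3, hM3⟩ : ∃ M3, M3 = ∫ z, (1 + z ^ 2) ^ 3 * rho z := ⟨_, rfl⟩
  have hM3p : 0 ≤ M3 := hM3 ▸ int_nonneg fun z => by positivity
  have hm := mm_pos
  obtain ⟨D, hD, hDp⟩ : ∃ D, D = K3 * (M3 + Nm) + 1 ∧ 0 < D := ⟨_, rfl, by positivity⟩
  refine ⟨min (1/2) (mm * c / (2 * D)), by positivity, ε0, hε0, ?_⟩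
  intro ε hε w wy wyy h s hs hs0 hεs x hx
  have hs1 : s ≤ 1 / 2 := hs0.trans (min_le_left _ _)
  have hs2 : s * D ≤ mm * c / 2 := by
    have : s ≤ mm * c / (2 * D) := hs0.trans (min_le_right _ _)
    rw [le_div_iff₀ (by positivity)] at this
    linarith
  have hq := hS0 ε hε w wy wyy h
  have hqK : ∀ y ∈ Icc (-2 : ℝ) 2, w y ^ 2 + wy y ^ 2 ≤ K := fun y hy => (hq y hy).2
  have hx' := abs_le.1 hx
  have hx2 : x ∈ Icc (-2 : ℝ) 2 := ⟨by linarith, by linarith⟩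
  have hqx := hq x hx2
  have bα : w x ^ 2 ≤ (K + 1) ^ 2 := by nlinarith [sq_nonneg (wy x)]
  have bβ : wy x ^ 2 ≤ (K + 1) ^ 2 := by nlinarith [sq_nonneg (w x)]
  have pt : ∀ z, (8 / 10 * (w x + s * wy x * z) ^ 2 - 11 / 10 * (s * wy x) ^ 2) * rho z ≤
      (9 / 10 * w (x + s * z) ^ 2 + (-1) * (s * wy (x + s * z)) ^ 2 +
        K3 * s ^ 4 * (1 + z ^ 2) ^ 3) * rho z +
        K3 * s ^ 6 * (wy (x + s * z) ^ 2 * rho (x + s * z)) := by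
    intro z
    have hP : 0 ≤ K3 * s ^ 6 * (wy (x + s * z) ^ 2 * rho (x + s * z)) := by
      have := rho_pos (x + s * z)
      positivity
    rcases le_or_gt (s ^ 2 * z ^ 2) 1 with hz | hz
    · refine le_add_of_le_of_nonneg (mul_le_mul_of_nonneg_right ?_ (rho_pos z).le) hP
      have hz1 : |s * z| ≤ 1 := abs_le_one_iff_mul_self_le_one.2 (by nlinarith)
      have hz1' := abs_le.1 hz1
      have hy : x + s * z ∈ Icc (-2 : ℝ) 2 := ⟨by linarith, by linarith⟩
      have r1 := h.wy_lip hK.le hqK hx2 hy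
      have r2 := h.w_taylor hK.le hqK hx2 hy
      rw [add_sub_cancel_left, abs_mul, abs_of_pos hs] at r1 r2
      have e0 : (1 + (1 + Nm) * (K + 1)) * (s * |z|) + 3 * ε ≤ K2 * s * (1 + |z|) := by
        have : 0 ≤ |z| := abs_nonneg z
        have h2 : 0 ≤ (1 + Nm) * (K + 1) := by positivity
        have h3 : 0 ≤ s * |z| := by positivity
        rw [hK2]
        nlinarith [mul_nonneg h2 hs.le, mul_nonneg h2 h3]
      obtain ⟨r, hr⟩ : ∃ r, r = w (x + s * z) - w x - s * z * wy x := ⟨_, rfl⟩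
      obtain ⟨v, hv⟩ : ∃ v, v = wy (x + s * z) - wy x := ⟨_, rfl⟩
      rw [← hr] at r2
      rw [← hv] at r1
      have z2 : (1 + |z|) ^ 2 ≤ 2 * (1 + z ^ 2) := by
        nlinarith [sq_abs z, sq_nonneg (|z| - 1)]
      have r1' : v ^ 2 ≤ K2 ^ 2 * s ^ 2 * (2 * (1 + z ^ 2)) := by
        have := pow_le_pow_left₀ (abs_nonneg _) (r1.trans e0) 2
        rw [sq_abs] at this
        calc v ^ 2 ≤ (K2 * s * (1 + |z|)) ^ 2 := this
          _ = K2 ^ 2 * s ^ 2 * (1 + |z|) ^ 2 := by ring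
          _ ≤ _ := by gcongr
      have r2' : r ^ 2 ≤ K2 ^ 2 * s ^ 4 * (2 * (1 + z ^ 2) * z ^ 2) := by
        have : |r| ≤ K2 * s * (1 + |z|) * (s * |z|) := r2.trans (by gcongr)
        have := pow_le_pow_left₀ (abs_nonneg _) this 2
        rw [sq_abs] at this
        calc r ^ 2 ≤ (K2 * s * (1 + |z|) * (s * |z|)) ^ 2 := this
          _ = K2 ^ 2 * s ^ 4 * ((1 + |z|) ^ 2 * z ^ 2) := by
            rw [mul_pow, mul_pow, mul_pow, mul_pow, sq_abs]; ring
          _ ≤ _ := by gcongr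
      have eW : w (x + s * z) = (w x + s * wy x * z) + r := by rw [hr]; ring
      have eV : wy (x + s * z) = wy x + v := by rw [hv]; ring
      rw [eW, eV]
      exact pt_inner hK3a r1' r2'
    · have hcmp := rho_compare hs hs1 hx hz
      have hr := (rho_pos z).le
      have a1 := pt_outer bα bβ hz
      have a2 : (8 / 10 * (w x + s * wy x * z) ^ 2) * rho z ≤
          (K3 * s ^ 4 * (1 + z ^ 2) ^ 3) * rho z := by
        refine mul_le_mul_of_nonneg_right ?_ hr
        have : 4 * (K + 1) ^ 2 * (s ^ 4 * (1 + z ^ 2) ^ 3) ≤ K3 * (s ^ 4 * (1 + z ^ 2) ^ 3) := by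
          gcongr
        have := sq_nonneg (w x + s * wy x * z)
        linarith
      have a3 : (s * wy (x + s * z)) ^ 2 * rho z ≤
          K3 * s ^ 6 * (wy (x + s * z) ^ 2 * rho (x + s * z)) := by
        have hrr := (rho_pos (x + s * z)).le
        calc (s * wy (x + s * z)) ^ 2 * rho z ≤ (s * wy (x + s * z)) ^ 2 *
              (256 * s ^ 4 * rho (x + s * z)) := by gcongr
          _ = 256 * s ^ 6 * (wy (x + s * z) ^ 2 * rho (x + s * z)) := by ring
          _ ≤ _ := by
            gcongr
      have a4 : 0 ≤ 9 / 10 * w (x + s * z) ^ 2 * rho z := by positivity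
      have a5 : 0 ≤ 11 / 10 * (s * wy x) ^ 2 * rho z := by positivity
      nlinarith
  obtain ⟨B, hB⟩ := h.bd
  have pW : PG (fun z => w (x + s * z)) :=
    PG.bd (h.cw.comp (by fun_prop)) B fun z => (hB _).1
  have pV : PG (fun z => s * wy (x + s * z)) :=
    (PG.const s).mul (PG.bd (h.cwy.comp (by fun_prop)) B fun z => (hB _).2.1)
  have pA : PG (fun z => K3 * s ^ 4 * (1 + z ^ 2) ^ 3) := by
    have p0 : PG (fun z => 1 + z ^ 2) := (PG.const 1).add PG.id.sq
    have := (PG.const (K3 * s ^ 4)).mul (p0.mul p0.sq)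
    refine (show (fun z : ℝ => K3 * s ^ 4 * (1 + z ^ 2) ^ 3) = _ from ?_) ▸ this
    funext z; ring
  have pWV := ((PG.const (9/10)).mul pW.sq).add ((PG.const (-1)).mul pV.sq)
  have iP : Integrable (fun z => wy (x + s * z) ^ 2 * rho (x + s * z)) := by
    have := (h.pwy.sq.integrable.comp_add_left x).comp_mul_left' hs.ne'
    simpa using this
  have eP : ∫ z, wy (x + s * z) ^ 2 * rho (x + s * z) = s⁻¹ * HH wy := by
    have e1 := Measure.integral_comp_mul_left (fun y => wy (x + y) ^ 2 * rho (x + y)) s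
    rw [e1, integral_add_left_eq_self (fun y => wy y ^ 2 * rho y) x, abs_of_pos (inv_pos.2 hs),
      smul_eq_mul, HH]
  have pl : PG (fun z => w x + s * wy x * z) := (PG.const _).add ((PG.const _).mul PG.id)
  have iL := (((PG.const (8/10)).mul pl.sq).sub (PG.const (11 / 10 * (s * wy x) ^ 2))).integrable
  have hint := integral_mono iL (((pWV.add pA).integrable).add (iP.const_mul (K3 * s ^ 6))) pt
  have hR : ∫ z, ((9 / 10 * w (x + s * z) ^ 2 + (-1) * (s * wy (x + s * z)) ^ 2 +
        K3 * s ^ 4 * (1 + z ^ 2) ^ 3) * rho z +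
        K3 * s ^ 6 * (wy (x + s * z) ^ 2 * rho (x + s * z))) =
      9 / 10 * HH (fun z => w (x + s * z)) - HH (fun z => s * wy (x + s * z)) +
        K3 * s ^ 4 * M3 + K3 * s ^ 6 * (s⁻¹ * HH wy) := by
    rw [integral_add (pWV.add pA).integrable (iP.const_mul _), int_add pWV pA,
      int_add ((PG.const (9/10)).mul pW.sq) ((PG.const (-1)).mul pV.sq), int_cmul, int_cmul,
      int_cmul, integral_const_mul, eP]
    rw [hM3]
    unfold HH
    ring
  have hL : ∫ z, (8 / 10 * (w x + s * wy x * z) ^ 2 - 11 / 10 * (s * wy x) ^ 2) * rho z =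
      mm * (8 / 10 * w x ^ 2 + 5 / 10 * (s * wy x) ^ 2) := by
    have e : (fun z => (8 / 10 * (w x + s * wy x * z) ^ 2 - 11 / 10 * (s * wy x) ^ 2) * rho z) =
        fun z => ((8 / 10 * w x ^ 2 - 11 / 10 * (s * wy x) ^ 2) * 1 +
          ((16 / 10 * w x * (s * wy x)) * z + 8 / 10 * (s * wy x) ^ 2 * z ^ 2)) * rho z := by
      funext z; ring
    rw [e, int_add ((PG.const _).mul (PG.const 1)) (((PG.const _).mul PG.id).add
      ((PG.const _).mul PG.id.sq)), int_add ((PG.const _).mul PG.id) ((PG.const _).mul PG.id.sq),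
      int_cmul, int_cmul, int_cmul, mom1, mom2, mm_eq]
    ring
  have hint' := (hL.symm.le.trans hint).trans hR.le
  have f1 : mm * (1 / 2 * (s ^ 2 * c)) ≤ mm * (8 / 10 * w x ^ 2 + 5 / 10 * (s * wy x) ^ 2) := by
    refine mul_le_mul_of_nonneg_left ?_ hm.le
    have hss : s ^ 2 ≤ 1 := by nlinarith
    have := mul_le_mul_of_nonneg_left hqx.1 (sq_nonneg s)
    nlinarith [mul_le_mul_of_nonneg_right hss (sq_nonneg (w x)), sq_nonneg (w x)]
  have f2 : K3 * s ^ 6 * (s⁻¹ * HH wy) ≤ K3 * s ^ 3 * Nm := by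
    have e1 : K3 * s ^ 6 * (s⁻¹ * HH wy) = K3 * s ^ 5 * HH wy := by field_simp
    rw [e1]
    have : s ^ 5 ≤ s ^ 3 := pow_le_pow_of_le_one hs.le (by linarith) (by norm_num)
    have := h.Nle
    have := HH_nonneg wy
    gcongr
  have f3 : K3 * s ^ 4 * M3 ≤ K3 * s ^ 3 * M3 := by
    have : s ^ 4 ≤ s ^ 3 := pow_le_pow_of_le_one hs.le (by linarith) (by norm_num)
    gcongr
  have f4 : K3 * s ^ 3 * M3 + K3 * s ^ 3 * Nm ≤ s ^ 2 * (mm * c / 2) := by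
    have : s ^ 2 * (s * D) ≤ s ^ 2 * (mm * c / 2) := by gcongr
    have h3 : 0 ≤ s ^ 3 := by positivity
    rw [hD] at this
    nlinarith
  linarith

end
end ZN

open Real Set Filter
namespace ZN
open Topology MeasureTheory
section
variable {Nm ε : ℝ} {w wy wyy : ℝ → ℝ}

lemma ST.ortho1 (h : ST Nm ε w wy wyy) :
    HH wy * ∫ y, w y * rho y = ∫ y, FF w wy wyy y * rho y := by
  have h1 := ibp h.pwy h.pwyy h.dyy
  unfold FF
  rw [int_add (h.pwyy.sub (PG.half.mul h.pwy)) ((PG.const _).mul h.pw), h1, int_cmul, zero_add]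

lemma ST.ortho2 (h : ST Nm ε w wy wyy) :
    (HH wy - 1 / 2) * ∫ y, (y * w y) * rho y = ∫ y, (FF w wy wyy y * y) * rho y := by
  have h1 := symm_L h.pwy h.pwyy PG.id (PG.const 1) h.dyy (fun y => hasDerivAt_id y)
  have h2 := ibp h.pw h.pwy h.dy
  have e : (fun y => (wy y - y / 2 * w y) * rho y) =
      fun y => (wy y + (-(1/2)) * (y * w y)) * rho y := by funext y; ring
  rw [e, int_add h.pwy ((PG.const _).mul (PG.id.mul h.pw)), int_cmul] at h2
  have e2 : (fun y => (FF w wy wyy y * y) * rho y) = fun y =>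
      ((wyy y - y / 2 * wy y) * y + HH wy * (y * w y)) * rho y := by
    funext y; unfold FF; ring
  rw [e2, int_add ((h.pwyy.sub (PG.half.mul h.pwy)).mul PG.id)
    ((PG.const _).mul (PG.id.mul h.pw)), int_cmul, h1]
  simp only [mul_one]
  linarith

lemma cs_int {F g : ℝ → ℝ} {δ : ℝ} (hδ : 0 < δ) (hF : PG F) (hg : PG g)
    (h : ∫ y, F y ^ 2 * rho y ≤ δ ^ 2) :
    |∫ y, (F y * g y) * rho y| ≤ δ * (1 + ∫ y, g y ^ 2 * rho y) / 2 := by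
  have key : ∀ s : ℝ, s ^ 2 = 1 → s * ∫ y, (F y * g y) * rho y ≤
      δ * (1 + ∫ y, g y ^ 2 * rho y) / 2 := by
    intro s hs
    have h1 : ∫ y, (s * (F y * g y)) * rho y ≤
        ∫ y, (1 / (2 * δ) * F y ^ 2 + δ / 2 * g y ^ 2) * rho y := by
      refine int_mono ((PG.const s).mul (hF.mul hg)) (((PG.const _).mul hF.sq).add
        ((PG.const _).mul hg.sq)) fun y => ?_
      have : 1 / (2 * δ) * F y ^ 2 + δ / 2 * g y ^ 2 - s * (F y * g y) =
          1 / (2 * δ) * (F y - s * δ * g y) ^ 2 := by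
        field_simp
        linear_combination (-δ ^ 2 * g y ^ 2) * hs
      have h2 : 0 ≤ 1 / (2 * δ) * (F y - s * δ * g y) ^ 2 := by positivity
      linarith
    rw [int_add ((PG.const _).mul hF.sq) ((PG.const _).mul hg.sq), int_cmul, int_cmul, int_cmul] at h1
    have h3 : 1 / (2 * δ) * ∫ y, F y ^ 2 * rho y ≤ 1 / (2 * δ) * δ ^ 2 := by gcongr
    have h4 : 1 / (2 * δ) * δ ^ 2 = δ / 2 := by field_simp
    linarith
  have k1 := key 1 (by norm_num)
  have k2 := key (-1) (by norm_num)
  rw [abs_le]; constructor <;> linarith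

lemma ST.small {δ : ℝ} (hδ : 0 < δ) (h : ST Nm ε w wy wyy) (hε : ε ≤ δ ^ 2)
    (hN : 9 / 10 ≤ HH wy) {R α β : ℝ} (hα : |α| ≤ R) (hβ : |β| ≤ 1) :
    ∫ y, (w y * (α + β * y)) * rho y ≤ δ * (1 + 2 * mm) * (R + 3) := by
  have hm := mm_pos
  have hF := h.Fle'.trans hε
  have i1 := cs_int hδ h.pF (PG.const 1) hF
  have i2 := cs_int hδ h.pF PG.id hF
  simp only [mul_one, one_pow] at i1
  rw [mm_eq, ← h.ortho1, abs_mul, abs_of_nonneg (HH_nonneg wy)] at i1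
  rw [mom2, ← h.ortho2, abs_mul, abs_of_nonneg (by linarith)] at i2
  set I1 := ∫ y, w y * rho y
  set I2 := ∫ y, (y * w y) * rho y
  have hG : 0 < δ * (1 + 2 * mm) := by positivity
  have hδm : 0 < δ * mm := by positivity
  have a1 : |I1| ≤ δ * (1 + 2 * mm) := by
    nlinarith [mul_le_mul_of_nonneg_right hN (abs_nonneg I1)]
  have a2 : |I2| ≤ 3 * (δ * (1 + 2 * mm)) := by
    nlinarith [mul_le_mul_of_nonneg_right hN (abs_nonneg I2)]
  have e : (fun y => (w y * (α + β * y)) * rho y) = fun y => (α * w y + β * (y * w y)) * rho y := by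
    funext y; ring
  rw [e, int_add ((PG.const _).mul h.pw) ((PG.const _).mul (PG.id.mul h.pw)), int_cmul, int_cmul]
  have b1 : α * I1 ≤ R * (δ * (1 + 2 * mm)) := by
    refine (le_abs_self _).trans ?_
    rw [abs_mul]
    exact mul_le_mul hα a1 (abs_nonneg _) ((abs_nonneg _).trans hα)
  have b2 : β * I2 ≤ 1 * (3 * (δ * (1 + 2 * mm))) := by
    refine (le_abs_self _).trans ?_
    rw [abs_mul]
    exact mul_le_mul hβ a2 (abs_nonneg _) zero_le_one
  linarith

def Trip (u : ℝ → ℝ) (a b : ℝ) : Prop :=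
  ∃ s y1 y2 y3 : ℝ, a ≤ y1 ∧ y1 < y2 ∧ y2 < y3 ∧ y3 ≤ b ∧ 0 < s * u y1 ∧ s * u y2 < 0 ∧
    0 < s * u y3

lemma signs_aux {R p n : ℝ} (hp : p ∈ Icc (-R) R) (hn : n ∈ Icc (-R) R)
    (hpn : p < n) (hwp : 0 < w p) (hwn : w n < 0) (hno : ¬ Trip w (-R) R) :
    ∃ z ∈ Icc (-R) R, ∀ y ∈ Icc (-R) R, 0 ≤ w y * (z - y) := by
  have key : ∀ y ∈ Icc (-R) R, ∀ y' ∈ Icc (-R) R, y < y' → 0 < w y' → 0 ≤ w y := by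
    intro y hy y' hy' hlt h1
    by_contra h2
    push Not at h2
    rcases lt_trichotomy p y with h | h | h
    · exact hno ⟨1, p, y, y', hp.1, h, hlt, hy'.2, by linarith, by linarith, by linarith⟩
    · rw [← h] at h2; linarith
    · exact hno ⟨-1, y, p, n, hy.1, h, hpn, hn.2, by linarith, by linarith, by linarith⟩
  set S := {y | y ∈ Icc (-R) R ∧ 0 < w y} with hS
  have hb : BddAbove S := ⟨R, fun y hy => hy.1.2⟩
  have hne : S.Nonempty := ⟨p, hp, hwp⟩
  refine ⟨sSup S, ⟨hp.1.trans (le_csSup hb ⟨hp, hwp⟩), csSup_le hne fun y hy => hy.1.2⟩, ?_⟩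
  intro y hy
  rcases lt_trichotomy y (sSup S) with h | h | h
  · obtain ⟨y', hy', hlt⟩ := exists_lt_of_lt_csSup hne h
    exact mul_nonneg (key y hy y' hy'.1 hlt hy'.2) (by linarith)
  · rw [← h]; simp
  · have : w y ≤ 0 := by
      by_contra h2
      push Not at h2
      have := le_csSup hb (show y ∈ S from ⟨hy, h2⟩)
      linarith
    exact mul_nonneg_of_nonpos_of_nonpos this (by linarith)

lemma signs {R : ℝ} (hR : 1 ≤ R) (hno : ¬ Trip w (-R) R) :
    ∃ α β : ℝ, |α| ≤ R ∧ |β| ≤ 1 ∧ (∀ y ∈ Icc (-R) R, 0 ≤ w y * (α + β * y)) ∧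
      (β = 0 ∧ |α| = 1 ∨ |β| = 1) := by
  by_cases h1 : ∃ p ∈ Icc (-R) R, 0 < w p
  · by_cases h2 : ∃ n ∈ Icc (-R) R, w n < 0
    · obtain ⟨p, hp, hwp⟩ := h1
      obtain ⟨n, hn, hwn⟩ := h2
      rcases lt_trichotomy p n with h | h | h
      · obtain ⟨z, hz, hh⟩ := signs_aux hp hn h hwp hwn hno
        exact ⟨z, -1, abs_le.2 hz, by simp, fun y hy => by
          have := hh y hy; nlinarith, Or.inr (by simp)⟩
      · rw [h] at hwp; linarith
      · have hno' : ¬ Trip (fun y => - w y) (-R) R := by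
          rintro ⟨s, y1, y2, y3, a1, a2, a3, a4, a5, a6, a7⟩
          exact hno ⟨-s, y1, y2, y3, a1, a2, a3, a4, by linarith, by linarith, by linarith⟩
        obtain ⟨z, hz, hh⟩ := signs_aux (w := fun y => - w y) hn hp h (by linarith) (by linarith)
          hno'
        exact ⟨-z, 1, by rw [abs_neg]; exact abs_le.2 hz, by simp, fun y hy => by
          have := hh y hy; nlinarith, Or.inr (by simp)⟩
    · push Not at h2
      exact ⟨1, 0, by simpa using hR, by simp, fun y hy => by simpa using h2 y hy,
        Or.inl (by simp)⟩
  · push Not at h1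
    exact ⟨-1, 0, by simpa using hR, by simp, fun y hy => by simpa using h1 y hy,
        Or.inl (by simp)⟩

lemma subint {α β p l : ℝ} (hl : 0 < l) (hl1 : l ≤ 1) (h : β = 0 ∧ |α| = 1 ∨ |β| = 1) :
    ∃ p', p ≤ p' ∧ p' + l / 4 ≤ p + l ∧ ∀ y ∈ Icc p' (p' + l / 4), l / 4 ≤ |α + β * y| := by
  rcases h with ⟨rfl, h⟩ | h
  · exact ⟨p, le_rfl, by linarith, fun y _ => by rw [zero_mul, add_zero, h]; linarith⟩
  · have e : ∀ y, |α + β * y| = |y + β * α| := fun y => by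
      have hb : β * β = 1 := by rw [← abs_mul_abs_self, h]; norm_num
      have : y + β * α = β * (α + β * y) := by linear_combination (-y) * hb
      rw [this, abs_mul, h, one_mul]
    simp only [e]
    rcases le_total (-(β * α)) (p + l / 2) with h1 | h1
    · exact ⟨p + 3 * l / 4, by linarith, by linarith, fun y hy =>
        (show l / 4 ≤ y + β * α by linarith [hy.1]).trans (le_abs_self _)⟩
    · exact ⟨p, by linarith, by linarith, fun y hy =>
        (show l / 4 ≤ -(y + β * α) by linarith [hy.2]).trans (neg_le_abs _)⟩

lemma ST.plat (h : ST Nm ε w wy wyy) {c K : ℝ} (hK : 0 < K)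
    (hq : ∀ y ∈ Icc (-2 : ℝ) 2, c ≤ w y ^ 2 + wy y ^ 2 ∧ w y ^ 2 + wy y ^ 2 ≤ K) {m l : ℝ}
    (hm : 0 < m) (hm1 : m ≤ 1) (hmc : m ≤ c / 8) (hl0 : 0 < l) (hl1 : l ≤ 1)
    (hl : l * (K + 1) ≤ m / 2) :
    ∃ p, 0 ≤ p ∧ p ≤ 1 ∧ ∀ y ∈ Icc p (p + l), m / 2 ≤ |w y| := by
  obtain ⟨p, hp, hwp⟩ : ∃ p ∈ Icc (0 : ℝ) 1, m ≤ |w p| := by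
    by_contra hcon
    push Not at hcon
    obtain ⟨ξ, hξ, e⟩ := exists_hasDerivAt_eq_slope w wy (zero_lt_one) h.cw.continuousOn
      (fun y _ => h.dy y)
    have h0 := abs_lt.1 (hcon 0 (by simp))
    have h1 := abs_lt.1 (hcon 1 (by simp))
    have h2 := abs_lt.1 (hcon ξ ⟨hξ.1.le, hξ.2.le⟩)
    have h3 := (hq ξ ⟨by linarith [hξ.1], by linarith [hξ.2]⟩).1
    rw [sub_zero, div_one] at e
    have b1 : wy ξ ^ 2 ≤ (2 * m) ^ 2 := sq_le_sq' (by linarith) (by linarith)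
    have b2 : w ξ ^ 2 ≤ m ^ 2 := sq_le_sq' (by linarith) (by linarith)
    nlinarith
  refine ⟨p, hp.1, hp.2, fun y hy => ?_⟩
  have := (convex_Icc p (p + l)).norm_image_sub_le_of_norm_hasDerivWithin_le
    (f := w) (f' := wy) (C := K + 1)
    (fun s _ => (h.dy s).hasDerivWithinAt)
    (fun s hs => by
      rw [norm_eq_abs]
      refine sq_le_abs hK.le ?_
      have := (hq s ⟨by linarith [hs.1, hp.1], by linarith [hs.2, hp.2]⟩).2
      nlinarith [sq_nonneg (w s)]) (left_mem_Icc.2 (by linarith)) hy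
  rw [norm_eq_abs, norm_eq_abs, abs_of_nonneg (sub_nonneg.2 hy.1)] at this
  have h2 : (K + 1) * (y - p) ≤ (K + 1) * l := by
    apply mul_le_mul_of_nonneg_left _ (by linarith); linarith [hy.2]
  have h3 := abs_sub_abs_le_abs_sub (w p) (w y)
  rw [abs_sub_comm] at h3
  linarith

lemma int_lower {f : ℝ → ℝ} (hf : PG f) (hnn : ∀ y, 0 ≤ f y) {p l m : ℝ} (hl : 0 ≤ l)
    (h : ∀ y ∈ Icc p (p + l), m ≤ f y * rho y) : l * m ≤ ∫ y, f y * rho y := by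
  have j1 : ∫ y in Icc p (p + l), m ≤ ∫ y in Icc p (p + l), f y * rho y :=
    setIntegral_mono_on (integrableOn_const (by simp)) hf.integrable.integrableOn
      measurableSet_Icc h
  have j2 : ∫ y in Icc p (p + l), f y * rho y ≤ ∫ y, f y * rho y :=
    setIntegral_le_integral hf.integrable
      (Eventually.of_forall fun y => mul_nonneg (hnn y) (rho_pos y).le)
  refine le_trans (le_of_eq ?_) (j1.trans j2)
  rw [setIntegral_const, measureReal_def, Real.volume_Icc,
    ENNReal.toReal_ofReal (by linarith), smul_eq_mul]
  ring

set_option maxHeartbeats 1000000 in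
lemma S2 (Nm : ℝ) (hN : 0 ≤ Nm) : ∃ R > 0, ∃ ε0 > 0, ∀ ε ≤ ε0,
    ∀ w wy wyy, ST Nm ε w wy wyy → 9 / 10 ≤ HH wy → Trip w (-R) R := by
  obtain ⟨c, hc, K, hK, ε0, hε0, hS0⟩ := S0 Nm 2 hN
  have hmm := mm_pos
  obtain ⟨m, hm, hm1, hmc⟩ : ∃ m > 0, m ≤ 1 ∧ m ≤ c / 8 :=
    ⟨min 1 (c / 8), by positivity, min_le_left _ _, min_le_right _ _⟩
  obtain ⟨l, hl0, hl1, hl⟩ : ∃ l > 0, l ≤ 1 ∧ l * (K + 1) ≤ m / 2 := by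
    refine ⟨min 1 (m / (2 * (K + 1))), by positivity, min_le_left _ _, ?_⟩
    have : min 1 (m / (2 * (K + 1))) ≤ (m / (2 * (K + 1))) := min_le_right _ _
    calc _ ≤ (m / (2 * (K + 1))) * (K + 1) := by gcongr
      _ = m / 2 := by field_simp
  obtain ⟨T, hT⟩ : ∃ T, T = 2 * mm + (4 + 16 * Nm) := ⟨_, rfl⟩
  have hTp : 0 < T := by rw [hT]; positivity
  obtain ⟨c1, hc1, hc1p⟩ : ∃ c1, c1 = l / 4 * (m / 2 * (l / 4) * exp (-1)) ∧ 0 < c1 :=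
    ⟨_, rfl, by positivity⟩
  obtain ⟨R, hR2, hRT⟩ : ∃ R, 2 ≤ R ∧ T ≤ R * (c1 / 4) := by
    refine ⟨max 2 (T / (c1 / 4)), le_max_left _ _, ?_⟩
    rw [← div_le_iff₀ (by positivity)]
    exact le_max_right _ _
  have hRp : 0 < R := by linarith
  obtain ⟨δ, hδ, hδ2⟩ : ∃ δ > 0, δ * (1 + 2 * mm) * (R + 3) ≤ c1 / 4 := by
    refine ⟨c1 / 4 / ((1 + 2 * mm) * (R + 3)), by positivity, le_of_eq ?_⟩
    field_simp
  refine ⟨R, hRp, min ε0 (δ ^ 2), by positivity, ?_⟩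
  intro ε hε w wy wyy h hN9
  by_contra hno
  obtain ⟨α, β, hα, hβ, hsgn, hty⟩ := signs (by linarith) hno
  have hsm := h.small hδ (hε.trans (min_le_right _ _)) hN9 hα hβ
  obtain ⟨p, hp0, hp1, hpl⟩ := h.plat hK (hS0 ε (hε.trans (min_le_left _ _)) w wy wyy h)
    hm hm1 hmc hl0 hl1 hl
  obtain ⟨p', hp', hp'2, hq⟩ := subint (p := p) hl0 hl1 hty
  have pq : PG (fun y => w y * (α + β * y)) :=
    h.pw.mul ((PG.const _).add ((PG.const _).mul PG.id))
  have pT : PG (fun y => y ^ 2 + y ^ 2 * w y ^ 2) := PG.id.sq.add (PG.id.sq.mul h.pw.sq)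
  have ph := pq.add ((PG.const (1 / R)).mul pT)
  have hnn : ∀ y, 0 ≤ w y * (α + β * y) + 1 / R * (y ^ 2 + y ^ 2 * w y ^ 2) := by
    intro y
    have hp : 0 ≤ 1 / R * (y ^ 2 + y ^ 2 * w y ^ 2) := by positivity
    by_cases hy : y ∈ Icc (-R) R
    · have := hsgn y hy
      linarith
    · have hyR : R ≤ |y| := by
        by_contra hcon
        push Not at hcon
        exact hy (abs_le.1 hcon.le)
      have b1 : |w y * (α + β * y)| ≤ |w y| * (2 * |y|) := by
        rw [abs_mul]
        refine mul_le_mul_of_nonneg_left ?_ (abs_nonneg _)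
        refine (abs_add_le _ _).trans ?_
        rw [abs_mul]
        nlinarith [abs_nonneg y]
      have b2 : |w y| * (2 * |y|) ≤ |y| * (1 + w y ^ 2) := by
        have : 2 * |w y| ≤ 1 + w y ^ 2 := by
          nlinarith [sq_abs (w y), sq_nonneg (|w y| - 1)]
        nlinarith [abs_nonneg y]
      have b3 : |y| * (1 + w y ^ 2) ≤ 1 / R * (y ^ 2 + y ^ 2 * w y ^ 2) := by
        rw [one_div_mul_eq_div, le_div_iff₀ hRp]
        have : |y| * R ≤ y ^ 2 := by rw [← sq_abs]; nlinarith [abs_nonneg y]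
        nlinarith [sq_nonneg (w y)]
      have := (abs_le.1 (b1.trans (b2.trans b3))).1
      linarith
  have hint : c1 ≤ ∫ y, (w y * (α + β * y) + 1 / R * (y ^ 2 + y ^ 2 * w y ^ 2)) * rho y := by
    rw [hc1]
    refine int_lower (p := p') ph hnn (by linarith) fun y hy => ?_
    have hy2 : y ∈ Icc (-2 : ℝ) 2 := ⟨by linarith [hy.1], by linarith [hy.2]⟩
    have r1 := rho_lower hy2
    rw [show -((2:ℝ) ^ 2 / 4) = -1 by norm_num] at r1
    have r2 := hpl y ⟨by linarith [hy.1], by linarith [hy.2]⟩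
    have r3 := hq y hy
    have r4 := hsgn y ⟨by linarith [hy2.1], by linarith [hy2.2]⟩
    have r5 : m / 2 * (l / 4) ≤ w y * (α + β * y) := by
      rw [← abs_of_nonneg r4, abs_mul]
      exact mul_le_mul r2 r3 (by positivity) (abs_nonneg _)
    have r6 : 0 ≤ 1 / R * (y ^ 2 + y ^ 2 * w y ^ 2) := by positivity
    exact mul_le_mul (by linarith) r1 (exp_pos _).le (by linarith)
  rw [int_add pq ((PG.const (1 / R)).mul pT), int_cmul, int_add PG.id.sq (PG.id.sq.mul h.pw.sq),
    mom2] at hint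
  have htail := h.tail
  have k1 : 1 / R * (2 * mm + ∫ y, (y ^ 2 * w y ^ 2) * rho y) ≤ c1 / 4 := by
    rw [one_div_mul_eq_div, div_le_iff₀ hRp]
    linarith
  linarith

end
end ZN

open Real Set Filter
namespace ZN
open Topology MeasureTheory

abbrev dom (a : ℝ) : Set (ℝ × ℝ) := Ioi a ×ˢ (univ : Set ℝ)

lemma dom_nhds {a t : ℝ} (y : ℝ) (h : a < t) : dom a ∈ 𝓝 (t, y) :=
  prod_mem_nhds (Ioi_mem_nhds h) univ_mem

lemma chain2 {f f1 f2 : ℝ → ℝ → ℝ} {a : ℝ}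
    (h1 : ∀ t > a, ∀ y, HasDerivAt (fun s => f s y) (f1 t y) t)
    (h2 : ∀ t > a, ∀ y, HasDerivAt (f t) (f2 t y) y)
    (c1 : ContinuousOn (fun z : ℝ × ℝ => f1 z.1 z.2) (dom a))
    (c2 : ContinuousOn (fun z : ℝ × ℝ => f2 z.1 z.2) (dom a))
    {p q : ℝ → ℝ} {p' q' s : ℝ} (hp : HasDerivAt p p' s) (hq : HasDerivAt q q' s) (hs : a < p s) :
    HasDerivAt (fun r => f (p r) (q r)) (f1 (p s) (q s) * p' + f2 (p s) (q s) * q') s := by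
  have hn := dom_nhds (q s) hs
  have e1 : ∀ᶠ v : ℝ × ℝ in 𝓝 (p s, q s), a < v.1 := by
    filter_upwards [hn] with v hv using hv.1
  have key := hasStrictFDerivAt_uncurry_coprod (𝕜 := ℝ) (u := (p s, q s)) (f := f)
    (f₁ := fun t y => ContinuousLinearMap.toSpanSingleton ℝ (f1 t y))
    (f₂ := fun t y => ContinuousLinearMap.toSpanSingleton ℝ (f2 t y))
    (by filter_upwards [e1] with v hv using (h1 v.1 hv v.2).hasFDerivAt)
    (by filter_upwards [e1] with v hv using (h2 v.1 hv v.2).hasFDerivAt)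
    (((ContinuousLinearMap.toSpanSingletonCLE (𝕜 := ℝ) (E := ℝ)).continuous.continuousAt).comp
      (c1.continuousAt hn))
    (((ContinuousLinearMap.toSpanSingletonCLE (𝕜 := ℝ) (E := ℝ)).continuous.continuousAt).comp
      (c2.continuousAt hn))
  have := key.hasFDerivAt.comp_hasDerivAt s (hp.prodMk hq)
  refine this.congr_deriv ?_
  simp [Function.HasUncurry.uncurry]
  ring

lemma cont_of_partials {f f1 f2 : ℝ → ℝ → ℝ} {a : ℝ}
    (h1 : ∀ t > a, ∀ y, HasDerivAt (fun s => f s y) (f1 t y) t)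
    (h2 : ∀ t > a, ∀ y, HasDerivAt (f t) (f2 t y) y)
    (c1 : ContinuousOn (fun z : ℝ × ℝ => f1 z.1 z.2) (dom a))
    (c2 : ContinuousOn (fun z : ℝ × ℝ => f2 z.1 z.2) (dom a)) :
    ContinuousOn (fun z : ℝ × ℝ => f z.1 z.2) (dom a) := by
  rintro ⟨t, y⟩ ⟨ht, -⟩
  have hn := dom_nhds y ht
  have e1 : ∀ᶠ v : ℝ × ℝ in 𝓝 (t, y), a < v.1 := by
    filter_upwards [hn] with v hv using hv.1
  have key := hasStrictFDerivAt_uncurry_coprod (𝕜 := ℝ) (u := (t, y)) (f := f)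
    (f₁ := fun t y => ContinuousLinearMap.toSpanSingleton ℝ (f1 t y))
    (f₂ := fun t y => ContinuousLinearMap.toSpanSingleton ℝ (f2 t y))
    (by filter_upwards [e1] with v hv using (h1 v.1 hv v.2).hasFDerivAt)
    (by filter_upwards [e1] with v hv using (h2 v.1 hv v.2).hasFDerivAt)
    (((ContinuousLinearMap.toSpanSingletonCLE (𝕜 := ℝ) (E := ℝ)).continuous.continuousAt).comp
      (c1.continuousAt hn))
    (((ContinuousLinearMap.toSpanSingletonCLE (𝕜 := ℝ) (E := ℝ)).continuous.continuousAt).comp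
      (c2.continuousAt hn))
  exact key.hasFDerivAt.continuousAt.continuousWithinAt

structure CV (τs M : ℝ) (v vt vy vyy : ℝ → ℝ → ℝ) : Prop where
  hM : 0 ≤ M
  dt : ∀ t > τs, ∀ y, HasDerivAt (fun s => v s y) (vt t y) t
  dy : ∀ t > τs, ∀ y, HasDerivAt (v t) (vy t y) y
  dyy : ∀ t > τs, ∀ y, HasDerivAt (vy t) (vyy t y) y
  ct : ContinuousOn (fun z : ℝ × ℝ => vt z.1 z.2) (dom τs)
  cy : ContinuousOn (fun z : ℝ × ℝ => vy z.1 z.2) (dom τs)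
  cyy : ContinuousOn (fun z : ℝ × ℝ => vyy z.1 z.2) (dom τs)
  bd : ∀ a > τs, ∀ b, ∃ C, ∀ t ∈ Icc a b, ∀ y,
    |v t y| ≤ C ∧ |vt t y| ≤ C ∧ |vy t y| ≤ C ∧ |vyy t y| ≤ C
  eq : ∀ t > τs, ∀ y, |vt t y - vyy t y| ≤ M * (|v t y| + |vy t y|)
  nt : ∀ t > τs, ∃ y, v t y ≠ 0

noncomputable def W0 (v : ℝ → ℝ → ℝ) (t0 y0 σ y : ℝ) : ℝ := v (t0 - exp (-σ)) (y0 + exp (-σ / 2) * y)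

noncomputable def W1 (vy : ℝ → ℝ → ℝ) (t0 y0 σ y : ℝ) : ℝ := exp (-σ / 2) * W0 vy t0 y0 σ y

noncomputable def W2 (vyy : ℝ → ℝ → ℝ) (t0 y0 σ y : ℝ) : ℝ := exp (-σ) * W0 vyy t0 y0 σ y

noncomputable def Wt (vt vy : ℝ → ℝ → ℝ) (t0 y0 σ y : ℝ) : ℝ :=
  exp (-σ) * W0 vt t0 y0 σ y + (-(1 / 2)) * y * W1 vy t0 y0 σ y

section
variable {τs M : ℝ} {v vt vy vyy : ℝ → ℝ → ℝ}

lemma exp_half (σ : ℝ) : exp (-σ / 2) * exp (-σ / 2) = exp (-σ) := by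
  rw [← exp_add]; congr 1; ring

lemma slice_cont {f : ℝ → ℝ → ℝ} (hc : ContinuousOn (fun z : ℝ × ℝ => f z.1 z.2) (dom τs))
    {t0 y0 σ : ℝ} (hσ : τs < t0 - exp (-σ)) : Continuous (W0 f t0 y0 σ) := by
  have : Continuous fun y : ℝ => ((t0 - exp (-σ), y0 + exp (-σ / 2) * y) : ℝ × ℝ) := by fun_prop
  exact hc.comp_continuous this fun y => ⟨hσ, mem_univ _⟩

lemma slice_tcont {f : ℝ → ℝ → ℝ} (hc : ContinuousOn (fun z : ℝ × ℝ => f z.1 z.2) (dom τs))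
    {t0 y0 σ : ℝ} (y : ℝ) (hσ : τs < t0 - exp (-σ)) :
    ContinuousAt (fun s => W0 f t0 y0 s y) σ := by
  have : Continuous fun s : ℝ => ((t0 - exp (-s), y0 + exp (-s / 2) * y) : ℝ × ℝ) := by fun_prop
  exact ContinuousAt.comp (f := fun s : ℝ => ((t0 - exp (-s), y0 + exp (-s / 2) * y) : ℝ × ℝ))
    (g := fun z : ℝ × ℝ => f z.1 z.2) (x := σ)
    (hc.continuousAt (dom_nhds _ hσ)) this.continuousAt

lemma slice_dy {f g : ℝ → ℝ → ℝ} (h : ∀ t > τs, ∀ y, HasDerivAt (f t) (g t y) y)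
    {t0 y0 σ : ℝ} (y : ℝ) (hσ : τs < t0 - exp (-σ)) :
    HasDerivAt (W0 f t0 y0 σ) (W1 g t0 y0 σ y) y := by
  have h1 : HasDerivAt (fun y => y0 + exp (-σ / 2) * y) (exp (-σ / 2)) y :=
    (((hasDerivAt_id y).const_mul _).const_add _).congr_deriv (by simp)
  exact ((h _ hσ (y0 + exp (-σ / 2) * y)).comp y h1).congr_deriv (by unfold W1 W0; ring)

lemma CV.ss (h : CV τs M v vt vy vyy) {t0 σ0 : ℝ} (y0 : ℝ) (h0 : 0 ≤ σ0)
    (h1 : exp (-σ0) < t0 - τs) :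
    ∃ C, SS σ0 M C (W0 v t0 y0) (Wt vt vy t0 y0) (W1 vy t0 y0) (W2 vyy t0 y0) := by
  obtain ⟨C, hC⟩ := h.bd (t0 - exp (-σ0)) (by linarith) t0
  have hsm : ∀ σ > σ0, exp (-σ) < exp (-σ0) := fun σ hσ => exp_lt_exp.2 (by linarith)
  have ht : ∀ σ > σ0, τs < t0 - exp (-σ) := fun σ hσ => by linarith [hsm σ hσ]
  have hI : ∀ σ > σ0, t0 - exp (-σ) ∈ Icc (t0 - exp (-σ0)) t0 := fun σ hσ =>
    ⟨by linarith [hsm σ hσ], by linarith [exp_pos (-σ)]⟩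
  have e1 : ∀ σ > σ0, exp (-σ / 2) ≤ 1 := fun σ hσ => exp_le_one_iff.2 (by linarith)
  have e2 : ∀ σ > σ0, exp (-σ) ≤ 1 := fun σ hσ => exp_le_one_iff.2 (by linarith)
  have hC0 : 0 ≤ C := (abs_nonneg _).trans (hC t0 ⟨by linarith [exp_pos (-σ0)], le_rfl⟩ 0).1
  have mulb : ∀ e x : ℝ, 0 < e → e ≤ 1 → |x| ≤ C → |e * x| ≤ C := fun e x he he1 hx => by
    rw [abs_mul, abs_of_pos he]; nlinarith [abs_nonneg x]
  have b1 : ∀ σ > σ0, ∀ y, |W1 vy t0 y0 σ y| ≤ C := fun σ hσ y =>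
    mulb _ _ (exp_pos _) (e1 σ hσ) (hC _ (hI σ hσ) _).2.2.1
  have cv := cont_of_partials h.dt h.dy h.ct h.cy
  refine ⟨C, ?_⟩
  constructor
  · exact h0
  · exact h.hM
  · intro σ hσ y
    have p1 : HasDerivAt (fun s => t0 - exp (-s)) (exp (-σ)) σ :=
      ((hasDerivAt_neg σ).exp.const_sub t0).congr_deriv (by ring)
    have p2 : HasDerivAt (fun s => y0 + exp (-s / 2) * y) (-(1 / 2) * exp (-σ / 2) * y) σ := by
      have : HasDerivAt (fun s : ℝ => -s / 2) (-1 / 2) σ := (hasDerivAt_neg σ).div_const 2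
      exact ((this.exp.mul_const y).const_add y0).congr_deriv (by ring)
    exact (chain2 h.dt h.dy h.ct h.cy p1 p2 (ht σ hσ)).congr_deriv (by unfold Wt W1 W0; ring)
  · exact fun σ hσ y => slice_dy h.dy y (ht σ hσ)
  · intro σ hσ y
    exact ((slice_dy h.dyy y (ht σ hσ)).const_mul _).congr_deriv (by
      unfold W2 W1; rw [← mul_assoc, exp_half])
  · intro σ hσ
    have c1 := slice_cont h.ct (y0 := y0) (ht σ hσ)
    have c2 := slice_cont h.cy (y0 := y0) (ht σ hσ)
    unfold Wt W1
    fun_prop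
  · intro σ hσ
    have c2 := slice_cont h.cyy (y0 := y0) (ht σ hσ)
    unfold W2
    fun_prop
  · intro σ hσ y
    exact (by fun_prop : Continuous fun s : ℝ => exp (-s / 2)).continuousAt.mul
      (slice_tcont h.cy y (ht σ hσ))
  · intro σ hσ y
    exact (by fun_prop : Continuous fun s : ℝ => exp (-s)).continuousAt.mul
      (slice_tcont h.cyy y (ht σ hσ))
  · exact fun σ hσ y => (hC _ (hI σ hσ) _).1
  · exact b1
  · exact fun σ hσ y => mulb _ _ (exp_pos _) (e2 σ hσ) (hC _ (hI σ hσ) _).2.2.2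
  · intro σ hσ y
    have a1 := mulb _ _ (exp_pos (-σ)) (e2 σ hσ) (hC _ (hI σ hσ) (y0 + exp (-σ / 2) * y)).2.1
    have a2 := b1 σ hσ y
    unfold Wt
    refine (abs_add_le _ _).trans ?_
    have a3 : |-(1 / 2) * y * W1 vy t0 y0 σ y| ≤ |y| * C := by
      rw [abs_mul]
      refine mul_le_mul ?_ a2 (abs_nonneg _) (abs_nonneg _)
      rw [abs_mul]; norm_num; nlinarith [abs_nonneg y]
    have : |exp (-σ) * W0 vt t0 y0 σ y| ≤ C := a1
    linarith
  · intro σ hσ y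
    have a1 := h.eq _ (ht σ hσ) (y0 + exp (-σ / 2) * y)
    have e : Wt vt vy t0 y0 σ y - (W2 vyy t0 y0 σ y - y / 2 * W1 vy t0 y0 σ y) =
        exp (-σ) * (W0 vt t0 y0 σ y - W0 vyy t0 y0 σ y) := by
      unfold Wt W2; ring
    rw [e, abs_mul, abs_of_pos (exp_pos _)]
    have a2 : |W0 vt t0 y0 σ y - W0 vyy t0 y0 σ y| ≤ M * (|W0 v t0 y0 σ y| + |W0 vy t0 y0 σ y|) :=
      a1
    have hM := h.hM
    have k1 : |W1 vy t0 y0 σ y| = exp (-σ / 2) * |W0 vy t0 y0 σ y| := by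
      unfold W1; rw [abs_mul, abs_of_pos (exp_pos _)]
    rw [k1]
    have k2 := e1 σ hσ
    have k3 := exp_pos (-σ / 2)
    calc exp (-σ) * |W0 vt t0 y0 σ y - W0 vyy t0 y0 σ y|
        ≤ exp (-σ) * (M * (|W0 v t0 y0 σ y| + |W0 vy t0 y0 σ y|)) :=
          mul_le_mul_of_nonneg_left a2 (exp_pos _).le
      _ = M * exp (-σ / 2) * (exp (-σ / 2) * |W0 v t0 y0 σ y| +
          exp (-σ / 2) * |W0 vy t0 y0 σ y|) := by rw [← exp_half]; ring
      _ ≤ _ := by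
        refine mul_le_mul_of_nonneg_left ?_ (by positivity)
        nlinarith [abs_nonneg (W0 v t0 y0 σ y)]
  · intro σ hσ
    obtain ⟨y, hy⟩ := h.nt _ (ht σ hσ)
    refine ⟨(y - y0) / exp (-σ / 2), ?_⟩
    unfold W0
    rw [mul_div_cancel₀ _ (exp_pos _).ne']
    simpa using hy

lemma CV.hz (h : CV τs M v vt vy vyy) {t0 σ0 y0 : ℝ}
    (h1 : exp (-σ0) < t0 - τs) (z0 : v t0 y0 = 0) (z1 : vy t0 y0 = 0) :
    ∃ K, ∀ σ > σ0, ∀ y, |W0 v t0 y0 σ y| ≤ K * exp (-σ) * (1 + y ^ 2) := by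
  obtain ⟨C, hC⟩ := h.bd (t0 - exp (-σ0)) (by linarith) t0
  have ht0 : τs < t0 := by linarith [exp_pos (-σ0)]
  have hC0 : 0 ≤ C := (abs_nonneg _).trans (hC t0 ⟨by linarith [exp_pos (-σ0)], le_rfl⟩ 0).1
  have htI : t0 ∈ Icc (t0 - exp (-σ0)) t0 := ⟨by linarith [exp_pos (-σ0)], le_rfl⟩
  have y1 : ∀ z, |vy t0 z| ≤ C * |z - y0| := by
    intro z
    have := convex_univ.norm_image_sub_le_of_norm_hasDerivWithin_le (f := vy t0) (f' := vyy t0)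
      (C := C) (x := y0) (y := z) (fun s _ => (h.dyy t0 ht0 s).hasDerivWithinAt)
      (fun s _ => (hC t0 htI s).2.2.2) (mem_univ _) (mem_univ _)
    rwa [z1, sub_zero] at this
  have y2 : ∀ z, |v t0 z| ≤ C * |z - y0| * |z - y0| := by
    intro z
    have := (convex_uIcc y0 z).norm_image_sub_le_of_norm_hasDerivWithin_le (f := v t0) (f' := vy t0)
      (C := C * |z - y0|) (x := y0) (y := z) (fun s _ => (h.dy t0 ht0 s).hasDerivWithinAt)
      (fun s hs => (y1 s).trans (mul_le_mul_of_nonneg_left (abs_sub_left_of_mem_uIcc hs) hC0))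
      left_mem_uIcc right_mem_uIcc
    rwa [z0, sub_zero] at this
  refine ⟨C, fun σ hσ y => ?_⟩
  have hsm : exp (-σ) < exp (-σ0) := exp_lt_exp.2 (by linarith)
  have hp := exp_pos (-σ)
  obtain ⟨z, hz⟩ : ∃ z, z = y0 + exp (-σ / 2) * y := ⟨_, rfl⟩
  have a1 := (convex_Icc (t0 - exp (-σ)) t0).norm_image_sub_le_of_norm_hasDerivWithin_le
    (f := fun s => v s z) (f' := fun s => vt s z) (C := C)
    (fun s hs => (h.dt s (by linarith [hs.1]) z).hasDerivWithinAt)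
    (fun s hs => (hC s ⟨by linarith [hs.1], hs.2⟩ z).2.1)
    (right_mem_Icc.2 (by linarith)) (left_mem_Icc.2 (by linarith))
  have a2 := y2 z
  have e : |z - y0| * |z - y0| = exp (-σ) * y ^ 2 := by
    rw [abs_mul_abs_self, hz, ← exp_half]; ring
  rw [mul_assoc, e] at a2
  simp only [norm_eq_abs] at a1
  have e3 : |t0 - exp (-σ) - t0| = exp (-σ) := by
    rw [show t0 - exp (-σ) - t0 = -exp (-σ) by ring, abs_neg, abs_of_pos hp]
  rw [e3] at a1
  unfold W0
  rw [← hz]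
  have := abs_sub_abs_le_abs_sub (v (t0 - exp (-σ)) z) (v t0 z)
  linarith

end
end ZN

open Real Set Filter
namespace ZN
open Topology MeasureTheory

lemma HH_cmul (c : ℝ) (f : ℝ → ℝ) : HH (fun y => c * f y) = c ^ 2 * HH f := by
  unfold HH
  rw [← int_cmul]
  congr 1; funext y; ring

section
variable {σ0 M C : ℝ} {w ws wy wyy : ℝ → ℝ → ℝ}

lemma SS.norm (h : SS σ0 M C w ws wy wyy) {σ Nm ε : ℝ} (hσ : σ0 < σ)
    (hN : NN (w σ) (wy σ) ≤ Nm) (hE : EE (w σ) (wy σ) (wyy σ) ≤ ε) :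
    ∃ c > 0, ST Nm ε (fun y => c * w σ y) (fun y => c * wy σ y) (fun y => c * wyy σ y) ∧
      HH (fun y => c * wy σ y) = NN (w σ) (wy σ) := by
  have hH := h.Hpos hσ
  have hc : (1 / √(HH (w σ))) ^ 2 = 1 / HH (w σ) := by
    rw [div_pow, sq_sqrt hH.le]; norm_num
  obtain ⟨c, hc0⟩ : ∃ c, c = 1 / √(HH (w σ)) := ⟨_, rfl⟩
  rw [← hc0] at hc
  have hcp : 0 < c := by rw [hc0]; positivity
  have hN1 : HH (fun y => c * wy σ y) = NN (w σ) (wy σ) := by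
    rw [HH_cmul, hc, NN]; ring
  refine ⟨c, hcp, ?_, hN1⟩
  constructor
  · exact fun y => (h.dy σ hσ y).const_mul c
  · exact fun y => (h.dyy σ hσ y).const_mul c
  · exact continuous_const.mul (h.cyy σ hσ)
  · refine ⟨c * C, fun y => ?_⟩
    simp only [abs_mul, abs_of_pos hcp]
    exact ⟨mul_le_mul_of_nonneg_left (h.b0 σ hσ y) hcp.le,
      mul_le_mul_of_nonneg_left (h.b1 σ hσ y) hcp.le,
      mul_le_mul_of_nonneg_left (h.b2 σ hσ y) hcp.le⟩
  · rw [HH_cmul, hc]; field_simp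
  · rw [hN1]; exact hN
  · rw [hN1]
    refine le_trans (le_of_eq ?_) hE
    unfold EE
    rw [div_eq_inv_mul, ← one_div, ← hc, ← int_cmul]
    congr 1; funext y; ring

end

section
variable {τs M : ℝ} {v vt vy vyy : ℝ → ℝ → ℝ}

lemma exists_sigma (D M : ℝ) (hD : 0 < D) : ∃ σ0 ≥ (0 : ℝ), exp (-σ0) < D ∧
    80 * M ^ 2 * exp (-σ0) ≤ 1 := by
  have ht : Tendsto (fun σ : ℝ => exp (-σ)) atTop (𝓝 0) := tendsto_exp_neg_atTop_nhds_zero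
  have h1 := ht.eventually (gt_mem_nhds hD)
  have h2 := (ht.const_mul (80 * M ^ 2)).eventually (ge_mem_nhds (by norm_num : 80 * M ^ 2 * 0 < (1:ℝ)))
  obtain ⟨σ, h3, h4, h5⟩ := (h1.and (h2.and (eventually_ge_atTop 0))).exists
  exact ⟨σ, h5, h3, h4⟩

lemma CV.setup (h : CV τs M v vt vy vyy) {t0 : ℝ} (y0 : ℝ) {σ0 : ℝ} (h0 : 0 ≤ σ0)
    (h1 : exp (-σ0) < t0 - τs) :
    ∃ C, SS σ0 M C (W0 v t0 y0) (Wt vt vy t0 y0) (W1 vy t0 y0) (W2 vyy t0 y0) ∧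
    ∃ Nm ≥ 0, ∀ σ ≥ σ0 + 1, NN (W0 v t0 y0 σ) (W1 vy t0 y0 σ) ≤ Nm := by
  obtain ⟨C, hS⟩ := h.ss y0 h0 h1
  refine ⟨C, hS, exp (2 * M ^ 2 * exp (-(σ0 + 1))) * (1 + NN (W0 v t0 y0 (σ0 + 1)) (W1 vy t0 y0 (σ0 + 1))), ?_, fun σ hσ => ?_⟩
  · have := NN_nonneg (W0 v t0 y0 (σ0 + 1)) (W1 vy t0 y0 (σ0 + 1))
    positivity
  · have := hS.F1 (show σ0 < σ0 + 1 by linarith) hσ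
    linarith

lemma CV.claimB (h : CV τs M v vt vy vyy) {t0 y0 : ℝ} (ht0 : τs < t0)
    (z0 : v t0 y0 = 0) (z1 : vy t0 y0 = 0) {η : ℝ} (hη : 0 < η) :
    ∃ t, t0 - η < t ∧ t < t0 ∧ τs < t ∧ Trip (v t) (y0 - η) (y0 + η) := by
  obtain ⟨σ0, h0, h1, h80⟩ := exists_sigma (t0 - τs) M (by linarith)
  obtain ⟨C, hS, Nm, hNm, hN⟩ := h.setup y0 h0 h1
  obtain ⟨K, hz⟩ := h.hz h1 z0 z1
  obtain ⟨R, hR, ε, hε, hS2⟩ := S2 Nm hNm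
  obtain ⟨σ2, hσ2, hF2⟩ := hS.F2 hε one_pos
  have ht : Tendsto (fun σ : ℝ => exp (-σ)) atTop (𝓝 0) := tendsto_exp_neg_atTop_nhds_zero
  have ht2 : Tendsto (fun σ : ℝ => exp (-σ / 2)) atTop (𝓝 0) := by
    have := ht.comp (tendsto_id.atTop_div_const (by norm_num : (0:ℝ) < 2))
    refine this.congr fun σ => ?_
    simp only [Function.comp, id]; congr 1; ring
  have e1 := ht.eventually (gt_mem_nhds hη)
  have e2 := (ht2.mul_const R).eventually (ge_mem_nhds (by simpa using hη : 0 * R < η))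
  obtain ⟨σ3, h3⟩ := eventually_atTop.1 (e1.and e2)
  obtain ⟨σ, hσ, hE⟩ := hF2 (max σ2 (max σ3 (σ0 + 1))) (le_max_left _ _)
  have g1 : σ3 < σ := ((le_max_left _ _).trans (le_max_right _ _)).trans_lt hσ.1
  have g2 : σ0 + 1 < σ := ((le_max_right _ _).trans (le_max_right _ _)).trans_lt hσ.1
  have hσ0 : σ0 < σ := by linarith
  obtain ⟨c, hc, hST, hNN⟩ := hS.norm hσ0 (hN σ g2.le) hE
  have hle : exp (-σ) ≤ exp (-σ0) := exp_le_exp.2 (by linarith)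
  have hF4 := hS.F4 hz hσ0 ((mul_le_mul_of_nonneg_left hle (by positivity)).trans h80)
  obtain ⟨s, y1, y2, y3, a1, a2, a3, a4, a5, a6, a7⟩ := hS2 ε le_rfl _ _ _ hST (by rw [hNN]; exact hF4.le)
  obtain ⟨h4, h5⟩ := h3 σ g1.le
  have hp := exp_pos (-σ)
  have hp2 := exp_pos (-σ / 2)
  refine ⟨t0 - exp (-σ), by linarith, by linarith, by linarith, s * c, y0 + exp (-σ / 2) * y1,
    y0 + exp (-σ / 2) * y2, y0 + exp (-σ / 2) * y3, ?_, ?_, ?_, ?_, ?_, ?_, ?_⟩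
  · nlinarith
  · have := mul_lt_mul_of_pos_left a2 hp2; linarith
  · have := mul_lt_mul_of_pos_left a3 hp2; linarith
  · nlinarith
  · rw [mul_assoc]; exact a5
  · rw [mul_assoc]; exact a6
  · rw [mul_assoc]; exact a7

lemma log_window {k τ σ'' : ℝ} (hk : 0 < k) (hτ : 0 < τ)
    (h : σ'' ∈ Ioo (-log τ - log (1 + k)) (-log τ - log (1 + k) + (log (1 + k) - log (1 + k / 2)))) :
    (1 + k / 2) * τ < exp (-σ'') ∧ exp (-σ'') < (1 + k) * τ := by
  constructor
  · rw [← log_lt_log_iff (by positivity) (exp_pos _), log_exp, log_mul (by positivity) hτ.ne']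
    linarith [h.2]
  · rw [← log_lt_log_iff (exp_pos _) (by positivity), log_exp, log_mul (by positivity) hτ.ne']
    linarith [h.1]

lemma CV.claimA (h : CV τs M v vt vy vyy) {t0 : ℝ} (y0 : ℝ) (ht0 : τs < t0) :
    ∃ ε > 0, ∀ t, t0 - ε < t → t < t0 → ∀ y, |y - y0| ≤ √(t0 - t) →
      ¬ (v t y = 0 ∧ vy t y = 0) := by
  obtain ⟨σ0, h0, h1, h80⟩ := exists_sigma ((t0 - τs) / 2) M (by linarith)
  obtain ⟨C, hS, Nm, hNm, hN⟩ := h.setup (t0 := t0) y0 h0 (by linarith)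
  obtain ⟨s0, hs0, ε1, hε1, hS1⟩ := S1 Nm hNm
  obtain ⟨k, hk, hk1, hks⟩ : ∃ k > 0, k ≤ 1 ∧ k ≤ s0 :=
    ⟨min 1 s0, by positivity, min_le_left _ _, min_le_right _ _⟩
  have hkk : 0 < k ^ 2 := by positivity
  have hkk1 : k ^ 2 ≤ 1 := by nlinarith
  obtain ⟨σ2, hσ2, hF2⟩ := hS.F2 (ε := min ε1 (k / 6)) (l := log (1 + k ^ 2) - log (1 + k ^ 2 / 2))
    (by positivity) (sub_pos.2 (log_lt_log (by positivity) (by linarith)))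
  obtain ⟨σm, hm1, hm2⟩ : ∃ σm, σ2 ≤ σm ∧ σ0 + 1 ≤ σm :=
    ⟨max σ2 (σ0 + 1), le_max_left _ _, le_max_right _ _⟩
  refine ⟨exp (-(σm + 1)), exp_pos _, fun t ht1 ht2 y hy hzero => ?_⟩
  obtain ⟨τ, hτ⟩ : ∃ τ, τ = t0 - t := ⟨_, rfl⟩
  have hτp : 0 < τ := by linarith
  have hτ1 : τ < exp (-(σm + 1)) := by linarith
  have hlog : σm + 1 < -log τ := by
    have := log_lt_log hτp hτ1
    rw [log_exp] at this
    linarith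
  have hl1 : log (1 + k ^ 2) ≤ 1 := by
    have := log_le_sub_one_of_pos (show 0 < 1 + k ^ 2 by positivity)
    linarith
  obtain ⟨σ'', hσ'', hE⟩ := hF2 (-log τ - log (1 + k ^ 2)) (by linarith)
  have g2 : σ0 + 1 < σ'' := by linarith [hσ''.1]
  obtain ⟨q1, q2⟩ := log_window hkk hτp hσ''
  obtain ⟨θ, hθ⟩ : ∃ θ, θ = exp (-σ'') := ⟨_, rfl⟩
  rw [← hθ] at q1 q2
  have hθp : 0 < θ := hθ ▸ exp_pos _
  have hτθ : τ < θ := by nlinarith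
  obtain ⟨c, hc, hST, -⟩ := hS.norm (by linarith : σ0 < σ'') (hN σ'' g2.le) hE
  have hrθ : exp (-σ'' / 2) = √θ := by
    rw [hθ, ← exp_half, sqrt_mul_self (exp_pos _).le]
  obtain ⟨s, hs⟩ : ∃ s, s = √((θ - τ) / θ) := ⟨_, rfl⟩
  have hspos : 0 < s := by rw [hs]; exact sqrt_pos.2 (div_pos (by linarith) hθp)
  have hsk : s ≤ k := by
    rw [hs]
    apply sqrt_le_iff.2 ⟨hk.le, ?_⟩
    rw [div_le_iff₀ hθp]
    nlinarith
  have hsk2 : k / 2 ≤ s := by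
    rw [hs]
    apply le_sqrt_of_sq_le
    rw [le_div_iff₀ hθp]
    nlinarith
  obtain ⟨x, hx⟩ : ∃ x, x = (y - y0) / √θ := ⟨_, rfl⟩
  have hrp : 0 < √θ := sqrt_pos.2 hθp
  have hx1 : |x| ≤ 1 := by
    rw [hx, abs_div, abs_of_pos hrp, div_le_one hrp]
    exact hy.trans (sqrt_le_sqrt (by linarith))
  have hεk : min ε1 (k / 6) ≤ k / 6 := min_le_right _ _
  have hmain := hS1 _ (min_le_left _ _) _ _ _ hST s hspos (hsk.trans hks) (by linarith) x hx1
  obtain ⟨σt, hσt⟩ : ∃ σt, σt = -log (θ - τ) := ⟨_, rfl⟩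
  have hθτ : 0 < θ - τ := by linarith
  have eσ : exp (-σt) = θ - τ := by rw [hσt, neg_neg, exp_log hθτ]
  have eσ2 : exp (-σt / 2) = s * √θ := by
    have h1 : exp (-σt / 2) = √(θ - τ) := by
      rw [← eσ, ← exp_half, sqrt_mul_self (exp_pos _).le]
    rw [h1, hs, ← sqrt_mul (by positivity), div_mul_cancel₀ _ hθp.ne']
  have hσt0 : σ0 < σt := by
    have : θ - τ < τ := by nlinarith
    have := log_lt_log hθτ this
    rw [hσt]
    linarith
  have hmm1 : exp (-(σm + 1)) < exp (-σ0) := exp_lt_exp.2 (by linarith)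
  have hE1 : exp (-σ0) < t - τs := by linarith
  obtain ⟨C', hS'⟩ := h.ss (t0 := t) y h0 hE1
  obtain ⟨K, hz⟩ := h.hz hE1 hzero.1 hzero.2
  have hle : exp (-σt) ≤ exp (-σ0) := exp_le_exp.2 (by linarith)
  have hF4 := hS'.F4 hz hσt0 ((mul_le_mul_of_nonneg_left hle (by positivity)).trans h80)
  have hH := hS'.Hpos hσt0
  have ept : ∀ f : ℝ → ℝ → ℝ, ∀ z, W0 f t0 y0 σ'' (x + s * z) = W0 f t y σt z := by
    intro f z
    unfold W0
    rw [eσ, eσ2, hrθ, ← hθ, hx]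
    congr 1
    · linarith
    · field_simp; ring
  have ew : (fun z => c * W0 v t0 y0 σ'' (x + s * z)) = fun z => c * W0 v t y σt z := by
    funext z; rw [ept]
  have ewy : (fun z => s * (c * W1 vy t0 y0 σ'' (x + s * z))) = fun z => c * W1 vy t y σt z := by
    funext z; unfold W1; rw [ept, eσ2, hrθ]; ring
  rw [ew, ewy, HH_cmul, HH_cmul] at hmain
  have hcc : 0 < c ^ 2 := by positivity
  have : HH (W1 vy t y σt) ≤ 9 / 10 * HH (W0 v t y σt) := by
    have : c ^ 2 * HH (W1 vy t y σt) ≤ c ^ 2 * (9 / 10 * HH (W0 v t y σt)) := by linarith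
    exact le_of_mul_le_mul_left this hcc
  have h9 : NN (W0 v t y σt) (W1 vy t y σt) ≤ 9 / 10 := by
    unfold NN
    rw [div_le_iff₀ hH]
    exact this
  linarith

end
end ZN

open Real Set Filter
namespace ZN
open Topology MeasureTheory

lemma prim_dt {g h : ℝ → ℝ → ℝ} {α C : ℝ} (hg : Continuous (Function.uncurry g))
    (hh : Continuous (Function.uncurry h)) (hC : ∀ t x, |h t x| ≤ C)
    (hd : ∀ t > α, ∀ x, HasDerivAt (fun s => g s x) (h t x) t) {t : ℝ} (ht : α < t) (x : ℝ) :
    HasDerivAt (fun s => ∫ z in (0:ℝ)..x, g s z) (∫ z in (0:ℝ)..x, h t z) t := by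
  have cg : ∀ s, Continuous (g s) := fun s => hg.comp (by fun_prop : Continuous fun z : ℝ => (s, z))
  have ch : ∀ s, Continuous (h s) := fun s => hh.comp (by fun_prop : Continuous fun z : ℝ => (s, z))
  refine (intervalIntegral.hasDerivAt_integral_of_dominated_loc_of_deriv_le (μ := volume)
    (s := Ioi α) (bound := fun _ => C) (F := g) (F' := h) (Ioi_mem_nhds ht) ?_ ?_ ?_ ?_ ?_ ?_).2
  · exact Eventually.of_forall fun s => (cg s).aestronglyMeasurable
  · exact (cg t).intervalIntegrable _ _
  · exact (ch t).aestronglyMeasurable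
  · exact Eventually.of_forall fun z _ s _ => hC s z
  · exact intervalIntegrable_const
  · exact Eventually.of_forall fun z _ s hs => hd s hs z

lemma expand1 {f f' : ℝ → ℝ} {m : ℝ} (hf : ∀ x, HasDerivAt f (f' x) x) (hm : ∀ x, m ≤ f' x)
    (x y : ℝ) : m * |x - y| ≤ |f x - f y| := by
  have key := mul_sub_le_image_sub_of_le_deriv (f := f) (fun x => (hf x).differentiableAt)
    (C := m) (fun x => by rw [(hf x).deriv]; exact hm x)
  rcases le_total x y with h | h
  · have := key h
    rw [abs_sub_comm x y, abs_of_nonneg (sub_nonneg.2 h), abs_sub_comm]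
    exact this.trans (le_abs_self _)
  · have := key h
    rw [abs_of_nonneg (sub_nonneg.2 h)]
    exact this.trans (le_abs_self _)

lemma surj1 {f f' : ℝ → ℝ} {m : ℝ} (hf : ∀ x, HasDerivAt f (f' x) x) (hm0 : 0 < m)
    (hm : ∀ x, m ≤ f' x) : Function.Surjective f := by
  have hc : Continuous f := continuous_iff_continuousAt.2 fun x => (hf x).continuousAt
  have key := mul_sub_le_image_sub_of_le_deriv (f := f) (fun x => (hf x).differentiableAt)
    (C := m) (fun x => by rw [(hf x).deriv]; exact hm x)
  refine hc.surjective ?_ ?_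
  · refine tendsto_atTop_mono' atTop (f₁ := fun x => f 0 + m * x) ?_
      (tendsto_atTop_add_const_left _ _ (tendsto_id.const_mul_atTop hm0))
    filter_upwards [eventually_ge_atTop 0] with x hx
    linarith [key hx]
  · refine tendsto_atBot_mono' atBot (f₁ := fun x => f 0 + m * x) ?_
      (tendsto_atBot_add_const_left _ _ (tendsto_id.const_mul_atBot hm0))
    filter_upwards [eventually_le_atBot 0] with x hx
    linarith [key hx]

lemma inv1 {f f' g : ℝ → ℝ} {m : ℝ} (hf : ∀ x, HasDerivAt f (f' x) x) (hm0 : 0 < m)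
    (hm : ∀ x, m ≤ f' x) (hg : ∀ y, f (g y) = y) (y : ℝ) : HasDerivAt g (f' (g y))⁻¹ y := by
  have hL : LipschitzWith (Real.toNNReal m⁻¹) g := by
    refine LipschitzWith.of_dist_le_mul fun x y => ?_
    rw [Real.coe_toNNReal _ (by positivity), Real.dist_eq, Real.dist_eq]
    have := expand1 hf hm (g x) (g y)
    rw [hg, hg] at this
    rw [inv_mul_eq_div, le_div_iff₀ hm0]; linarith
  exact (hf (g y)).of_local_left_inverse hL.continuous.continuousAt (hm0.trans_le (hm (g y))).ne'
    (Eventually.of_forall hg)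

structure CH (α m K : ℝ) (Y Yt Yx : ℝ → ℝ → ℝ) : Prop where
  hm : 0 < m
  hK : 0 ≤ K
  dt : ∀ t > α, ∀ x, HasDerivAt (fun s => Y s x) (Yt t x) t
  dx : ∀ t > α, ∀ x, HasDerivAt (Y t) (Yx t x) x
  ct : ContinuousOn (fun z : ℝ × ℝ => Yt z.1 z.2) (dom α)
  cx : ContinuousOn (fun z : ℝ × ℝ => Yx z.1 z.2) (dom α)
  bt : ∀ t > α, ∀ x, |Yt t x| ≤ K
  bx : ∀ t > α, ∀ x, m ≤ Yx t x
  bx' : ∀ t > α, ∀ x, Yx t x ≤ K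
  per : ∀ t > α, ∀ x, Y t (x + 2 * π) = Y t x + 1

section
variable {α m K : ℝ} {Y Yt Yx X : ℝ → ℝ → ℝ}

lemma CH.lip_t (h : CH α m K Y Yt Yx) {t t' : ℝ} (ht : α < t) (ht' : α < t') (x : ℝ) :
    |Y t x - Y t' x| ≤ K * |t - t'| :=
  (convex_Ioi α).norm_image_sub_le_of_norm_hasDerivWithin_le (f := fun s => Y s x)
    (f' := fun s => Yt s x)
    (fun s hs => (h.dt s hs x).hasDerivWithinAt) (fun s hs => h.bt s hs x) ht' ht

lemma CH.lip_x (h : CH α m K Y Yt Yx) {t : ℝ} (ht : α < t) (x x' : ℝ) :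
    |Y t x - Y t x'| ≤ K * |x - x'| :=
  (convex_univ).norm_image_sub_le_of_norm_hasDerivWithin_le (f := Y t)
    (f' := Yx t)
    (fun s _ => (h.dx t ht s).hasDerivWithinAt) (fun s _ => by
      rw [Real.norm_eq_abs, abs_of_nonneg (h.hm.le.trans (h.bx t ht s))]; exact h.bx' t ht s)
    (mem_univ _) (mem_univ _)

lemma CH.exists_inv (h : CH α m K Y Yt Yx) : ∃ X : ℝ → ℝ → ℝ, ∀ t > α, ∀ y, Y t (X t y) = y := by
  have : ∀ t y, ∃ x, α < t → Y t x = y := fun t y => by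
    by_cases ht : α < t
    · obtain ⟨x, hx⟩ := surj1 (h.dx t ht) h.hm (h.bx t ht) y
      exact ⟨x, fun _ => hx⟩
    · exact ⟨0, fun h => absurd h ht⟩
  choose X hX using this
  exact ⟨X, fun t ht y => hX t y ht⟩

lemma CH.left_inv (h : CH α m K Y Yt Yx) (hX : ∀ t > α, ∀ y, Y t (X t y) = y) {t : ℝ} (ht : α < t)
    (x : ℝ) : X t (Y t x) = x := by
  have := expand1 (h.dx t ht) (h.bx t ht) (X t (Y t x)) x
  rw [hX t ht, sub_self, abs_zero] at this
  have h2 : |X t (Y t x) - x| ≤ 0 := by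
    by_contra hc; push Not at hc; have := mul_pos h.hm hc; linarith
  exact sub_eq_zero.1 (abs_nonpos_iff.1 h2)

lemma CH.lip (h : CH α m K Y Yt Yx) (hX : ∀ t > α, ∀ y, Y t (X t y) = y) {t t' : ℝ} (ht : α < t)
    (ht' : α < t') (y y' : ℝ) : m * |X t y - X t' y'| ≤ K * |t - t'| + |y - y'| := by
  have h1 := expand1 (h.dx t' ht') (h.bx t' ht') (X t y) (X t' y')
  rw [hX t' ht'] at h1
  have h2 := h.lip_t ht' ht (X t y)
  rw [hX t ht] at h2
  have h3 := abs_add_le (Y t' (X t y) - y) (y - y')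
  rw [sub_add_sub_cancel] at h3
  rw [abs_sub_comm t t']
  linarith

lemma CH.contX (h : CH α m K Y Yt Yx) (hX : ∀ t > α, ∀ y, Y t (X t y) = y) :
    ContinuousOn (fun z : ℝ × ℝ => X z.1 z.2) (dom α) := by
  rintro ⟨t, y⟩ ⟨ht, -⟩
  refine ContinuousAt.continuousWithinAt ?_
  rw [ContinuousAt, tendsto_iff_dist_tendsto_zero]
  have hlim : Tendsto (fun z : ℝ × ℝ => (K * |z.1 - t| + |z.2 - y|) / m) (𝓝 (t, y)) (𝓝 0) := by
    have : Continuous fun z : ℝ × ℝ => (K * |z.1 - t| + |z.2 - y|) / m := by fun_prop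
    simpa using this.tendsto (t, y)
  refine squeeze_zero' (Eventually.of_forall fun _ => dist_nonneg) ?_ hlim
  filter_upwards [dom_nhds y ht] with z hz
  rw [Real.dist_eq, le_div_iff₀ h.hm, mul_comm]
  exact h.lip hX hz.1 ht _ _

lemma CH.dXy (h : CH α m K Y Yt Yx) (hX : ∀ t > α, ∀ y, Y t (X t y) = y) (t : ℝ) (ht : α < t)
    (y : ℝ) : HasDerivAt (X t) (Yx t (X t y))⁻¹ y :=
  inv1 (h.dx t ht) h.hm (h.bx t ht) (hX t ht) y

lemma CH.dXt (h : CH α m K Y Yt Yx) (hX : ∀ t > α, ∀ y, Y t (X t y) = y) (t : ℝ) (ht : α < t)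
    (y : ℝ) : HasDerivAt (fun s => X s y) (-(Yt t (X t y) / Yx t (X t y))) t := by
  have hn := dom_nhds (X t y) ht
  have e1 : ∀ᶠ v : ℝ × ℝ in 𝓝 (t, X t y), α < v.1 := by
    filter_upwards [hn] with v hv using hv.1
  have key := (hasStrictFDerivAt_uncurry_coprod (𝕜 := ℝ) (u := (t, X t y)) (f := Y)
    (f₁ := fun t y => ContinuousLinearMap.toSpanSingleton ℝ (Yt t y))
    (f₂ := fun t y => ContinuousLinearMap.toSpanSingleton ℝ (Yx t y))
    (by filter_upwards [e1] with v hv using (h.dt v.1 hv v.2).hasFDerivAt)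
    (by filter_upwards [e1] with v hv using (h.dx v.1 hv v.2).hasFDerivAt)
    (((ContinuousLinearMap.toSpanSingletonCLE (𝕜 := ℝ) (E := ℝ)).continuous.continuousAt).comp
      (h.ct.continuousAt hn))
    (((ContinuousLinearMap.toSpanSingletonCLE (𝕜 := ℝ) (E := ℝ)).continuous.continuousAt).comp
      (h.cx.continuousAt hn))).hasFDerivAt.isLittleO
  have hcont : Tendsto (fun s => (s, X s y)) (𝓝 t) (𝓝 (t, X t y)) := by
    refine tendsto_id.prodMk_nhds ?_
    have h1 : ContinuousAt (fun z : ℝ × ℝ => X z.1 z.2) (t, y) := (h.contX hX).continuousAt (dom_nhds y ht)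
    have h2 : ContinuousAt (fun s : ℝ => (s, y)) t := by fun_prop
    exact ContinuousAt.comp (f := fun s : ℝ => (s, y)) (g := fun z : ℝ × ℝ => X z.1 z.2) (x := t) h1 h2
  have k2 := key.comp_tendsto hcont
  have hpos : 0 < Yx t (X t y) := h.hm.trans_le (h.bx t ht _)
  have hO : ((fun p : ℝ × ℝ => p - (t, X t y)) ∘ fun s => (s, X s y)) =O[𝓝 t] fun s => s - t := by
    refine Asymptotics.IsBigO.of_bound (1 + K / m) ?_
    filter_upwards [Ioi_mem_nhds ht] with s hs
    have := h.lip hX hs ht y y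
    rw [sub_self, abs_zero, add_zero] at this
    have h4 : |X s y - X t y| ≤ K / m * |s - t| := by
      rw [div_mul_eq_mul_div, le_div_iff₀ h.hm]; linarith
    have h5 : 0 ≤ K / m := div_nonneg h.hK h.hm.le
    have h6 := abs_nonneg (s - t)
    simp only [Function.comp, Prod.mk_sub_mk, Prod.norm_def, Real.norm_eq_abs]
    refine max_le ?_ ?_ <;> nlinarith
  have k3 := k2.trans_isBigO hO
  rw [hasDerivAt_iff_isLittleO]
  have k4 := (k3.const_mul_left (-(Yx t (X t y))⁻¹))
  refine k4.congr' ?_ EventuallyEq.rfl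
  filter_upwards [Ioi_mem_nhds ht] with s hs
  simp [Function.HasUncurry.uncurry, hX s hs, hX t ht]
  field_simp
  ring

lemma CH.perX (h : CH α m K Y Yt Yx) (hX : ∀ t > α, ∀ y, Y t (X t y) = y) {t : ℝ} (ht : α < t)
    (y : ℝ) : X t (y + 1) = X t y + 2 * π := by
  rw [← h.left_inv hX ht (X t y + 2 * π), h.per t ht, hX t ht]
end
end ZN

open Real Set Filter
namespace ZN
open Topology MeasureTheory

lemma mx_cont {f : ℝ → ℝ → ℝ} (hf : ContinuousOn (fun p : ℝ × ℝ => f p.1 p.2) (dom 0)) :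
    Continuous (fun p : ℝ × ℝ => f (max p.1 (1 / 2)) p.2) := by
  have : Continuous (fun p : ℝ × ℝ => ((max p.1 (1 / 2), p.2) : ℝ × ℝ)) := by fun_prop
  exact hf.comp_continuous this fun p => ⟨lt_of_lt_of_le (by norm_num : (0:ℝ) < 1 / 2) (le_max_right _ _), mem_univ _⟩

lemma mk_chart (δ : ℝ) (hδ : 0 < δ) (a a_t : ℝ → ℝ → ℝ)
    (ha_cont : ContinuousOn (fun p : ℝ × ℝ => a p.1 p.2) (dom 0))
    (hat_cont : ContinuousOn (fun p : ℝ × ℝ => a_t p.1 p.2) (dom 0))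
    (ha_t : ∀ t > (0:ℝ), ∀ x : ℝ, HasDerivAt (fun s => a s x) (a_t t x) t)
    (M : ℝ)
    (hbound : ∀ t > (0:ℝ), ∀ x : ℝ, |a t x| ≤ M ∧ |a_t t x| ≤ M)
    (ha_pos : ∀ t > (0:ℝ), ∀ x : ℝ, δ ≤ a t x)
    (ha_per : ∀ t > (0:ℝ), ∀ x : ℝ, a t (x + 2 * Real.pi) = a t x) :
    ∃ (L : ℝ → ℝ) (Y Yt : ℝ → ℝ → ℝ) (m K l0 l1 : ℝ), Continuous L ∧ 0 < l0 ∧ (∀ t, l0 ≤ L t) ∧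
      (∀ t, L t ≤ l1) ∧ CH (1 / 2) m K Y Yt (fun t x => (√(a t x))⁻¹ / L t) := by
  have hM : 0 < M := hδ.trans_le ((ha_pos 1 one_pos 0).trans ((le_abs_self _).trans (hbound 1 one_pos 0).1))
  have hmx : ∀ t : ℝ, (0:ℝ) < max t (1 / 2) := fun t => lt_of_lt_of_le (by norm_num) (le_max_right _ _)
  obtain ⟨g, hg⟩ : ∃ g : ℝ → ℝ → ℝ, g = fun t x => (√(a (max t (1 / 2)) x))⁻¹ := ⟨_, rfl⟩
  obtain ⟨h, hh⟩ : ∃ h : ℝ → ℝ → ℝ, h = fun t x => -(a_t (max t (1 / 2)) x / (2 * √(a (max t (1 / 2)) x)))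
    / (√(a (max t (1 / 2)) x)) ^ 2 := ⟨_, rfl⟩
  have sp : ∀ t x, √δ ≤ √(a (max t (1 / 2)) x) := fun t x => Real.sqrt_le_sqrt (ha_pos _ (hmx t) x)
  have sδ : 0 < √δ := Real.sqrt_pos.2 hδ
  have sM : 0 < √M := Real.sqrt_pos.2 hM
  have sp0 : ∀ t x, 0 < √(a (max t (1 / 2)) x) := fun t x => sδ.trans_le (sp t x)
  have sq : ∀ t x, √(a (max t (1 / 2)) x) ≤ √M := fun t x =>
    Real.sqrt_le_sqrt ((le_abs_self _).trans (hbound _ (hmx t) x).1)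
  have cg : Continuous (Function.uncurry g) := by
    rw [hg]
    exact ((mx_cont ha_cont).sqrt).inv₀ fun p => (sp0 p.1 p.2).ne'
  have ch : Continuous (Function.uncurry h) := by
    rw [hh]
    refine (((mx_cont hat_cont).div (continuous_const.mul (mx_cont ha_cont).sqrt) fun p => ?_).neg).div
      ((mx_cont ha_cont).sqrt.pow 2) fun p => ?_
    · exact (mul_pos two_pos (sp0 p.1 p.2)).ne'
    · exact (pow_pos (sp0 p.1 p.2) 2).ne'
  have cgs : ∀ s, Continuous (g s) := fun s => cg.comp (by fun_prop : Continuous fun z : ℝ => (s, z))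
  have chs : ∀ s, Continuous (h s) := fun s => ch.comp (by fun_prop : Continuous fun z : ℝ => (s, z))
  obtain ⟨C, hC⟩ : ∃ C, C = M / (2 * √δ) / (√δ) ^ 2 := ⟨_, rfl⟩
  have hC0 : 0 ≤ C := by rw [hC]; positivity
  have bh : ∀ t x, |h t x| ≤ C := fun t x => by
    have h1 := sp t x
    have h2 := (hbound _ (hmx t) x).2
    rw [hh, hC]
    simp only [neg_div, abs_neg]
    rw [abs_div, abs_div, abs_of_pos (mul_pos two_pos (sp0 t x)), abs_of_pos (pow_pos (sp0 t x) 2)]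
    gcongr
  have dg : ∀ t > (1/2 : ℝ), ∀ x, HasDerivAt (fun s => g s x) (h t x) t := fun t ht x => by
    have h0 : (0:ℝ) < t := by linarith
    have hne : a t x ≠ 0 := (hδ.trans_le (ha_pos t h0 x)).ne'
    have hs : √(a t x) ≠ 0 := (Real.sqrt_pos.2 (hδ.trans_le (ha_pos t h0 x))).ne'
    have d := ((ha_t t h0 x).sqrt hne).inv hs
    rw [hg, hh]
    simp only [max_eq_left ht.le]
    refine d.congr_of_eventuallyEq ?_
    filter_upwards [Ioi_mem_nhds ht] with s hs
    have hs' : max s (1 / 2) = s := max_eq_left (le_of_lt (mem_Ioi.1 hs))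
    simp only [hs', Pi.inv_apply]
  have gper : ∀ t, Function.Periodic (g t) (2 * π) := fun t x => by
    rw [hg]; simp only [ha_per _ (hmx t)]
  have aper' : ∀ t > (1/2:ℝ), ∀ x, a_t t (x + 2 * π) = a_t t x := fun t ht x => by
    have h0 : (0:ℝ) < t := by linarith
    have d := ha_t t h0 (x + 2 * π)
    refine d.unique ((ha_t t h0 x).congr_of_eventuallyEq ?_)
    filter_upwards [Ioi_mem_nhds h0] with s hs using ha_per s hs x
  have hper : ∀ t > (1/2:ℝ), Function.Periodic (h t) (2 * π) := fun t ht x => by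
    rw [hh]; simp only [max_eq_left (le_of_lt ht), aper' t ht]
    rw [ha_per t (by linarith)]
  obtain ⟨G, hG⟩ : ∃ G : ℝ → ℝ → ℝ, G = fun t x => ∫ z in (0:ℝ)..x, g t z := ⟨_, rfl⟩
  obtain ⟨H, hH⟩ : ∃ H : ℝ → ℝ → ℝ, H = fun t x => ∫ z in (0:ℝ)..x, h t z := ⟨_, rfl⟩
  have dG : ∀ t > (1/2:ℝ), ∀ x, HasDerivAt (fun s => G s x) (H t x) t := fun t ht x => by
    rw [hG, hH]; exact prim_dt cg ch bh dg ht x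
  have dGx : ∀ t x, HasDerivAt (G t) (g t x) x := fun t x => by
    rw [hG]; exact intervalIntegral.integral_hasDerivAt_right ((cgs t).intervalIntegrable _ _)
      ((cgs t).stronglyMeasurableAtFilter _ _) (cgs t).continuousAt
  have cG : Continuous (fun p : ℝ × ℝ => G p.1 p.2) := by
    rw [hG]; exact intervalIntegral.continuous_parametric_primitive_of_continuous cg
  have cH : Continuous (fun p : ℝ × ℝ => H p.1 p.2) := by
    rw [hH]; exact intervalIntegral.continuous_parametric_primitive_of_continuous ch
  have Gper : ∀ t x, G t (x + 2 * π) = G t x + G t (2 * π) := fun t x => by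
    rw [hG]
    have := (gper t).intervalIntegral_add_eq_add 0 x fun _ _ => (cgs t).intervalIntegrable _ _
    simpa using this
  have Hper : ∀ t > (1/2:ℝ), ∀ x, H t (x + 2 * π) = H t x + H t (2 * π) := fun t ht x => by
    rw [hH]
    have := (hper t ht).intervalIntegral_add_eq_add 0 x fun _ _ => (chs t).intervalIntegrable _ _
    simpa using this
  have pi0 : 0 < 2 * π := by positivity
  have bg0 : ∀ t x, (√M)⁻¹ ≤ g t x := fun t x => by
    rw [hg]; exact inv_anti₀ (sp0 t x) (sq t x)
  have bg1 : ∀ t x, g t x ≤ (√δ)⁻¹ := fun t x => by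
    rw [hg]; exact inv_anti₀ sδ (sp t x)
  have bg : ∀ t x, |g t x| ≤ (√δ)⁻¹ := fun t x => by
    rw [abs_of_nonneg ((by positivity : 0 ≤ (√M)⁻¹).trans (bg0 t x))]; exact bg1 t x
  have L0 : ∀ t, 2 * π * (√M)⁻¹ ≤ G t (2 * π) := fun t => by
    have := expand1 (dGx t) (bg0 t) (2 * π) 0
    have e0 : G t 0 = 0 := by rw [hG]; simp
    have : (√M)⁻¹ * (2 * π - 0) ≤ G t (2 * π) - G t 0 :=
      mul_sub_le_image_sub_of_le_deriv (f := G t) (fun x => (dGx t x).differentiableAt)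
        (fun x => by rw [(dGx t x).deriv]; exact bg0 t x) pi0.le
    rw [e0] at this; linarith
  have Gb : ∀ t, ∀ x ∈ Icc (0:ℝ) (2 * π), |G t x| ≤ (√δ)⁻¹ * (2 * π) := fun t x hx => by
    rw [hG]
    have := intervalIntegral.norm_integral_le_of_norm_le_const (a := 0) (b := x) (f := g t)
      (C := (√δ)⁻¹) fun z _ => bg t z
    refine this.trans ?_
    rw [sub_zero, abs_of_nonneg hx.1]
    exact mul_le_mul_of_nonneg_left hx.2 (by positivity)
  have Hb : ∀ t, ∀ x ∈ Icc (0:ℝ) (2 * π), |H t x| ≤ C * (2 * π) := fun t x hx => by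
    rw [hH]
    have := intervalIntegral.norm_integral_le_of_norm_le_const (a := 0) (b := x) (f := h t)
      (C := C) fun z _ => bh t z
    refine this.trans ?_
    rw [sub_zero, abs_of_nonneg hx.1]
    exact mul_le_mul_of_nonneg_left hx.2 hC0
  have mem2 : 2 * π ∈ Icc (0:ℝ) (2 * π) := ⟨pi0.le, le_rfl⟩
  obtain ⟨l0, hl0⟩ : ∃ l0, l0 = 2 * π * (√M)⁻¹ := ⟨_, rfl⟩
  obtain ⟨l1, hl1⟩ : ∃ l1, l1 = (√δ)⁻¹ * (2 * π) := ⟨_, rfl⟩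
  obtain ⟨C1, hC1⟩ : ∃ C1, C1 = C * (2 * π) := ⟨_, rfl⟩
  have l0p : 0 < l0 := by rw [hl0]; positivity
  have l1p : 0 < l1 := by rw [hl1]; positivity
  have C1p : 0 ≤ C1 := by rw [hC1]; positivity
  rw [← hl0] at L0
  rw [← hl1] at Gb
  rw [← hC1] at Hb
  have Lp : ∀ t, 0 < G t (2 * π) := fun t => l0p.trans_le (L0 t)
  have L1 : ∀ t, G t (2 * π) ≤ l1 := fun t => (le_abs_self _).trans (Gb t _ mem2)
  have cL : Continuous fun t => G t (2 * π) :=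
    cG.comp (by fun_prop : Continuous fun t : ℝ => ((t, 2 * π) : ℝ × ℝ))
  have cHL : Continuous fun t => H t (2 * π) :=
    cH.comp (by fun_prop : Continuous fun t : ℝ => ((t, 2 * π) : ℝ × ℝ))
  refine ⟨fun t => G t (2 * π), fun t x => G t x / G t (2 * π),
    fun t x => (H t x * G t (2 * π) - G t x * H t (2 * π)) / (G t (2 * π)) ^ 2,
    (√M)⁻¹ / l1, (C1 * l1 + l1 * C1) / l0 ^ 2 + (√δ)⁻¹ / l0, l0, l1, cL, l0p, L0, L1, ?_⟩
  have eg : ∀ t > (1/2:ℝ), ∀ x, (√(a t x))⁻¹ = g t x := fun t ht x => by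
    rw [hg]; simp only [max_eq_left (le_of_lt ht)]
  have K1 : 0 ≤ (C1 * l1 + l1 * C1) / l0 ^ 2 := by positivity
  have K2 : 0 ≤ (√δ)⁻¹ / l0 := by positivity
  constructor
  · positivity
  · positivity
  · intro t ht x
    exact (dG t ht x).div (dG t ht (2 * π)) (Lp t).ne'
  · intro t ht x
    simp only [eg t ht]
    exact (dGx t x).div_const _
  · refine Continuous.continuousOn ?_
    have c1 : Continuous fun z : ℝ × ℝ => G z.1 (2 * π) := cL.comp continuous_fst
    have c2 : Continuous fun z : ℝ × ℝ => H z.1 (2 * π) := cHL.comp continuous_fst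
    exact ((cH.mul c1).sub (cG.mul c2)).div (c1.pow 2) fun z => (pow_pos (Lp z.1) 2).ne'
  · have c1 : Continuous fun z : ℝ × ℝ => G z.1 (2 * π) := cL.comp continuous_fst
    refine (Continuous.div cg c1 fun z => (Lp z.1).ne').continuousOn.congr ?_
    rintro ⟨t, x⟩ ⟨ht, -⟩
    simp only [eg t ht]
    rfl
  · intro t ht x
    have hp : Function.Periodic (fun x => (H t x * G t (2 * π) - G t x * H t (2 * π)) / (G t (2 * π)) ^ 2)
        (2 * π) := fun x => by
      simp only [Gper, Hper t ht]; congr 1; ring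
    obtain ⟨y, hy, hxy⟩ := hp.exists_mem_Ico₀ pi0 x
    rw [show (H t x * G t (2 * π) - G t x * H t (2 * π)) / (G t (2 * π)) ^ 2 = _ from hxy]
    have hy' : y ∈ Icc (0:ℝ) (2 * π) := ⟨hy.1, hy.2.le⟩
    refine le_trans ?_ (le_add_of_nonneg_right K2)
    rw [abs_div, abs_of_pos (pow_pos (Lp t) 2)]
    have hL := L0 t
    have n1 : |H t y * G t (2 * π) - G t y * H t (2 * π)| ≤ C1 * l1 + l1 * C1 := by
      refine (abs_sub _ _).trans ?_
      rw [abs_mul, abs_mul]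
      exact add_le_add (mul_le_mul (Hb t y hy') (Gb t _ mem2) (abs_nonneg _) C1p)
        (mul_le_mul (Gb t y hy') (Hb t _ mem2) (abs_nonneg _) l1p.le)
    exact div_le_div₀ (by positivity) n1 (by positivity) (pow_le_pow_left₀ l0p.le hL 2)
  · intro t ht x
    simp only [eg t ht]
    exact div_le_div₀ ((by positivity : 0 ≤ (√M)⁻¹).trans (bg0 t x)) (bg0 t x) (Lp t) (L1 t)
  · intro t ht x
    simp only [eg t ht]
    refine le_trans ?_ (le_add_of_nonneg_left K1)
    exact div_le_div₀ (by positivity) (bg1 t x) l0p (L0 t)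
  · intro t ht x
    simp only [Gper]
    rw [add_div, div_self (Lp t).ne']
end ZN

open Real Set Filter
namespace ZN
open Topology MeasureTheory

lemma mk_time (L : ℝ → ℝ) (l0 l1 : ℝ) (hL : Continuous L) (h0 : 0 < l0) (hl0 : ∀ t, l0 ≤ L t)
    (hl1 : ∀ t, L t ≤ l1) : ∃ s θ : ℝ → ℝ, (∀ t, HasDerivAt s (L t ^ 2)⁻¹ t) ∧
      (∀ τ, s (θ τ) = τ) ∧ (∀ t, θ (s t) = t) ∧ (∀ τ, HasDerivAt θ (L (θ τ) ^ 2) τ) ∧ StrictMono s ∧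
      ∀ t t', (l1 ^ 2)⁻¹ * |t - t'| ≤ |s t - s t'| := by
  have Lp : ∀ t, 0 < L t := fun t => h0.trans_le (hl0 t)
  have l1p : 0 < l1 := (Lp 0).trans_le (hl1 0)
  have cd : Continuous fun t => (L t ^ 2)⁻¹ := by
    have : Continuous fun t => L t ^ 2 := by fun_prop
    exact this.inv₀ fun t => (pow_pos (Lp t) 2).ne'
  have hs : ∀ t, HasDerivAt (fun t => ∫ r in (1:ℝ)..t, (L r ^ 2)⁻¹) (L t ^ 2)⁻¹ t := fun t =>
    intervalIntegral.integral_hasDerivAt_right (cd.intervalIntegrable _ _)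
      (cd.stronglyMeasurableAtFilter _ _) cd.continuousAt
  obtain ⟨s, hse⟩ : ∃ s : ℝ → ℝ, s = fun t => ∫ r in (1:ℝ)..t, (L r ^ 2)⁻¹ := ⟨_, rfl⟩
  rw [← hse] at hs
  have mp : 0 < (l1 ^ 2)⁻¹ := by positivity
  have hm : ∀ t, (l1 ^ 2)⁻¹ ≤ (L t ^ 2)⁻¹ := fun t =>
    inv_anti₀ (pow_pos (Lp t) 2) (pow_le_pow_left₀ (Lp t).le (hl1 t) 2)
  choose θ hθ using surj1 hs mp hm
  have mono : StrictMono s := strictMono_of_deriv_pos fun t => by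
    rw [(hs t).deriv]; exact mp.trans_le (hm t)
  refine ⟨s, θ, hs, hθ, fun t => mono.injective (hθ _), fun τ => ?_, mono, expand1 hs hm⟩
  exact (inv1 hs mp hm hθ τ).congr_deriv (by rw [inv_inv])

lemma bd_of_per {f : ℝ → ℝ → ℝ} {τs : ℝ} (hc : ContinuousOn (fun z : ℝ × ℝ => f z.1 z.2) (dom τs))
    (hp : ∀ t > τs, ∀ y, f t (y + 1) = f t y) (a : ℝ) (ha : τs < a) (b : ℝ) :
    ∃ C, ∀ t ∈ Icc a b, ∀ y, |f t y| ≤ C := by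
  have hK : IsCompact (Icc a b ×ˢ Icc (0:ℝ) 1) := isCompact_Icc.prod isCompact_Icc
  obtain ⟨C, hC⟩ := hK.exists_bound_of_continuousOn (f := fun z : ℝ × ℝ => f z.1 z.2)
    (hc.mono fun z hz => ⟨ha.trans_le hz.1.1, mem_univ _⟩)
  refine ⟨C, fun t ht y => ?_⟩
  have hper : Function.Periodic (f t) 1 := hp t (ha.trans_le ht.1)
  obtain ⟨z, hz, he⟩ := hper.exists_mem_Ico₀ one_pos y
  rw [he]
  exact hC (t, z) ⟨ht, hz.1, hz.2.le⟩

lemma per_dy {f g : ℝ → ℝ} (hd : ∀ y, HasDerivAt f (g y) y) (hp : ∀ y, f (y + 1) = f y) (y : ℝ) :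
    g (y + 1) = g y := by
  have h1 : HasDerivAt (fun z => f (z + 1)) (g (y + 1)) y := (hd (y + 1)).comp_add_const y 1
  rw [show (fun z => f (z + 1)) = f from funext hp] at h1
  exact h1.unique (hd y)

lemma CV_of_per {τs M : ℝ} {v vt vy vyy : ℝ → ℝ → ℝ} (hM : 0 ≤ M)
    (dt : ∀ t > τs, ∀ y, HasDerivAt (fun s => v s y) (vt t y) t)
    (dy : ∀ t > τs, ∀ y, HasDerivAt (v t) (vy t y) y)
    (dyy : ∀ t > τs, ∀ y, HasDerivAt (vy t) (vyy t y) y)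
    (ct : ContinuousOn (fun z : ℝ × ℝ => vt z.1 z.2) (dom τs))
    (cy : ContinuousOn (fun z : ℝ × ℝ => vy z.1 z.2) (dom τs))
    (cyy : ContinuousOn (fun z : ℝ × ℝ => vyy z.1 z.2) (dom τs))
    (hp : ∀ t > τs, ∀ y, v t (y + 1) = v t y)
    (eq : ∀ t > τs, ∀ y, |vt t y - vyy t y| ≤ M * (|v t y| + |vy t y|))
    (nt : ∀ t > τs, ∃ y, v t y ≠ 0) : CV τs M v vt vy vyy := by
  refine ⟨hM, dt, dy, dyy, ct, cy, cyy, ?_, eq, nt⟩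
  intro a ha b
  have py : ∀ t > τs, ∀ y, vy t (y + 1) = vy t y := fun t ht => per_dy (dy t ht) (hp t ht)
  have pyy : ∀ t > τs, ∀ y, vyy t (y + 1) = vyy t y := fun t ht => per_dy (dyy t ht) (py t ht)
  have pt : ∀ t > τs, ∀ y, vt t (y + 1) = vt t y := fun t ht y =>
    (dt t ht (y + 1)).unique ((dt t ht y).congr_of_eventuallyEq (by
      filter_upwards [Ioi_mem_nhds ht] with s hs using hp s hs y))
  obtain ⟨C1, h1⟩ := bd_of_per (cont_of_partials dt dy ct cy) hp a ha b
  obtain ⟨C2, h2⟩ := bd_of_per ct pt a ha b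
  obtain ⟨C3, h3⟩ := bd_of_per cy py a ha b
  obtain ⟨C4, h4⟩ := bd_of_per cyy pyy a ha b
  refine ⟨max (max C1 C2) (max C3 C4), fun t ht y => ⟨?_, ?_, ?_, ?_⟩⟩
  · exact (h1 t ht y).trans ((le_max_left _ _).trans (le_max_left _ _))
  · exact (h2 t ht y).trans ((le_max_right _ _).trans (le_max_left _ _))
  · exact (h3 t ht y).trans ((le_max_left _ _).trans (le_max_right _ _))
  · exact (h4 t ht y).trans ((le_max_right _ _).trans (le_max_right _ _))

structure Sol (δ M : ℝ) (a b c a_t a_x φ φ_t φ_x φ_xx : ℝ → ℝ → ℝ) : Prop where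
  hδ : 0 < δ
  ca : ContinuousOn (fun p : ℝ × ℝ => a p.1 p.2) (dom 0)
  cat : ContinuousOn (fun p : ℝ × ℝ => a_t p.1 p.2) (dom 0)
  cax : ContinuousOn (fun p : ℝ × ℝ => a_x p.1 p.2) (dom 0)
  dat : ∀ t > (0:ℝ), ∀ x : ℝ, HasDerivAt (fun s => a s x) (a_t t x) t
  dax : ∀ t > (0:ℝ), ∀ x : ℝ, HasDerivAt (a t) (a_x t x) x
  bound : ∀ t > (0:ℝ), ∀ x : ℝ,
      |a t x| ≤ M ∧ |a_t t x| ≤ M ∧ |a_x t x| ≤ M ∧ |b t x| ≤ M ∧ |c t x| ≤ M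
  pos : ∀ t > (0:ℝ), ∀ x : ℝ, δ ≤ a t x
  pa : ∀ t > (0:ℝ), ∀ x : ℝ, a t (x + 2 * π) = a t x
  pφ : ∀ t > (0:ℝ), ∀ x : ℝ, φ t (x + 2 * π) = φ t x
  cφ : ContinuousOn (fun p : ℝ × ℝ => φ p.1 p.2) (dom 0)
  cφt : ContinuousOn (fun p : ℝ × ℝ => φ_t p.1 p.2) (dom 0)
  cφx : ContinuousOn (fun p : ℝ × ℝ => φ_x p.1 p.2) (dom 0)
  cφxx : ContinuousOn (fun p : ℝ × ℝ => φ_xx p.1 p.2) (dom 0)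
  dφt : ∀ t > (0:ℝ), ∀ x : ℝ, HasDerivAt (fun s => φ s x) (φ_t t x) t
  dφx : ∀ t > (0:ℝ), ∀ x : ℝ, HasDerivAt (φ t) (φ_x t x) x
  dφxx : ∀ t > (0:ℝ), ∀ x : ℝ, HasDerivAt (φ_x t) (φ_xx t x) x
  eq : ∀ t > (0:ℝ), ∀ x : ℝ,
      φ_t t x = a t x * φ_xx t x + b t x * φ_x t x + c t x * φ t x
  nt : ∀ t > (0:ℝ), ∃ x : ℝ, φ t x ≠ 0

lemma pde_est {M r l l1 K A B Cc ax p px pt pxx yt : ℝ} {r0 l0 : ℝ} (h0 : 0 < r0) (hr : r0 ≤ r)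
    (hl0 : 0 < l0) (hl : l0 ≤ l)
    (hl1 : l ≤ l1) (hA : A = r ^ 2) (hM : 0 ≤ M) (hax : |ax| ≤ M) (hB : |B| ≤ M) (hC : |Cc| ≤ M)
    (hyt : |yt| ≤ K) (he : pt = A * pxx + B * px + Cc * p) :
    |l ^ 2 * (pt - px * yt * (r * l)) - l ^ 2 * (A * pxx + ax / 2 * px)| ≤
      l1 ^ 2 * (2 * M / (r0 * l0) + M + K) * (|p| + |px * (r * l)|) := by
  have hrl : r0 * l0 ≤ r * l := mul_le_mul hr hl hl0.le (h0.le.trans hr)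
  have hrl0 : 0 < r0 * l0 := mul_pos h0 hl0
  have e : l ^ 2 * (pt - px * yt * (r * l)) - l ^ 2 * (A * pxx + ax / 2 * px) =
      l ^ 2 * ((B - ax / 2) * px + Cc * p - yt * (px * (r * l))) := by rw [he]; ring
  have hpx : |px| ≤ |px * (r * l)| / (r0 * l0) := by
    rw [le_div_iff₀ hrl0, abs_mul, abs_of_pos (hrl0.trans_le hrl)]
    exact mul_le_mul_of_nonneg_left hrl (abs_nonneg _)
  have hK : 0 ≤ K := (abs_nonneg _).trans hyt
  have hl2 : l ^ 2 ≤ l1 ^ 2 := pow_le_pow_left₀ (hl0.le.trans hl) hl1 2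
  obtain ⟨q, hq⟩ : ∃ q, q = |px * (r * l)| := ⟨_, rfl⟩
  have q0 : 0 ≤ q := by rw [hq]; exact abs_nonneg _
  have hba : |B - ax / 2| ≤ 2 * M := by
    have := abs_le.1 hB; have := abs_le.1 hax; rw [abs_le]; constructor <;> linarith
  have t1 : |(B - ax / 2) * px| ≤ 2 * M * (q / (r0 * l0)) := by
    rw [abs_mul, hq]; exact mul_le_mul hba hpx (abs_nonneg _) (by linarith)
  have t2 : |Cc * p| ≤ M * |p| := by
    rw [abs_mul]; exact mul_le_mul_of_nonneg_right hC (abs_nonneg _)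
  have t3 : |yt * (px * (r * l))| ≤ K * q := by
    rw [abs_mul, hq]; exact mul_le_mul_of_nonneg_right hyt (abs_nonneg _)
  have t4 : |(B - ax / 2) * px + Cc * p - yt * (px * (r * l))| ≤
      2 * M * (q / (r0 * l0)) + M * |p| + K * q :=
    (abs_sub _ _).trans (add_le_add ((abs_add_le _ _).trans (add_le_add t1 t2)) t3)
  rw [e, abs_mul, abs_of_nonneg (sq_nonneg l), ← hq, mul_assoc]
  refine mul_le_mul hl2 (t4.trans ?_) (abs_nonneg _) (sq_nonneg _)
  have e2 : 2 * M * (q / (r0 * l0)) = 2 * M / (r0 * l0) * q := by ring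
  have s1 : 0 ≤ 2 * M / (r0 * l0) * |p| := by positivity
  have s2 : 0 ≤ M * q := by positivity
  have s3 : 0 ≤ K * |p| := by positivity
  rw [e2]; nlinarith
end ZN

open Real Set Filter
namespace ZN
open Topology MeasureTheory

structure Chart (φ φ_x : ℝ → ℝ → ℝ) (m K l M' : ℝ) (s θ : ℝ → ℝ) (Y Yt Yx X vt vy vyy : ℝ → ℝ → ℝ) :
    Prop where
  ch : CH (1 / 2) m K Y Yt Yx
  hX : ∀ t > (1 / 2 : ℝ), ∀ y, Y t (X t y) = y
  sθ : ∀ τ, s (θ τ) = τ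
  θs : ∀ t, θ (s t) = t
  mono : StrictMono s
  hl : 0 < l
  ex : ∀ t t', l * |t - t'| ≤ |s t - s t'|
  cs : Continuous s
  cv : CV (s (1 / 2)) M' (fun τ y => φ (θ τ) (X (θ τ) y)) vt vy vyy
  z : ∀ τ > s (1 / 2), ∀ y, vy τ y = 0 ↔ φ_x (θ τ) (X (θ τ) y) = 0

set_option maxHeartbeats 1000000 in
lemma Sol.chart {δ M : ℝ} {a b c a_t a_x φ φ_t φ_x φ_xx : ℝ → ℝ → ℝ}
    (h : Sol δ M a b c a_t a_x φ φ_t φ_x φ_xx) :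
    ∃ (m K l M' : ℝ) (s θ : ℝ → ℝ) (Y Yt Yx X vt vy vyy : ℝ → ℝ → ℝ),
      Chart φ φ_x m K l M' s θ Y Yt Yx X vt vy vyy := by
  obtain ⟨L, Y, Yt, m, K, l0, l1, cL, l0p, hl0, hl1, hch⟩ := mk_chart δ h.hδ a a_t h.ca h.cat h.dat M
    (fun t ht x => ⟨(h.bound t ht x).1, (h.bound t ht x).2.1⟩) h.pos h.pa
  obtain ⟨s, θ, ds, hsθ, hθs, dθ, mono, hex⟩ := mk_time L l0 l1 cL l0p hl0 hl1
  obtain ⟨X, hX⟩ := hch.exists_inv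
  have Lp : ∀ t, 0 < L t := fun t => l0p.trans_le (hl0 t)
  have l1p : 0 < l1 := (Lp 0).trans_le (hl1 0)
  have hM : 0 ≤ M := (abs_nonneg _).trans (h.bound 1 one_pos 0).1
  have sδ : 0 < √δ := Real.sqrt_pos.2 h.hδ
  have ap : ∀ t > (0:ℝ), ∀ x, 0 < a t x := fun t ht x => h.hδ.trans_le (h.pos t ht x)
  have rp : ∀ t > (0:ℝ), ∀ x, 0 < √(a t x) := fun t ht x => Real.sqrt_pos.2 (ap t ht x)
  have hθm : ∀ τ > s (1 / 2), 1 / 2 < θ τ := fun τ hτ => by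
    rw [← mono.lt_iff_lt, hsθ]; exact hτ
  have hθ0 : ∀ τ > s (1 / 2), 0 < θ τ := fun τ hτ => by linarith [hθm τ hτ]
  have cθ : Continuous θ := continuous_iff_continuousAt.2 fun τ => (dθ τ).continuousAt
  have cs : Continuous s := continuous_iff_continuousAt.2 fun τ => (ds τ).continuousAt
  have cX : ContinuousOn (fun z : ℝ × ℝ => X (θ z.1) z.2) (dom (s (1 / 2))) := by
    have : Continuous fun z : ℝ × ℝ => ((θ z.1, z.2) : ℝ × ℝ) := by fun_prop
    exact (hch.contX hX).comp this.continuousOn fun z hz => ⟨hθm _ hz.1, mem_univ _⟩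
  have comp : ∀ F : ℝ → ℝ → ℝ, ContinuousOn (fun z : ℝ × ℝ => F z.1 z.2) (dom (1 / 2)) →
      ContinuousOn (fun z : ℝ × ℝ => F (θ z.1) (X (θ z.1) z.2)) (dom (s (1 / 2))) := fun F hF => by
    have c1 : ContinuousOn (fun z : ℝ × ℝ => ((θ z.1, X (θ z.1) z.2) : ℝ × ℝ)) (dom (s (1 / 2))) :=
      (cθ.comp continuous_fst).continuousOn.prodMk cX
    exact hF.comp c1 fun z hz => ⟨hθm _ hz.1, mem_univ _⟩
  have sub : dom (1 / 2) ⊆ dom 0 := fun z hz => ⟨lt_trans (by norm_num) (mem_Ioi.1 hz.1), mem_univ _⟩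
  have cr : ContinuousOn (fun z : ℝ × ℝ => √(a z.1 z.2)) (dom (1 / 2)) := (h.ca.mono sub).sqrt
  have cL' : ContinuousOn (fun z : ℝ × ℝ => L z.1) (dom (1 / 2)) := (cL.comp continuous_fst).continuousOn
  obtain ⟨F1, hF1⟩ : ∃ F1 : ℝ → ℝ → ℝ, F1 = fun t x => φ_x t x * (√(a t x) * L t) := ⟨_, rfl⟩
  obtain ⟨F2, hF2⟩ : ∃ F2 : ℝ → ℝ → ℝ, F2 = fun t x => L t ^ 2 * (a t x * φ_xx t x + a_x t x / 2 * φ_x t x) := ⟨_, rfl⟩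
  obtain ⟨F3, hF3⟩ : ∃ F3 : ℝ → ℝ → ℝ, F3 = fun t x => L t ^ 2 * (φ_t t x - φ_x t x * Yt t x * (√(a t x) * L t)) := ⟨_, rfl⟩
  have cF1 : ContinuousOn (fun z : ℝ × ℝ => F1 z.1 z.2) (dom (1 / 2)) := by
    rw [hF1]; exact (h.cφx.mono sub).mul (cr.mul cL')
  have cF2 : ContinuousOn (fun z : ℝ × ℝ => F2 z.1 z.2) (dom (1 / 2)) := by
    rw [hF2]; exact (cL'.pow 2).mul (((h.ca.mono sub).mul (h.cφxx.mono sub)).add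
      (((h.cax.mono sub).div_const 2).mul (h.cφx.mono sub)))
  have cF3 : ContinuousOn (fun z : ℝ × ℝ => F3 z.1 z.2) (dom (1 / 2)) := by
    rw [hF3]; exact (cL'.pow 2).mul ((h.cφt.mono sub).sub
      (((h.cφx.mono sub).mul hch.ct).mul (cr.mul cL')))
  have dXy : ∀ τ > s (1 / 2), ∀ y, HasDerivAt (X (θ τ)) (√(a (θ τ) (X (θ τ) y)) * L (θ τ)) y :=
    fun τ hτ y => (hch.dXy hX (θ τ) (hθm τ hτ) y).congr_deriv (by
      rw [inv_div, div_inv_eq_mul, mul_comm])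
  have hcv : CV (s (1 / 2)) (l1 ^ 2 * (2 * M / (√δ * l0) + M + K)) (fun τ y => φ (θ τ) (X (θ τ) y))
      (fun τ y => F3 (θ τ) (X (θ τ) y)) (fun τ y => F1 (θ τ) (X (θ τ) y))
      (fun τ y => F2 (θ τ) (X (θ τ) y)) := by
    refine CV_of_per ?_ ?_ ?_ ?_ (comp _ cF3) (comp _ cF1) (comp _ cF2) ?_ ?_ ?_
    · have := hch.hK; positivity
    · intro τ hτ y
      have hr := (rp _ (hθ0 τ hτ) (X (θ τ) y)).ne'
      have hL := (Lp (θ τ)).ne'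
      have dX : HasDerivAt (fun r => X (θ r) y) _ τ :=
        HasDerivAt.comp (h₂ := fun t => X t y) τ (hch.dXt hX (θ τ) (hθm τ hτ) y) (dθ τ)
      refine (chain2 h.dφt h.dφx h.cφt h.cφx (dθ τ) dX (hθ0 τ hτ)).congr_deriv ?_
      rw [hF3]; field_simp; ring
    · intro τ hτ y
      refine ((h.dφx (θ τ) (hθ0 τ hτ) (X (θ τ) y)).comp y (dXy τ hτ y)).congr_deriv ?_
      rw [hF1]
    · intro τ hτ y
      have ht := hθ0 τ hτ
      have hr := (rp _ ht (X (θ τ) y)).ne'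
      have hs := Real.sq_sqrt (ap _ ht (X (θ τ) y)).le
      have d1 := (h.dφxx (θ τ) ht (X (θ τ) y)).comp y (dXy τ hτ y)
      have d2 := ((h.dax (θ τ) ht (X (θ τ) y)).sqrt (ap _ ht _).ne').comp y (dXy τ hτ y)
      have d3 := d1.mul (d2.mul_const (L (θ τ)))
      rw [hF1, hF2]
      refine d3.congr_deriv ?_
      simp only [Function.comp]
      obtain ⟨r, hre⟩ : ∃ r, r = √(a (θ τ) (X (θ τ) y)) := ⟨_, rfl⟩
      rw [← hre] at hs hr ⊢
      rw [← hs]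
      field_simp
    · intro τ hτ y
      rw [hch.perX hX (hθm τ hτ), h.pφ _ (hθ0 τ hτ)]
    · intro τ hτ y
      have ht := hθ0 τ hτ
      have hb := h.bound (θ τ) ht (X (θ τ) y)
      rw [hF1, hF2, hF3]
      exact pde_est sδ (Real.sqrt_le_sqrt (h.pos _ ht _)) l0p (hl0 _) (hl1 _)
        (Real.sq_sqrt (ap _ ht _).le).symm hM hb.2.2.1 hb.2.2.2.1 hb.2.2.2.2
        (hch.bt _ (hθm τ hτ) _) (h.eq _ ht _)
    · intro τ hτ
      obtain ⟨x, hx⟩ := h.nt (θ τ) (hθ0 τ hτ)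
      refine ⟨Y (θ τ) x, ?_⟩
      rw [hch.left_inv hX (hθm τ hτ)]; exact hx
  refine ⟨m, K, (l1 ^ 2)⁻¹, _, s, θ, Y, Yt, _, X, _, _, _,
    ⟨hch, hX, hsθ, hθs, mono, by positivity, hex, cs, hcv, fun τ hτ y => ?_⟩⟩
  rw [hF1]
  have := (rp _ (hθ0 τ hτ) (X (θ τ) y)).ne'
  have := (Lp (θ τ)).ne'
  simp [*]
end ZN

open Real Set Filter
namespace ZN
open Topology MeasureTheory

section
variable {φ φ_x : ℝ → ℝ → ℝ} {m K l M' : ℝ} {s θ : ℝ → ℝ} {Y Yt Yx X vt vy vyy : ℝ → ℝ → ℝ}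

lemma Chart.A (h : Chart φ φ_x m K l M' s θ Y Yt Yx X vt vy vyy) : ∃ c0 > 0, ∀ t0 > (1 / 2 : ℝ), ∀ x0,
    ∃ ε > 0, ∀ t > (1 / 2 : ℝ), t0 - ε < t → t < t0 → ∀ x, |x - x0| ≤ c0 * √(t0 - t) →
      ¬(φ t x = 0 ∧ φ_x t x = 0) := by
  have hK := h.ch.hK
  have hl := h.hl
  have sl : 0 < √l := Real.sqrt_pos.2 hl
  obtain ⟨c0, hc0⟩ : ∃ c0, c0 = √l / (2 * (K + 1)) := ⟨_, rfl⟩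
  have c0p : 0 < c0 := by rw [hc0]; positivity
  have hc1 : 2 * K * c0 ≤ √l := by
    rw [hc0, mul_div_assoc', div_le_iff₀ (by positivity)]; nlinarith
  refine ⟨c0, c0p, fun t0 ht0 x0 => ?_⟩
  have hτ0 : s (1 / 2) < s t0 := h.mono ht0
  obtain ⟨ε', hε', hA⟩ := h.cv.claimA (Y t0 x0) hτ0
  have hev : ∀ᶠ t in 𝓝 t0, s t0 - ε' < s t :=
    h.cs.continuousAt.eventually (Ioi_mem_nhds (by linarith : s t0 - ε' < s t0))
  obtain ⟨ε1, hε1, hb⟩ := Metric.eventually_nhds_iff.1 hev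
  refine ⟨min ε1 (c0 ^ 2), by positivity, fun t ht h1 h2 x hx hz => ?_⟩
  have g1 : t0 - t < ε1 := by linarith [min_le_left ε1 (c0 ^ 2)]
  have g2 : t0 - t < c0 ^ 2 := by linarith [min_le_right ε1 (c0 ^ 2)]
  have hd : dist t t0 < ε1 := by rw [Real.dist_eq, abs_sub_comm, abs_of_pos (by linarith)]; exact g1
  have hst := hb hd
  have hst' := h.mono h2
  have hs12 := h.mono ht
  have hD : 0 ≤ t0 - t := by linarith
  have eD := Real.mul_self_sqrt hD
  have sD : √(t0 - t) ≤ c0 := by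
    rw [Real.sqrt_le_left c0p.le]; exact g2.le
  have sD0 := Real.sqrt_nonneg (t0 - t)
  have y1 := h.ch.lip_x ht x x0
  have y2 := h.ch.lip_t ht ht0 x0
  rw [abs_sub_comm t t0, abs_of_nonneg hD] at y2
  have ex := h.ex t0 t
  rw [abs_of_nonneg hD, abs_of_nonneg (by linarith)] at ex
  have hs : √l * √(t0 - t) ≤ √(s t0 - s t) := by
    rw [← Real.sqrt_mul hl.le]; exact Real.sqrt_le_sqrt ex
  have hy : |Y t x - Y t0 x0| ≤ √(s t0 - s t) := by
    have e := abs_add_le (Y t x - Y t x0) (Y t x0 - Y t0 x0)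
    rw [sub_add_sub_cancel] at e
    have f1 : K * |x - x0| ≤ K * (c0 * √(t0 - t)) := mul_le_mul_of_nonneg_left hx hK
    have f2 : K * (t0 - t) ≤ K * (c0 * √(t0 - t)) := by
      rw [← eD]; rw [eD]
      refine mul_le_mul_of_nonneg_left ?_ hK
      calc t0 - t = √(t0 - t) * √(t0 - t) := eD.symm
        _ ≤ c0 * √(t0 - t) := mul_le_mul_of_nonneg_right sD sD0
    have f3 : 2 * K * c0 * √(t0 - t) ≤ √l * √(t0 - t) := mul_le_mul_of_nonneg_right hc1 sD0
    linarith
  refine hA (s t) hst hst' (Y t x) hy ?_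
  have hz2 := h.z (s t) hs12 (Y t x)
  rw [h.θs, h.ch.left_inv h.hX ht] at hz2
  rw [h.θs, h.ch.left_inv h.hX ht]
  exact ⟨hz.1, hz2.2 hz.2⟩

lemma Chart.B (h : Chart φ φ_x m K l M' s θ Y Yt Yx X vt vy vyy) {t0 x0 : ℝ} (ht0 : 1 / 2 < t0)
    (z0 : φ t0 x0 = 0) (z1 : φ_x t0 x0 = 0) {η : ℝ} (hη : 0 < η) :
    ∃ t, t0 - η < t ∧ t < t0 ∧ 1 / 2 < t ∧ Trip (φ t) (x0 - η) (x0 + η) := by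
  have hK := h.ch.hK
  have hl := h.hl
  have hm := h.ch.hm
  have hτ0 : s (1 / 2) < s t0 := h.mono ht0
  obtain ⟨η', hη'⟩ : ∃ η', η' = min (η * l) (η * m * l / (K + l)) := ⟨_, rfl⟩
  have p' : 0 < η' := by rw [hη']; positivity
  have q1 : η' ≤ η * l := by rw [hη']; exact min_le_left _ _
  have q2 : η' * (K + l) ≤ η * m * l := by
    rw [← le_div_iff₀ (by positivity), hη']; exact min_le_right _ _
  have hz2 := h.z (s t0) hτ0 (Y t0 x0)
  rw [h.θs, h.ch.left_inv h.hX ht0] at hz2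
  obtain ⟨τ, g1, g2, g3, sg, y1, y2, y3, a1, a2, a3, a4, b1, b2, b3⟩ :=
    h.cv.claimB (y0 := Y t0 x0) hτ0 (by rw [h.θs, h.ch.left_inv h.hX ht0]; exact z0)
      (hz2.2 z1) p'
  have t1 : θ τ < t0 := by rw [← h.mono.lt_iff_lt, h.sθ]; exact g2
  have t2 : 1 / 2 < θ τ := by rw [← h.mono.lt_iff_lt, h.sθ]; exact g3
  have ex := h.ex t0 (θ τ)
  rw [h.sθ, abs_of_pos (by linarith), abs_of_pos (by linarith)] at ex
  have hlt : l * (t0 - θ τ) < η' := by linarith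
  have mX : StrictMono (X (θ τ)) := by
    have mY : StrictMono (Y (θ τ)) := strictMono_of_deriv_pos fun x => by
      rw [(h.ch.dx _ t2 x).deriv]; exact hm.trans_le (h.ch.bx _ t2 x)
    intro p q hpq
    rw [← mY.lt_iff_lt, h.hX _ t2, h.hX _ t2]; exact hpq
  have near : ∀ y, Y t0 x0 - η' ≤ y → y ≤ Y t0 x0 + η' → |X (θ τ) y - x0| ≤ η := fun y h1 h2 => by
    have e := h.ch.lip h.hX t2 ht0 y (Y t0 x0)
    rw [h.ch.left_inv h.hX ht0, abs_sub_comm (θ τ), abs_of_pos (by linarith : 0 < t0 - θ τ)] at e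
    have e2 : |y - Y t0 x0| ≤ η' := by rw [abs_le]; constructor <;> linarith
    have e3 : K * (l * (t0 - θ τ)) ≤ K * η' := mul_le_mul_of_nonneg_left hlt.le hK
    have e4 : l * m * |X (θ τ) y - x0| ≤ l * m * η := by
      have := mul_le_mul_of_nonneg_left e hl.le
      have := mul_le_mul_of_nonneg_left e2 hl.le
      linarith
    exact le_of_mul_le_mul_left e4 (by positivity)
  refine ⟨θ τ, ?_, t1, t2, sg, X (θ τ) y1, X (θ τ) y2, X (θ τ) y3, ?_, mX a2, mX a3, ?_, b1, b2, b3⟩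
  · have : l * (t0 - θ τ) < l * η := by linarith
    have := lt_of_mul_lt_mul_left this hl.le
    linarith
  · have := (abs_le.1 (near y1 a1 (by linarith))).1
    linarith
  · have := (abs_le.1 (near y3 (by linarith) a4)).2
    linarith
end
end ZN

open Real Set Filter
namespace ZN
open Topology MeasureTheory

lemma null_of_holder {R : ℝ → ℝ → Prop} {C : ℝ} (hC : 0 ≤ C)
    (hR : ∀ t x t' x', R t x → R t' x' → |t - t'| ≤ C * |x - x'| ^ 2) :
    volume {t | ∃ x, R t x} = 0 := by
  classical
  have : ∀ x, ∃ t, (∃ t', R t' x) → R t x := fun x => by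
    by_cases h : ∃ t', R t' x
    · obtain ⟨t, ht⟩ := h; exact ⟨t, fun _ => ht⟩
    · exact ⟨0, fun h' => absurd h' h⟩
  choose f hf using this
  have hH : HolderOnWith (Real.toNNReal C) 2 f {x | ∃ t, R t x} := by
    intro x hx y hy
    have h := hR _ _ _ _ (hf x hx) (hf y hy)
    rw [edist_dist, edist_dist, Real.dist_eq, Real.dist_eq, NNReal.coe_ofNat, ENNReal.rpow_ofNat,
      show ((Real.toNNReal C : NNReal) : ENNReal) = ENNReal.ofReal C from rfl,
      ← ENNReal.ofReal_pow (abs_nonneg _), ← ENNReal.ofReal_mul hC]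
    exact ENNReal.ofReal_le_ofReal h
  have himg : {t | ∃ x, R t x} ⊆ f '' {x | ∃ t, R t x} := by
    rintro t ⟨x, hx⟩
    refine ⟨x, ⟨t, hx⟩, ?_⟩
    have h := hR _ _ _ _ (hf x ⟨t, hx⟩) hx
    simp only [sub_self, abs_zero] at h
    have : |f x - t| ≤ 0 := by linarith [h]
    exact sub_eq_zero.1 (abs_nonpos_iff.1 this)
  refine measure_mono_null himg ?_
  have h1 := hH.hausdorffMeasure_image_le (by norm_num) (zero_le_one)
  have h2 : Measure.hausdorffMeasure (((2:NNReal):ℝ) * 1) {x | ∃ t, R t x} = 0 := by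
    have hd : dimH {x : ℝ | ∃ t, R t x} < ((2 : NNReal) : ENNReal) := by
      refine (dimH_mono (subset_univ _)).trans_lt ?_
      rw [Real.dimH_univ]; norm_num
    have := hausdorffMeasure_of_dimH_lt hd
    simpa using this
  rw [h2, mul_zero, hausdorffMeasure_real] at h1
  exact le_antisymm h1 bot_le

lemma exists_time {Z : ℝ → ℝ → Prop} {c0 : ℝ} (hc : 0 < c0)
    (hA : ∀ t0 > (1 / 2 : ℝ), ∀ x0,
    ∃ ε > 0, ∀ t > (1 / 2 : ℝ), t0 - ε < t → t < t0 → ∀ x, |x - x0| ≤ c0 * √(t0 - t) → ¬ Z t x) :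
    ∃ t1 > (1 / 2 : ℝ), ∀ x, ¬ Z t1 x := by
  obtain ⟨R, hRd⟩ : ∃ R : ℕ → ℤ → ℝ → ℝ → Prop, R = fun (n : ℕ) (j : ℤ) t x => 1 / 2 < t ∧ Z t x ∧
    (j : ℝ) ≤ t * (n + 1) ∧ t * (n + 1) < j + 1 ∧
    ∀ t' > (1 / 2 : ℝ), t - 1 / ((n : ℝ) + 1) < t' → t' < t → ∀ x', |x' - x| ≤ c0 * √(t - t') → ¬ Z t' x' := ⟨_, rfl⟩
  have main : ∀ n j t x t' x', R n j t x → R n j t' x' → t' < t → |t - t'| ≤ 1 / c0 ^ 2 * |x - x'| ^ 2 := by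
    intro n j t x t' x' h h' hlt
    rw [hRd] at h h'
    have hn : (0:ℝ) < (n:ℝ) + 1 := by positivity
    have h1 : t - 1 / ((n:ℝ) + 1) < t' := by
      rw [sub_lt_comm, lt_div_iff₀ hn]; nlinarith [h.2.2.2.1, h'.2.2.1]
    have h2 : c0 * √(t - t') < |x' - x| := by
      by_contra hcon; push Not at hcon
      exact h.2.2.2.2 t' h'.1 h1 hlt x' hcon h'.2.1
    have h3 := Real.sq_sqrt (show 0 ≤ t - t' by linarith)
    have h4 : (c0 * √(t - t')) ^ 2 ≤ |x' - x| ^ 2 := pow_le_pow_left₀ (by positivity) h2.le 2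
    rw [mul_pow, h3] at h4
    rw [abs_of_pos (by linarith), abs_sub_comm x x', one_div, inv_mul_eq_div, le_div_iff₀ (by positivity)]
    linarith
  have null : ∀ n j, volume {t | ∃ x, R n j t x} = 0 := fun n j => by
    refine null_of_holder (C := 1 / c0 ^ 2) (by positivity) fun t x t' x' h h' => ?_
    rcases lt_trichotomy t t' with hlt | rfl | hlt
    · rw [abs_sub_comm, abs_sub_comm x]; exact main n j _ _ _ _ h' h hlt
    · rw [sub_self, abs_zero]; positivity
    · exact main n j _ _ _ _ h h' hlt
  by_contra hcon
  push Not at hcon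
  have hsub : Icc (1:ℝ) 2 ⊆ ⋃ n : ℕ, ⋃ j : ℤ, {t | ∃ x, R n j t x} := by
    intro t ht
    have ht2 : 1 / 2 < t := by linarith [ht.1]
    obtain ⟨x, hx⟩ := hcon t ht2
    obtain ⟨ε, hε, h⟩ := hA t ht2 x
    obtain ⟨n, hn⟩ := exists_nat_one_div_lt hε
    refine mem_iUnion.2 ⟨n, mem_iUnion.2 ⟨⌊t * ((n:ℝ) + 1)⌋, x, ?_⟩⟩
    rw [hRd]
    exact ⟨ht2, hx, Int.floor_le _, Int.lt_floor_add_one _, fun t' h1 h2 h3 => h t' h1 (by linarith) h3⟩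
  have h0 : volume (Icc (1:ℝ) 2) = 0 :=
    measure_mono_null hsub (measure_iUnion_null fun n => measure_iUnion_null fun j => null n j)
  rw [Real.volume_Icc] at h0
  norm_num at h0

lemma finite_zeros {u u' : ℝ → ℝ} (hu : ∀ y, HasDerivAt u (u' y) y) (hs : ∀ y, u y = 0 → u' y ≠ 0)
    (A B : ℝ) : {y ∈ Icc A B | u y = 0}.Finite := by
  have hcont : Continuous u := continuous_iff_continuousAt.2 fun y => (hu y).continuousAt
  by_contra hinf
  obtain ⟨z, _, hz⟩ := Set.Infinite.exists_accPt_of_subset_isCompact hinf (isCompact_Icc (a := A) (b := B))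
    (sep_subset _ _)
  have hfr : ∃ᶠ y in 𝓝[≠] z, y ∈ {y ∈ Icc A B | u y = 0} := accPt_iff_frequently_nhdsNE.1 hz
  have hz0 : u z = 0 := by
    by_contra hne
    have : ∀ᶠ y in 𝓝[≠] z, u y ≠ 0 := (hcont.continuousAt.eventually_ne hne).filter_mono nhdsWithin_le_nhds
    obtain ⟨y, h1, h2⟩ := (hfr.and_eventually this).exists
    exact h2 h1.2
  obtain ⟨y, h1, h2⟩ := (hfr.and_eventually ((hu z).eventually_ne (c := 0) (hs z hz0))).exists
  exact h2 h1.2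

lemma not_pat {u u' : ℝ → ℝ} (hper : ∀ y, u (y + 2 * π) = u y)
    (hu : ∀ y, HasDerivAt u (u' y) y) (hs : ∀ y, u y = 0 → u' y ≠ 0) :
    ∃ k, ¬ Pat u k := by
  have hcont : Continuous u := continuous_iff_continuousAt.2 fun y => (hu y).continuousAt
  have pi0 : 0 < 2 * π := by positivity
  have hfin := finite_zeros hu hs 0 (4 * π)
  refine ⟨hfin.toFinset.card + 2, ?_⟩
  rintro ⟨x, h1, h2, h3⟩
  obtain ⟨k, hk⟩ : ∃ k, k = hfin.toFinset.card := ⟨_, rfl⟩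
  rw [← hk] at h1 h2 h3
  obtain ⟨n, hn⟩ : ∃ n : ℤ, x 0 + n * (2 * π) ∈ Ico 0 (0 + 2 * π) := by
    obtain ⟨n, hn, -⟩ := existsUnique_add_zsmul_mem_Ico pi0 (x 0) 0
    exact ⟨n, by simpa using hn⟩
  have hsh : ∀ y, u (y + n * (2 * π)) = u y := fun y =>
    (show Function.Periodic u (2 * π) from hper).int_mul n y
  have hz : ∀ i : ℕ, ∃ y, i < k + 1 → x i < y ∧ y < x (i + 1) ∧ u y = 0 := fun i => by
    by_cases hi : i < k + 1
    · have hlt := h1 i (i + 1) (by omega) (by omega)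
      have s1 := h3 i (by omega)
      have s2 := h3 (i + 1) (by omega)
      rw [pow_succ] at s2
      have c1 : ContinuousOn (fun y => (-1:ℝ) ^ i * u y) (Icc (x i) (x (i + 1))) := by fun_prop
      have := intermediate_value_Ioo' hlt.le c1
      obtain ⟨y, hy, hy0⟩ := this (show (0:ℝ) ∈ Ioo _ _ from ⟨by linarith, s1⟩)
      refine ⟨y, fun _ => ⟨hy.1, hy.2, ?_⟩⟩
      simpa using hy0
    · exact ⟨0, fun h => absurd h hi⟩
  choose y hy using hz
  have hle : ∀ i j, i ≤ j → j < k + 2 → x i ≤ x j := fun i j hij hj => by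
    rcases hij.eq_or_lt with rfl | h
    · exact le_rfl
    · exact (h1 i j h hj).le
  have ymono : ∀ i j, i < j → j < k + 1 → y i < y j := fun i j hij hj => by
    have := (hy i (by omega)).2.1
    have := (hy j hj).1
    have := hle (i + 1) j hij (by omega)
    linarith
  have hcard : (Finset.range (k + 1)).card ≤ hfin.toFinset.card := by
    refine Finset.card_le_card_of_injOn (fun i => y i + n * (2 * π)) ?_ ?_
    · intro i hi
      have hi' : i < k + 1 := by simpa using hi
      have a1 := hy i hi'
      have a2 := hle 0 i (by omega) (by omega)
      have a3 := h2 (i + 1) (by omega)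
      have a4 := hn.1
      have a5 := hn.2
      simp only [Finite.coe_toFinset, mem_ofPred_eq, mem_Icc]
      refine ⟨⟨by linarith, by linarith⟩, ?_⟩
      rw [hsh]; exact a1.2.2
    · intro i hi j hj hij
      have hi' : i < k + 1 := by simpa using hi
      have hj' : j < k + 1 := by simpa using hj
      have hij' : y i = y j := by simpa using hij
      rcases lt_trichotomy i j with h | h | h
      · exact absurd hij' (ymono i j h hj').ne
      · exact h
      · exact absurd hij' (ymono j i h hi').ne'
  rw [Finset.card_range, ← hk] at hcard
  omega
end ZN

open Real Set Filter
namespace ZN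
open Topology MeasureTheory

lemma trip_pat2 {u : ℝ → ℝ} {A B : ℝ} (hAB : B < A + 2 * π) (h : Trip u A B) : Pat u 2 := by
  obtain ⟨s, y1, y2, y3, a1, a2, a3, a4, b1, b2, b3⟩ := h
  have mk : ∀ p q : ℝ, p < q → q < p + 2 * π → 0 < u p → u q < 0 → Pat u 2 := fun p q hpq hw hp hq => by
    refine ⟨fun i => if i = 0 then p else q, fun i j hij hj => ?_, fun j hj => ?_, fun j hj => ?_⟩
    · have : i = 0 := by omega
      have : j = 1 := by omega
      subst i j; simpa using hpq
    · interval_cases j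
      · have : 0 < 2 * π := by positivity
        simp [pi_pos]
      · simpa using hw
    · interval_cases j
      · simpa using hp
      · simpa using hq
  rcases lt_trichotomy s 0 with hs | hs | hs
  · refine mk y2 y3 a3 (by linarith) ?_ ?_
    · by_contra hc; push Not at hc; nlinarith
    · by_contra hc; push Not at hc; nlinarith
  · simp [hs] at b1
  · refine mk y1 y2 a2 (by linarith) ?_ ?_
    · by_contra hc; push Not at hc; nlinarith
    · by_contra hc; push Not at hc; nlinarith

lemma no_double {φ φ_x : ℝ → ℝ → ℝ} {T' : ℝ} (hT' : 1 / 2 < T')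
    (cφ : ContinuousOn (fun p : ℝ × ℝ => φ p.1 p.2) (dom 0))
    (pφ : ∀ t > (0:ℝ), ∀ x : ℝ, φ t (x + 2 * π) = φ t x)
    (pφx : ∀ t > (0:ℝ), ∀ x : ℝ, φ_x t (x + 2 * π) = φ_x t x)
    (hB : ∀ t0 > (1 / 2 : ℝ), ∀ x0, φ t0 x0 = 0 → φ_x t0 x0 = 0 → ∀ η > 0,
      ∃ t, t0 - η < t ∧ t < t0 ∧ 1 / 2 < t ∧ Trip (φ t) (x0 - η) (x0 + η))
    (k : ℕ) (hP : ∀ t > T', Pat (φ t) k) (hno : ∀ t > T', ¬ Pat (φ t) (k + 2))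
    (t0 : ℝ) (ht0 : T' < t0) (x0 : ℝ) (z0 : φ t0 x0 = 0) : φ_x t0 x0 ≠ 0 := by
  intro z1
  have pi0 : 0 < 2 * π := by positivity
  have t0p : 0 < t0 := by linarith
  rcases Nat.eq_zero_or_pos k with rfl | hk0
  · obtain ⟨t, h1, h2, h3, h4⟩ := hB t0 (by linarith) x0 z0 z1 (min 1 (t0 - T'))
      (lt_min one_pos (by linarith))
    have e1 := min_le_left 1 (t0 - T')
    have e2 := min_le_right 1 (t0 - T')
    exact hno t (by linarith) (trip_pat2 (by linarith [pi_gt_three]) h4)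
  · obtain ⟨x, m1, m2, m3⟩ := hP t0 ht0
    have hPD : PD (φ t0) k x := ⟨m1, m2, m3⟩
    obtain ⟨n, hn⟩ : ∃ n : ℤ, x0 + n * (2 * π) ∈ Ico (x 0) (x 0 + 2 * π) := by
      obtain ⟨n, hn, -⟩ := existsUnique_add_zsmul_mem_Ico pi0 x0 (x 0)
      exact ⟨n, by simpa using hn⟩
    obtain ⟨w, hw⟩ : ∃ w, w = x0 + n * (2 * π) := ⟨_, rfl⟩
    rw [← hw] at hn
    have w0 : φ t0 w = 0 := by
      rw [hw, (show Function.Periodic (φ t0) (2 * π) from pφ t0 t0p).int_mul n x0]; exact z0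
    have w1 : φ_x t0 w = 0 := by
      rw [hw, (show Function.Periodic (φ_x t0) (2 * π) from pφx t0 t0p).int_mul n x0]; exact z1
    have hne : ∀ j < k, x j ≠ w := fun j hj e => by
      have := m3 j hj
      rw [e, w0, mul_zero] at this
      exact lt_irrefl _ this
    have hlt : x 0 < w := lt_of_le_of_ne hn.1 (hne 0 hk0)
    obtain ⟨j, hj, g1, g2⟩ := hPD.gap hk0 hlt hn.2 hne
    have hev : ∀ᶠ t in 𝓝 t0, ∀ i ∈ Finset.range k, 0 < (-1 : ℝ) ^ i * φ t (x i) := by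
      rw [Filter.eventually_all_finset]
      intro i hi
      have c1 : ContinuousAt (fun t => φ t (x i)) t0 := by
        have h2 : ContinuousAt (fun s : ℝ => (s, x i)) t0 := by fun_prop
        exact ContinuousAt.comp (f := fun s : ℝ => (s, x i)) (g := fun z : ℝ × ℝ => φ z.1 z.2) (x := t0)
          (cφ.continuousAt (dom_nhds _ t0p)) h2
      exact (c1.const_mul ((-1 : ℝ) ^ i)).eventually (Ioi_mem_nhds (m3 i (by simpa using hi)))
    obtain ⟨ε, hε, hb⟩ := Metric.eventually_nhds_iff.1 hev
    obtain ⟨η, hη⟩ : ∃ η, η = min (min ε (t0 - T')) (min ((w - x j) / 2) ((nxt x k j - w) / 2)) := ⟨_, rfl⟩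
    have e1 : η ≤ ε := by rw [hη]; exact (min_le_left _ _).trans (min_le_left _ _)
    have e2 : η ≤ t0 - T' := by rw [hη]; exact (min_le_left _ _).trans (min_le_right _ _)
    have e3 : η ≤ (w - x j) / 2 := by rw [hη]; exact (min_le_right _ _).trans (min_le_left _ _)
    have e4 : η ≤ (nxt x k j - w) / 2 := by rw [hη]; exact (min_le_right _ _).trans (min_le_right _ _)
    have hη0 : 0 < η := by
      rw [hη]; exact lt_min (lt_min hε (by linarith)) (lt_min (by linarith) (by linarith))
    obtain ⟨t, h1, h2, h3, s, y1, y2, y3, a1, a2, a3, a4, b1, b2, b3⟩ := hB t0 (by linarith) w w0 w1 η hη0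
    have hd : dist t t0 < ε := by
      rw [Real.dist_eq, abs_sub_comm, abs_of_pos (by linarith)]; linarith
    have hPD' : PD (φ t) k x := ⟨m1, m2, fun i hi => hb hd i (by simpa using hi)⟩
    exact hno t (by linarith) (hPD'.insert_triple hj (by linarith) a2 a3 (by linarith) b1 b2 b3)

theorem Sol.main {δ M : ℝ} {a b c a_t a_x φ φ_t φ_x φ_xx : ℝ → ℝ → ℝ}
    (h : Sol δ M a b c a_t a_x φ φ_t φ_x φ_xx) :
    ∃ T > (0:ℝ), ∃ N : ℕ, ∀ t ≥ T,
      (∀ x : ℝ, φ t x = 0 → φ_x t x ≠ 0) ∧ zeroNum (φ t) = (N : ℕ∞) := by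
  obtain ⟨m, K, l, M', s, θ, Y, Yt, Yx, X, vt, vy, vyy, hch⟩ := h.chart
  obtain ⟨c0, hc0, hA⟩ := hch.A
  obtain ⟨t1, ht1, hz1⟩ := exists_time (Z := fun t x => φ t x = 0 ∧ φ_x t x = 0) hc0 hA
  have t1p : 0 < t1 := by linarith
  have mono := pat_mono M a b c φ φ_t φ_x φ_xx (fun t ht x => (h.bound t ht x).2.2.2.2)
    (fun t ht x => h.hδ.trans_le (h.pos t ht x)) h.pφ h.cφ h.dφt h.dφx h.dφxx h.eq
  have hev : ∀ j : ℕ, Even (2 * j) := fun j => even_two_mul j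
  obtain ⟨k0, hk0⟩ := not_pat (h.pφ t1 t1p) (h.dφx t1 t1p) (fun y h0 h1 => hz1 y ⟨h0, h1⟩)
  obtain ⟨j, hj, hj'⟩ : ∃ j : ℕ, (∀ t ≥ t1, Pat (φ t) (2 * j)) ∧ ¬ ∀ t ≥ t1, Pat (φ t) (2 * (j + 1)) := by
    by_contra hcon
    push Not at hcon
    have hall : ∀ j : ℕ, ∀ t ≥ t1, Pat (φ t) (2 * j) := fun j => by
      induction j with
      | zero => exact fun t _ => ⟨fun _ => 0, by simp, by simp, by simp⟩
      | succ j ih => exact hcon j ih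
    exact hk0 ((hall k0 t1 le_rfl).prefix (by omega))
  push Not at hj'
  obtain ⟨T', hT', hnP⟩ := hj'
  have hno : ∀ t ≥ T', ¬ Pat (φ t) (2 * j + 2) := fun t ht hP =>
    hnP (mono (2 * (j + 1)) (hev _) T' t (by linarith) ht hP)
  have pφx : ∀ t > (0:ℝ), ∀ x : ℝ, φ_x t (x + 2 * π) = φ_x t x := fun t ht x => by
    have d1 : HasDerivAt (fun z => φ t (z + 2 * π)) (φ_x t (x + 2 * π)) x :=
      (h.dφx t ht (x + 2 * π)).comp_add_const x (2 * π)
    rw [show (fun z => φ t (z + 2 * π)) = φ t from funext (h.pφ t ht)] at d1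
    exact d1.unique (h.dφx t ht x)
  have nd := no_double (by linarith : 1 / 2 < T') h.cφ h.pφ pφx
    (fun t0 ht0 x0 z0 z1 η hη => hch.B ht0 z0 z1 hη) (2 * j)
    (fun t ht => hj t (by linarith)) (fun t ht => hno t (le_of_lt ht))
  refine ⟨T' + 1, by linarith, 2 * j, fun t ht => ?_⟩
  have htT : T' < t := by linarith
  have tp : 0 < t := by linarith
  exact ⟨nd t htT, count_zeros (h.pφ t tp) (h.dφx t tp) (nd t htT) (2 * j) (hev j)
    (hj t (by linarith)) (hno t htT.le)⟩
end ZN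

theorem stmt3
    (δ : ℝ) (hδ : 0 < δ)
    (a b c a_t a_x : ℝ → ℝ → ℝ)
    (φ φ_t φ_x φ_xx : ℝ → ℝ → ℝ)
    (ha_cont : ContinuousOn (fun p : ℝ × ℝ => a p.1 p.2) (Set.Ioi 0 ×ˢ Set.univ))
    (hb_cont : ContinuousOn (fun p : ℝ × ℝ => b p.1 p.2) (Set.Ioi 0 ×ˢ Set.univ))
    (hc_cont : ContinuousOn (fun p : ℝ × ℝ => c p.1 p.2) (Set.Ioi 0 ×ˢ Set.univ))
    (hat_cont : ContinuousOn (fun p : ℝ × ℝ => a_t p.1 p.2) (Set.Ioi 0 ×ˢ Set.univ))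
    (hax_cont : ContinuousOn (fun p : ℝ × ℝ => a_x p.1 p.2) (Set.Ioi 0 ×ˢ Set.univ))
    (ha_t : ∀ t > (0:ℝ), ∀ x : ℝ, HasDerivAt (fun s => a s x) (a_t t x) t)
    (ha_x : ∀ t > (0:ℝ), ∀ x : ℝ, HasDerivAt (fun y => a t y) (a_x t x) x)
    (M : ℝ)
    (hbound : ∀ t > (0:ℝ), ∀ x : ℝ,
      |a t x| ≤ M ∧ |a_t t x| ≤ M ∧ |a_x t x| ≤ M ∧ |b t x| ≤ M ∧ |c t x| ≤ M)
    (ha_pos : ∀ t > (0:ℝ), ∀ x : ℝ, δ ≤ a t x)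
    (ha_per : ∀ t > (0:ℝ), ∀ x : ℝ, a t (x + 2 * Real.pi) = a t x)
    (hb_per : ∀ t > (0:ℝ), ∀ x : ℝ, b t (x + 2 * Real.pi) = b t x)
    (hc_per : ∀ t > (0:ℝ), ∀ x : ℝ, c t (x + 2 * Real.pi) = c t x)
    (hφ_per : ∀ t > (0:ℝ), ∀ x : ℝ, φ t (x + 2 * Real.pi) = φ t x)
    (hφ_cont : ContinuousOn (fun p : ℝ × ℝ => φ p.1 p.2) (Set.Ioi 0 ×ˢ Set.univ))
    (hφt_cont : ContinuousOn (fun p : ℝ × ℝ => φ_t p.1 p.2) (Set.Ioi 0 ×ˢ Set.univ))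
    (hφx_cont : ContinuousOn (fun p : ℝ × ℝ => φ_x p.1 p.2) (Set.Ioi 0 ×ˢ Set.univ))
    (hφxx_cont : ContinuousOn (fun p : ℝ × ℝ => φ_xx p.1 p.2) (Set.Ioi 0 ×ˢ Set.univ))
    (hφ_t : ∀ t > (0:ℝ), ∀ x : ℝ, HasDerivAt (fun s => φ s x) (φ_t t x) t)
    (hφ_x : ∀ t > (0:ℝ), ∀ x : ℝ, HasDerivAt (fun y => φ t y) (φ_x t x) x)
    (hφ_xx : ∀ t > (0:ℝ), ∀ x : ℝ, HasDerivAt (fun y => φ_x t y) (φ_xx t x) x)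
    (heq : ∀ t > (0:ℝ), ∀ x : ℝ,
      φ_t t x = a t x * φ_xx t x + b t x * φ_x t x + c t x * φ t x)
    (hnontriv : ∀ t > (0:ℝ), ∃ x : ℝ, φ t x ≠ 0) :
    ∃ T > (0:ℝ), ∃ N : ℕ, ∀ t ≥ T,
      (∀ x : ℝ, φ t x = 0 → φ_x t x ≠ 0) ∧ zeroNum (φ t) = (N : ℕ∞) := by
  exact ZN.Sol.main ⟨hδ, ha_cont, hat_cont, hax_cont, ha_t, ha_x, hbound, ha_pos, ha_per, hφ_per,
    hφ_cont, hφt_cont, hφx_cont, hφxx_cont, hφ_t, hφ_x, hφ_xx, heq, hnontriv⟩
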